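/- Let q be a prime power. Then (q,4) ∈ B(3,2), except possibly for q ∈ {2, 4, 8, 16, 3, 9, 27, 5, 25, 7, 11, 13, 17, 19, 23, 29, 31, 37, 41, 43, 47, 83}. -/

import Mathlib

open Polynomial

noncomputable section

/-- An element of a finite field is *primitive* if it generates the multiplicative group. -/
def IsPrimitiveElem {L : Type} [Field L] [Fintype L] (α : L) : Prop :=
  orderOf α = Fintype.card L - 1

/-- `β` is a *normal element* of `L` over `K`, where `n = [L : K]`:
the conjugates `β, β^q, …, β^(q^(n-1))` form a `K`-basis of `L`. -/
def IsNormalElem (K : Type) {L : Type} [Field K] [Fintype K] [Field L] [Algebra K L]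
    (n : ℕ) (β : L) : Prop :=
  LinearIndependent K (fun i : Fin n => β ^ Fintype.card K ^ (i : ℕ)) ∧
    Submodule.span K (Set.range fun i : Fin n => β ^ Fintype.card K ^ (i : ℕ)) = ⊤

/-- The set `Υ_Q(m₁, m₂)` of rational functions over the field `F` with `Q` elements. -/
def Upsilon (F : Type) [Field F] [Fintype F] (m₁ m₂ : ℕ) : Set (RatFunc F) :=
  {f | ∃ f₁ f₂ : F[X], f₂ ≠ 0 ∧
      f = algebraMap F[X] (RatFunc F) f₁ / algebraMap F[X] (RatFunc F) f₂ ∧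
      f₁.natDegree ≤ m₁ ∧ f₂.natDegree ≤ m₂ ∧ IsCoprime f₁ f₂ ∧
      ∃ (k : ℕ) (g : F[X]), 0 < k ∧ g.Monic ∧ Irreducible g ∧ g ≠ X ∧
        Nat.gcd k (Fintype.card F - 1) = 1 ∧
        g ^ k ∣ f₁ * f₂ ∧ ¬ g ^ (k + 1) ∣ f₁ * f₂}

/-- Evaluation of a rational function at a point of the same field (`0` if undefined). -/
def ratEval {F : Type} [Field F] (f : RatFunc F) (α : F) : F :=
  f.eval (RingHom.id F) α

/-- `α` is `s`-free. -/
def IsFree {F : Type} [Field F] (s : ℕ) (α : F) : Prop :=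
  α ≠ 0 ∧ ∀ d : ℕ, d ∣ s → d ≠ 1 → ¬ ∃ β : F, β ^ d = α

/-- The `F_q[x]`-module action `h ∘ β = ∑ hᵢ β^(qⁱ)` on `L`. -/
def polyAct {K L : Type} [Field K] [Fintype K] [Field L] [Algebra K L]
    (h : K[X]) (β : L) : L :=
  h.sum fun i a => algebraMap K L a * β ^ Fintype.card K ^ i

/-- `α` is `g`-free with respect to the `F_q[x]`-module structure of `L`. -/
def IsPolyFree (K : Type) {L : Type} [Field K] [Fintype K] [Field L] [Algebra K L]
    (g : K[X]) (α : L) : Prop :=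
  ∀ h : K[X], h.Monic → h ∣ g → (∃ lam : L, α = polyAct h lam) → h = 1

/-- `N_f(e₁, e₂, g)`: the number of `α ∈ L` such that `α` is `e₁`-free,
`f(α)` is `e₂`-free and `α` is `g`-free. -/
def NElems (K : Type) {L : Type} [Field K] [Fintype K] [Field L] [Fintype L] [Algebra K L]
    (f : RatFunc L) (e₁ e₂ : ℕ) (g : K[X]) : ℕ :=
  Nat.card {α : L | IsFree e₁ α ∧ IsFree e₂ (ratEval f α) ∧ IsPolyFree K g α}

/-- `W(ℓ)`: the number of squarefree divisors of `ℓ`. -/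
def Wnat (ℓ : ℕ) : ℕ := (ℓ.divisors.filter Squarefree).card

/-- `W_q(g)`: the number of monic squarefree divisors of `g` in `F_q[x]`. -/
def Wpoly {K : Type} [Field K] (g : K[X]) : ℕ :=
  Nat.card {h : K[X] // h.Monic ∧ Squarefree h ∧ h ∣ g}

/-- `Φ(g) = |(F_q[x]/(g))ˣ|`. -/
def PhiPoly {K : Type} [Field K] (g : K[X]) : ℕ :=
  Nat.card ((K[X] ⧸ Ideal.span ({g} : Set K[X]))ˣ)

/-- `(q, n) ∈ B(m₁, m₂)`: for every `f ∈ Υ_{qⁿ}(m₁, m₂)` there is a primitive element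
`α` of `F_{qⁿ}`, normal over `F_q`, with `f(α)` also primitive. -/
def memB (m₁ m₂ q n : ℕ) : Prop :=
  ∀ (K L : Type) [Field K] [Field L] [Fintype K] [Fintype L] [Algebra K L],
    Fintype.card K = q → Fintype.card L = q ^ n →
    ∀ f ∈ Upsilon L m₁ m₂,
      ∃ α : L, IsPrimitiveElem α ∧ IsNormalElem K n α ∧ IsPrimitiveElem (ratEval f α)

/-- `𝔑(q, n)`: the number of primitive elements of `F_{qⁿ}` that are normal over `F_q`. -/
def NNum (K L : Type) [Field K] [Fintype K] [Field L] [Fintype L] [Algebra K L] (n : ℕ) : ℕ :=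
  Nat.card {α : L | IsPrimitiveElem α ∧ IsNormalElem K n α}

end

open Polynomial

namespace Stp

variable {𝕜 : Type*} [Field 𝕜]

lemma pow_dvd_hasse (F G : 𝕜[X]) (N : ℕ) : ∀ l : ℕ, F ^ (N - l) ∣ hasseDeriv l (G * F ^ N) := by
  induction N with
  | zero => intro l; simp
  | succ N ih =>
    intro l
    have : G * F ^ (N + 1) = F * (G * F ^ N) := by ring
    rw [this, hasseDeriv_mul]
    refine Finset.dvd_sum fun ab hab => ?_
    obtain ⟨a, b⟩ := ab
    rw [Finset.HasAntidiagonal.mem_antidiagonal] at hab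
    simp only at hab ⊢
    rcases Nat.eq_zero_or_pos a with ha | ha
    · subst ha
      have : b = l := by omega
      subst this
      rw [hasseDeriv_zero']
      refine (pow_dvd_pow F (show N + 1 - b ≤ (N - b) + 1 by omega)).trans ?_
      rw [pow_succ, mul_comm]
      exact mul_dvd_mul_left F (ih b)
    · exact Dvd.dvd.mul_left ((pow_dvd_pow F (by omega)).trans (ih b)) _

lemma hasse_mul_const (n : ℕ) (Y : 𝕜[X]) (hY : ∀ b, 0 < b → b < n → hasseDeriv b Y = 0)
    (A : 𝕜[X]) (l : ℕ) (hl : l < n) : hasseDeriv l (A * Y) = hasseDeriv l A * Y := by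
  rw [hasseDeriv_mul]
  rw [Finset.sum_eq_single (l, 0)]
  · simp
  · rintro ⟨a, b⟩ hab hne
    rw [Finset.HasAntidiagonal.mem_antidiagonal] at hab
    simp only at hab ⊢
    rw [hY b, mul_zero]
    · rcases Nat.eq_zero_or_pos b with hb | hb
      · exfalso; apply hne; ext <;> simp <;> omega
      · exact hb
    · omega
  · intro h; simp at h

lemma hasse_mul_const_pow (n : ℕ) (Y : 𝕜[X]) (hY : ∀ b, 0 < b → b < n → hasseDeriv b Y = 0)
    (A : 𝕜[X]) (l : ℕ) (hl : l < n) (j : ℕ) :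
    hasseDeriv l (A * Y ^ j) = hasseDeriv l A * Y ^ j := by
  induction j generalizing A with
  | zero => simp
  | succ j ih =>
    rw [pow_succ, ← mul_assoc, hasse_mul_const n Y hY _ l hl, ih, mul_assoc]

lemma hasse_frob (p n : ℕ) [hp : Fact p.Prime] [CharP 𝕜 p] (δ : 𝕜) (b : ℕ) (h0 : 0 < b)
    (h1 : b < p ^ n) : hasseDeriv b ((X - C δ) ^ (p ^ n) : 𝕜[X]) = 0 := by
  rw [sub_pow_char_pow, map_sub, ← C_pow, hasseDeriv_C _ _ h0, sub_zero, ← monomial_one_right_eq_X_pow,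
    hasseDeriv_monomial]
  have : p ∣ (p ^ n).choose b := by
    apply hp.out.dvd_choose_pow h0.ne' h1.ne
  rw [(CharP.cast_eq_zero_iff 𝕜 p _).2 this]
  simp

lemma dvd_of_hasse (R : 𝕜[X]) (x : 𝕜) (M : ℕ) (h : ∀ l < M, (hasseDeriv l R).eval x = 0) :
    (X - C x) ^ M ∣ R := by
  rw [X_sub_C_pow_dvd_iff, X_pow_dvd_iff]
  intro d hd
  have := taylor_coeff x R d
  rw [taylor_apply] at this
  rw [this, h d hd]

lemma card_mul_le (R : 𝕜[X]) (hR : R ≠ 0) (Z : Finset 𝕜) (M : ℕ)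
    (h : ∀ x ∈ Z, (X - C x) ^ M ∣ R) : Z.card * M ≤ R.natDegree := by
  have h1 : ∏ x ∈ Z, (X - C x) ^ M ∣ R := by
    apply Finset.prod_dvd_of_coprime _ h
    intro x _ y _ hxy
    exact (pairwise_coprime_X_sub_C Function.injective_id hxy).pow
  have h2 := natDegree_le_of_dvd h1 hR
  rw [natDegree_prod _ _ (fun x _ => pow_ne_zero _ (X_sub_C_ne_zero x))] at h2
  simpa using h2

lemma sum_ne_zero_of_orders {ι : Type*} (s : Finset ι) (T : ι → 𝕜[X]) (δ : 𝕜) (o : ι → ℕ)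
    (hT : ∀ i ∈ s, T i ≠ 0 → (X - C δ) ^ (o i) ∣ T i ∧ ¬ (X - C δ) ^ (o i + 1) ∣ T i)
    (hinj : ∀ i ∈ s, ∀ j ∈ s, T i ≠ 0 → T j ≠ 0 → o i = o j → i = j)
    (hne : ∃ i ∈ s, T i ≠ 0) : ∑ i ∈ s, T i ≠ 0 := by
  classical
  obtain ⟨i0, hi0, hmin⟩ := Finset.exists_min_image (s.filter fun i => T i ≠ 0) o (by
    obtain ⟨i, hi, h⟩ := hne
    exact ⟨i, by simp [hi, h]⟩)
  rw [Finset.mem_filter] at hi0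
  intro hsum
  rw [← Finset.add_sum_erase s T hi0.1] at hsum
  apply (hT i0 hi0.1 hi0.2).2
  rw [eq_neg_of_add_eq_zero_left hsum]
  rw [dvd_neg]
  refine Finset.dvd_sum fun j hj => ?_
  rw [Finset.mem_erase] at hj
  by_cases hj0 : T j = 0
  · rw [hj0]; exact dvd_zero _
  refine (pow_dvd_pow _ ?_).trans (hT j hj.2 hj0).1
  have h1 := hmin j (by simp [hj.2, hj0])
  have h2 : o i0 ≠ o j := fun h => hj.1 (hinj i0 hi0.1 j hj.2 hi0.2 hj0 h).symm
  omega

/-- Existence of the auxiliary coefficients. -/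
lemma exists_coeffs (d J B M T : ℕ) (a δ' : 𝕜) (U : ℕ → ℕ → ℕ → 𝕜[X])
    (hU : ∀ l i b, l < M → b < B → (U l i b).natDegree + J ≤ T)
    (_hJ : 0 < J)
    (hcount : M * T < d * J * B) :
    ∃ c : Fin d × Fin J × Fin B → 𝕜, c ≠ 0 ∧ ∀ l < M,
      ∑ t : Fin d × Fin J × Fin B, C (c t) * (C (a ^ (t.1 : ℕ)) * U l t.1 t.2.2 *
        (X - C δ') ^ (t.2.1 : ℕ)) = 0 := by
  classical
  let Φ : (Fin d × Fin J × Fin B → 𝕜) →ₗ[𝕜] (Fin M × Fin T → 𝕜) :=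
    { toFun := fun c y => (∑ t : Fin d × Fin J × Fin B, C (c t) * (C (a ^ (t.1 : ℕ)) *
        U y.1 t.1 t.2.2 * (X - C δ') ^ (t.2.1 : ℕ))).coeff y.2
      map_add' := by
        intro c c'
        ext y
        simp only [Pi.add_apply, map_add, add_mul, Finset.sum_add_distrib, coeff_add]
      map_smul' := by
        intro r c
        ext y
        simp only [Pi.smul_apply, smul_eq_mul, map_mul, RingHom.id_apply]
        rw [← coeff_C_mul, Finset.mul_sum]
        simp only [mul_assoc] }
  have hker : LinearMap.ker Φ ≠ ⊥ := by
    apply LinearMap.ker_ne_bot_of_finrank_lt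
    simp only [Module.finrank_fintype_fun_eq_card, Fintype.card_prod, Fintype.card_fin]
    rw [← mul_assoc]; exact hcount
  obtain ⟨c, hc, hc0⟩ := Submodule.exists_mem_ne_zero_of_ne_bot hker
  refine ⟨c, hc0, fun l hl => ?_⟩
  rw [LinearMap.mem_ker] at hc
  ext n
  rw [coeff_zero]
  by_cases hn : n < T
  · exact congrFun hc (⟨l, hl⟩, ⟨n, hn⟩)
  · rw [finsetSum_coeff]
    refine Finset.sum_eq_zero fun t _ => ?_
    apply coeff_eq_zero_of_natDegree_lt
    refine lt_of_le_of_lt ((natDegree_C_mul_le _ _).trans (natDegree_mul_le.trans (add_le_add_left (natDegree_C_mul_le _ _) _))) ?_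
    rw [natDegree_pow, natDegree_X_sub_C, mul_one]
    have := hU l t.1 t.2.2 hl t.2.2.2
    have := t.2.1.2
    omega

theorem stepanov_core (p n d h e J B M m T : ℕ) [hp : Fact p.Prime] [CharP 𝕜 p]
    (F W : 𝕜[X]) (δ a : 𝕜)
    (hF : F = (X - C δ) ^ e * W) (hW : W.eval δ ≠ 0) (hm : F.natDegree ≤ m)
    (hed : Nat.Coprime e d) (hq : p ^ n = d * h + 1)
    (hBJ : B + J ≤ h + 1) (hJ : 0 < J) (hMq : M ≤ p ^ n)
    (hT : B + M * m + J ≤ T) (hcount : M * T < d * J * B)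
    (Z : Finset 𝕜) (hZ : ∀ x ∈ Z, x ^ p ^ n = x ∧ F.eval x ≠ 0 ∧ F.eval x ^ h = a) :
    Z.card * M ≤ M * m + d * h * m + J * p ^ n := by
  classical
  have hW0 : W ≠ 0 := by rintro rfl; simp at hW
  have hF0 : F ≠ 0 := by
    rw [hF]; exact mul_ne_zero (pow_ne_zero _ (X_sub_C_ne_zero δ)) hW0
  -- quotient of derivatives
  have hex : ∀ l i b : ℕ, ∃ V : 𝕜[X], hasseDeriv l (X ^ b * F ^ (M + i * h)) =
      F ^ (M + i * h - l) * V := fun l i b => pow_dvd_hasse F (X ^ b) (M + i * h) l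
  choose U hU using hex
  have hUdeg : ∀ l i b, l < M → b < B → (U l i b).natDegree + J ≤ T := by
    intro l i b hl hb
    by_cases h0 : U l i b = 0
    · rw [h0]; simp; omega
    have h1 : (hasseDeriv l (X ^ b * F ^ (M + i * h))).natDegree ≤ b + (M + i * h) * F.natDegree := by
      refine (natDegree_hasseDeriv_le _ _).trans ((Nat.sub_le _ _).trans ?_)
      refine natDegree_mul_le.trans ?_
      rw [natDegree_X_pow, natDegree_pow]
    rw [hU, natDegree_mul (pow_ne_zero _ hF0) h0, natDegree_pow] at h1
    have h2 : (M + i * h) * F.natDegree = (M + i * h - l) * F.natDegree + l * F.natDegree := by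
      rw [← add_mul]; congr 1; omega
    have h3 : l * F.natDegree ≤ M * m := Nat.mul_le_mul hl.le hm
    omega
  obtain ⟨c, hc0, hc⟩ := exists_coeffs d J B M T a (δ ^ p ^ n) U hUdeg hJ hcount
  -- group terms
  let r : Fin d × Fin J → 𝕜[X] := fun ij => ∑ b : Fin B, C (c (ij.1, ij.2, b)) * X ^ (b : ℕ)
  let Tm : Fin d × Fin J → 𝕜[X] := fun ij => r ij * F ^ (M + ij.1 * h) * ((X - C δ) ^ p ^ n) ^ (ij.2 : ℕ)
  let R : 𝕜[X] := ∑ ij, Tm ij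
  have hrcoeff : ∀ ij (b : Fin B), (r ij).coeff b = c (ij.1, ij.2, b) := by
    intro ij b
    simp only [r, finsetSum_coeff, coeff_C_mul, coeff_X_pow]
    rw [Finset.sum_eq_single b]
    · simp
    · intro b' _ hb'
      have : (b : ℕ) ≠ (b' : ℕ) := fun hh => hb' (Fin.ext hh.symm)
      simp [this]
    · simp
  have hrdeg : ∀ ij, r ij ≠ 0 → (r ij).natDegree < B := by
    intro ij hne
    rw [natDegree_lt_iff_degree_lt hne]
    refine (degree_sum_le _ _).trans_lt ?_
    rw [Finset.sup_lt_iff (by exact WithBot.bot_lt_coe B)]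
    intro b _
    refine (degree_C_mul_X_pow_le _ _).trans_lt ?_
    exact_mod_cast b.2
  have hTm0 : ∀ ij, Tm ij ≠ 0 → r ij ≠ 0 := by
    intro ij h1 h2; apply h1; simp only [Tm, h2, zero_mul]
  have hR0 : R ≠ 0 := by
    apply sum_ne_zero_of_orders Finset.univ Tm δ
      (fun ij => (r ij).rootMultiplicity δ + e * (M + ij.1 * h) + p ^ n * ij.2)
    · intro ij _ hne
      have hr := hTm0 ij hne
      obtain ⟨w, hw⟩ := pow_rootMultiplicity_dvd (r ij) δ
      have hwe : w.eval δ ≠ 0 := by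
        intro hh
        obtain ⟨w', hw'⟩ := dvd_iff_isRoot.2 hh
        apply (rootMultiplicity_le_iff hr δ _).1 le_rfl
        refine ⟨w', ?_⟩
        rw [pow_succ, mul_assoc, ← hw', ← hw]
      have key : Tm ij = (X - C δ) ^ ((r ij).rootMultiplicity δ + e * (M + ij.1 * h) + p ^ n * ij.2) *
          (w * W ^ (M + ij.1 * h)) := by
        simp only [Tm]
        conv_lhs => rw [hw, hF]
        rw [mul_pow, ← pow_mul, ← pow_mul, pow_add, pow_add]
        ring
      rw [key]
      refine ⟨dvd_mul_right _ _, fun hdvd => ?_⟩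
      rw [pow_succ, mul_dvd_mul_iff_left (pow_ne_zero _ (X_sub_C_ne_zero δ)), dvd_iff_isRoot,
        IsRoot, eval_mul, eval_pow] at hdvd
      exact (mul_ne_zero hwe (pow_ne_zero _ hW)) hdvd
    · rintro ⟨i, j⟩ _ ⟨i', j'⟩ _ h1 h2 ho
      have hr1 := hrdeg _ (hTm0 _ h1)
      have hr2 := hrdeg _ (hTm0 _ h2)
      have e1 : (r (i, j)).rootMultiplicity δ < B :=
        lt_of_le_of_lt ((Polynomial.count_roots (r (i,j)) (a := δ)) ▸ (Multiset.count_le_card _ _).trans (card_roots' _)) hr1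
      have e2 : (r (i', j')).rootMultiplicity δ < B :=
        lt_of_le_of_lt ((Polynomial.count_roots (r (i',j')) (a := δ)) ▸ (Multiset.count_le_card _ _).trans (card_roots' _)) hr2
      simp only at ho
      set u := (r (i, j)).rootMultiplicity δ
      set u' := (r (i', j')).rootMultiplicity δ
      rw [hq] at ho
      have hj := j.2
      have hj' := j'.2
      have hi := i.2
      have hi' := i'.2
      -- h * (e i + d j) + (j + u) = h * (e i' + d j') + (j' + u')
      have ho2 : h * (e * i + d * j) + (j + u) = h * (e * i' + d * j') + (j' + u') := by
        have : (u:ℤ) + e * (M + i * h) + (d * h + 1) * j = u' + e * (M + i' * h) + (d * h + 1) * j' := by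
          exact_mod_cast ho
        have : (h:ℤ) * (e * i + d * j) + (j + u) = h * (e * i' + d * j') + (j' + u') := by
          linarith
        exact_mod_cast this
      have hlt1 : (j:ℕ) + u < h := by omega
      have hlt2 : (j':ℕ) + u' < h := by omega
      have hdiv : e * i + d * j = e * i' + d * j' := by
        have : (h * (e * i + d * j) + (j + u)) / h = (h * (e * i' + d * j') + (j' + u')) / h := by
          rw [ho2]
        rwa [Nat.mul_add_div (by omega), Nat.mul_add_div (by omega), Nat.div_eq_of_lt hlt1,
          Nat.div_eq_of_lt hlt2, add_zero, add_zero] at this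
      have hmod : (e * i) ≡ (e * i') [MOD d] := by
        have : (e * i + d * j) ≡ (e * i' + d * j') [MOD d] := by rw [hdiv]
        simpa [Nat.ModEq] using this
      have hii : (i : ℕ) = i' := by
        have := Nat.ModEq.cancel_left_of_coprime (c := e) (by rw [Nat.gcd_comm]; exact hed) hmod
        exact Nat.ModEq.eq_of_lt_of_lt this hi hi'
      rw [hii] at hdiv
      have hjj : (j : ℕ) = j' := by
        have : d * j = d * j' := by omega
        exact Nat.eq_of_mul_eq_mul_left (by omega) this
      ext <;> simp [hii, hjj]
    · by_contra hall
      push Not at hall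
      apply hc0
      funext t
      have h1 := hall (t.1, t.2.1) (Finset.mem_univ _)
      have h2 : r (t.1, t.2.1) = 0 := by
        by_contra hne
        exact (mul_ne_zero (mul_ne_zero hne (pow_ne_zero _ hF0))
          (pow_ne_zero _ (pow_ne_zero _ (X_sub_C_ne_zero δ)))) h1
      have h3 := hrcoeff (t.1, t.2.1) t.2.2
      rw [h2] at h3
      simpa using h3.symm
  have hRsum : R = ∑ t : Fin d × Fin J × Fin B, C (c t) * ((X ^ (t.2.2 : ℕ) *
      F ^ (M + t.1 * h)) * ((X - C δ) ^ p ^ n) ^ (t.2.1 : ℕ)) := by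
    simp only [R, Tm, r, Fintype.sum_prod_type, Finset.sum_mul]
    refine Finset.sum_congr rfl fun i _ => Finset.sum_congr rfl fun j _ =>
      Finset.sum_congr rfl fun b _ => by ring
  have hvan : ∀ x ∈ Z, (X - C x) ^ M ∣ R := by
    intro x hx
    obtain ⟨hx1, hx2, hx3⟩ := hZ x hx
    apply dvd_of_hasse
    intro l hl
    have hD : hasseDeriv l R = ∑ t : Fin d × Fin J × Fin B, C (c t) * ((F ^ (M + t.1 * h - l) *
        U l t.1 t.2.2) * ((X - C δ) ^ p ^ n) ^ (t.2.1 : ℕ)) := by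
      rw [hRsum, map_sum]
      refine Finset.sum_congr rfl fun t _ => ?_
      rw [← smul_eq_C_mul, map_smul, hasse_mul_const_pow (p ^ n) _ (fun b h0 h1 => hasse_frob p n δ b h0 h1) _ l
        (by omega), hU, smul_eq_C_mul]
    have hcl := congrArg (eval x) (hc l hl)
    rw [eval_finsetSum, eval_zero] at hcl
    rw [hD, eval_finsetSum]
    have : ∀ t : Fin d × Fin J × Fin B, eval x (C (c t) * ((F ^ (M + t.1 * h - l) *
        U l t.1 t.2.2) * ((X - C δ) ^ p ^ n) ^ (t.2.1 : ℕ))) = F.eval x ^ (M - l) *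
        eval x (C (c t) * (C (a ^ (t.1 : ℕ)) * U l t.1 t.2.2 *
        (X - C (δ ^ p ^ n)) ^ (t.2.1 : ℕ))) := by
      intro t
      have e1 : (x - δ) ^ p ^ n = x - δ ^ p ^ n := by rw [sub_pow_char_pow, hx1]
      have e2 : M + t.1 * h - l = (M - l) + h * t.1 := by rw [mul_comm h]; omega
      simp only [eval_mul, eval_C, eval_pow, eval_sub, eval_X, e1, e2, pow_add, pow_mul, hx3]
      ring
    rw [Finset.sum_congr rfl (fun t _ => this t), ← Finset.mul_sum, hcl, mul_zero]
  refine (card_mul_le R hR0 Z M hvan).trans ?_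
  apply natDegree_sum_le_of_forall_le
  intro ij _
  by_cases hz : Tm ij = 0
  · rw [hz]; simp
  have hr := hrdeg ij (hTm0 ij hz)
  simp only [Tm]
  refine natDegree_mul_le.trans ?_
  have h1 : (r ij * F ^ (M + ij.1 * h)).natDegree ≤ B + (M + ij.1 * h) * m := by
    refine natDegree_mul_le.trans (add_le_add hr.le ?_)
    rw [natDegree_pow]
    exact Nat.mul_le_mul_left _ hm
  rw [natDegree_pow, natDegree_pow, natDegree_X_sub_C, mul_one]
  have h2 : (M + ij.1 * h) * m ≤ M * m + d * h * m := by
    rw [add_mul]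
    exact Nat.add_le_add_left (Nat.mul_le_mul_right _ (Nat.mul_le_mul_right _ ij.1.2.le)) _
  have h3 : B + ij.2 * p ^ n ≤ J * p ^ n := by
    have hd : 0 < d := by have := ij.1.2; omega
    have : B ≤ p ^ n := by
      have : h ≤ d * h := Nat.le_mul_of_pos_left _ hd
      omega
    calc B + ij.2 * p ^ n ≤ p ^ n + ij.2 * p ^ n := by omega
      _ = (ij.2 + 1) * p ^ n := by ring
      _ ≤ J * p ^ n := Nat.mul_le_mul_right _ ij.2.2
  omega

end Stp

open Polynomial
namespace Stp
variable {𝕜 : Type*} [Field 𝕜]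

theorem stepanov (p n d h e m s : ℕ) [hp : Fact p.Prime] [CharP 𝕜 p]
    (F W : 𝕜[X]) (δ a : 𝕜)
    (hF : F = (X - C δ) ^ e * W) (hW : W.eval δ ≠ 0) (hm : F.natDegree ≤ m)
    (hed : Nat.Coprime e d) (hd : 0 < d) (hq : p ^ n = d * h + 1) (hs : p ^ n = s ^ 2)
    (hbig : 2 * (d * (d * m + 3)) ≤ s)
    (Z : Finset 𝕜) (hZ : ∀ x ∈ Z, x ^ p ^ n = x ∧ F.eval x ≠ 0 ∧ F.eval x ^ h = a) :
    Z.card * d ≤ s ^ 2 + (d * (d * m + 3) + m + d * m) * s := by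
  set c := d * (d * m + 3) with hc
  have hcd : d * m + 3 ≤ c := Nat.le_mul_of_pos_left _ hd
  have hdc : 3 * d ≤ c := by rw [hc, mul_comm 3]; exact Nat.mul_le_mul_left _ (Nat.le_add_left _ _)
  have hdh : d * h + 1 = s ^ 2 := by omega
  have hspos : 0 < s := by omega
  -- J ≤ h
  have hch : c * h + (d * m + 3) = (d * m + 3) * s ^ 2 := by
    rw [← hdh, hc]; ring
  have hkey : d * m * s ^ 2 + (s + c) ^ 2 < c * h := by
    have h1 : 4 * (s + c) ^ 2 ≤ 9 * s ^ 2 := by nlinarith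
    have h2 : 4 * (d * m + 3) < 3 * s ^ 2 := by nlinarith
    nlinarith
  have hJh : s + c ≤ h := by
    by_contra hlt
    push Not at hlt
    have : c * h ≤ (s + c) ^ 2 := by nlinarith
    nlinarith [Nat.zero_le (d * m * s ^ 2)]
  obtain ⟨B, hB⟩ := Nat.exists_eq_add_of_le hJh
  have := stepanov_core p n d h e (s + c) B (d * s) m (h + d * s * m) F W δ a hF hW hm hed hq
    (by omega) (by omega) (by rw [hs, sq]; exact Nat.mul_le_mul_right _ (by omega))
    (by omega) (by
      have h3 : s * (h + d * s * m) < (s + c) * B := by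
        have e1 : (s + c) * h = (s + c) * (s + c) + (s + c) * B := by rw [hB]; ring
        nlinarith
      calc d * s * (h + d * s * m) = d * (s * (h + d * s * m)) := by ring
        _ < d * ((s + c) * B) := Nat.mul_lt_mul_of_pos_left h3 hd
        _ = d * (s + c) * B := by ring) Z hZ
  have h4 : s * (Z.card * d) ≤ s * (s ^ 2 + (c + m + d * m) * s) := by
    rw [hs] at this
    have h5 : d * h * m ≤ s ^ 2 * m := Nat.mul_le_mul_right _ (by omega)
    have h6 : d * m * s ≤ d * m * s ^ 2 := by
      apply Nat.mul_le_mul_left; nlinarith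
    nlinarith
  exact Nat.le_of_mul_le_mul_left h4 hspos

end Stp

open Polynomial
namespace Stp

lemma root_bound {N : ℕ} (ω : Fin N → ℂ) (r K : ℝ) (hr : 0 < r) (k0 : ℕ)
    (h : ∀ k ≥ k0, ‖∑ i, ω i ^ k‖ ≤ K * r ^ k) (i0 : Fin N) : ‖ω i0‖ ≤ r := by
  classical
  let T := (Finset.univ.image ω).erase (ω i0)
  let P : ℂ[X] := ∏ z ∈ T, (X - C z)
  have hP0 : P.eval (ω i0) ≠ 0 := by
    simp only [P, eval_prod, eval_sub, eval_X, eval_C]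
    rw [Finset.prod_ne_zero_iff]
    intro z hz
    rw [Finset.mem_erase] at hz
    exact sub_ne_zero.2 hz.1.symm
  have hP1 : ∀ i, ω i ≠ ω i0 → P.eval (ω i) = 0 := by
    intro i hi
    simp only [P, eval_prod, eval_sub, eval_X, eval_C]
    apply Finset.prod_eq_zero (i := ω i) _ (sub_self _)
    simp [T, hi]
  let c : ℕ := (Finset.univ.filter fun i => ω i = ω i0).card
  have hc : 0 < c := Finset.card_pos.2 ⟨i0, by simp⟩
  have h1 : ∀ k, ∑ i, ω i ^ k * P.eval (ω i) = c * P.eval (ω i0) * ω i0 ^ k := by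
    intro k
    rw [← Finset.sum_filter_add_sum_filter_not Finset.univ (fun i => ω i = ω i0)]
    rw [Finset.sum_eq_zero (s := Finset.univ.filter fun i => ¬ ω i = ω i0)]
    · rw [Finset.sum_congr rfl (g := fun _ => ω i0 ^ k * P.eval (ω i0))]
      · rw [Finset.sum_const, nsmul_eq_mul]; simp only [c]; ring
      · intro i hi; rw [(Finset.mem_filter.1 hi).2]
    · intro i hi; rw [hP1 i (Finset.mem_filter.1 hi).2, mul_zero]
  have h2 : ∀ k, ∑ i, ω i ^ k * P.eval (ω i) =
      ∑ t ∈ Finset.range (P.natDegree + 1), P.coeff t * ∑ i, ω i ^ (k + t) := by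
    intro k
    simp only [eval_eq_sum_range, Finset.mul_sum]
    rw [Finset.sum_comm]
    refine Finset.sum_congr rfl fun t _ => Finset.sum_congr rfl fun i _ => ?_
    rw [pow_add]; ring
  set D : ℝ := ∑ t ∈ Finset.range (P.natDegree + 1), ‖P.coeff t‖ * (K * r ^ t) with hD
  set A : ℝ := c * ‖P.eval (ω i0)‖ with hA
  have hApos : 0 < A := mul_pos (by exact_mod_cast hc) (norm_pos_iff.2 hP0)
  have h3 : ∀ k ≥ k0, A * ‖ω i0‖ ^ k ≤ D * r ^ k := by
    intro k hk
    have : A * ‖ω i0‖ ^ k = ‖∑ i, ω i ^ k * P.eval (ω i)‖ := by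
      rw [h1, norm_mul, norm_mul, norm_pow, Complex.norm_natCast]
    rw [this, h2, hD, Finset.sum_mul]
    refine (norm_sum_le _ _).trans (Finset.sum_le_sum fun t _ => ?_)
    rw [norm_mul, mul_assoc]
    refine mul_le_mul_of_nonneg_left ?_ (norm_nonneg _)
    refine (h (k + t) (by omega)).trans (le_of_eq ?_)
    rw [pow_add]; ring
  by_contra hlt
  push Not at hlt
  have hx : 1 < ‖ω i0‖ / r := (one_lt_div hr).2 hlt
  obtain ⟨n, hn⟩ := pow_unbounded_of_one_lt (D / A) hx
  have hn2 : (‖ω i0‖ / r) ^ n ≤ (‖ω i0‖ / r) ^ (n + k0) := pow_le_pow_right₀ hx.le (by omega)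
  have h4 := h3 (n + k0) (by omega)
  have h5 : (‖ω i0‖ / r) ^ (n + k0) ≤ D / A := by
    rw [div_pow, div_le_div_iff₀ (pow_pos hr _) hApos]
    linarith
  linarith

lemma exists_roots (N : ℕ) (a S : ℕ → ℂ) (h0 : a 0 = 1) (hN : ∀ n, N < n → a n = 0)
    (hrec : ∀ n : ℕ, (n : ℂ) * a n = ∑ x ∈ (Finset.HasAntidiagonal.antidiagonal n).filter (fun x => x.1 < n), a x.1 * S x.2) :
    ∃ ω : Fin N → ℂ, ∀ k, 0 < k → S k = - ∑ i, ω i ^ k := by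
  classical
  let p : ℂ[X] := ∑ n ∈ Finset.range (N + 1), C (a n) * X ^ (N - n)
  have hpc : ∀ j ≤ N, p.coeff (N - j) = a j := by
    intro j hj
    simp only [p, finsetSum_coeff, coeff_C_mul, coeff_X_pow]
    rw [Finset.sum_eq_single j]
    · simp
    · intro b hb hbj
      rw [Finset.mem_range] at hb
      rw [if_neg (by omega), mul_zero]
    · intro h; simp at h; omega
  have hpd : p.natDegree ≤ N := by
    apply natDegree_sum_le_of_forall_le
    intro n _
    exact (natDegree_C_mul_X_pow_le _ _).trans (Nat.sub_le _ _)
  have hpN : p.coeff N = 1 := by simpa [h0] using hpc 0 (Nat.zero_le _)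
  have hpm : p.Monic := monic_of_natDegree_le_of_coeff_eq_one N hpd hpN
  have hpdeg : p.natDegree = N := le_antisymm hpd (le_natDegree_of_ne_zero (by rw [hpN]; exact one_ne_zero))
  have hsp : p.Splits := IsAlgClosed.splits p
  have hcard : Multiset.card p.roots = N := by
    rw [← hpdeg]; exact (splits_iff_card_roots.1 hsp)
  have hlen : p.roots.toList.length = N := by simp [hcard]
  let ω : Fin N → ℂ := fun i => p.roots.toList.get (i.cast hlen.symm)
  have hω : (Finset.univ : Finset (Fin N)).val.map ω = p.roots := by
    have h1 : List.ofFn ω = p.roots.toList := by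
      apply List.ext_get
      · simp [hlen]
      · intro n h1 h2; simp [ω]
    rw [Fin.univ_val_map, h1]; simp
  have hprod : p = (p.roots.map fun r => X - C r).prod := by
    rw [prod_multiset_X_sub_C_of_monic_of_roots_card_eq hpm (by rw [hcard, hpdeg])]
  -- the elementary symmetric functions
  let b : ℕ → ℂ := fun n => (-1) ^ n * MvPolynomial.aeval ω (MvPolynomial.esymm (Fin N) ℂ n)
  have hab : ∀ n, a n = b n := by
    intro n
    simp only [b]
    rw [MvPolynomial.aeval_esymm_eq_multiset_esymm, hω]
    rcases Nat.lt_or_ge N n with hn | hn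
    · rw [hN n hn, Multiset.esymm, Multiset.powersetCard_eq_empty]
      · simp
      · omega
    · rw [← hpc n hn]
      conv_lhs => rw [hprod]
      rw [Multiset.prod_X_sub_C_coeff _ (by omega), hcard]
      congr 2 <;> omega
  refine ⟨ω, ?_⟩
  have hbrec : ∀ n : ℕ, (n : ℂ) * b n = ∑ x ∈ (Finset.HasAntidiagonal.antidiagonal n).filter (fun x => x.1 < n), b x.1 * (- ∑ i, ω i ^ x.2) := by
    intro n
    have := congrArg (MvPolynomial.aeval ω) (MvPolynomial.mul_esymm_eq_sum (Fin N) ℂ n)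
    simp only [map_mul, map_natCast, map_sum, map_pow, map_neg, map_one, MvPolynomial.psum, MvPolynomial.aeval_X] at this
    simp only [b]
    rw [mul_left_comm, this, ← mul_assoc, ← pow_add]
    have : (-1 : ℂ) ^ (n + (n + 1)) = -1 := by
      rw [show n + (n + 1) = 2 * n + 1 by ring, pow_succ, pow_mul]; simp
    rw [this, Finset.mul_sum]
    refine Finset.sum_congr rfl fun x _ => ?_
    ring
  intro k
  induction k using Nat.strong_induction_on with
  | _ k ih =>
    intro hk
    have h1 := hrec k
    have h2 := hbrec k
    rw [← hab k, h1] at h2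
    have hmem : (0, k) ∈ (Finset.HasAntidiagonal.antidiagonal k).filter (fun x => x.1 < k) := by
      simp [hk]
    rw [← Finset.add_sum_erase _ _ hmem, ← Finset.add_sum_erase _ _ hmem] at h2
    rw [Finset.sum_congr rfl (g := fun x => b x.1 * (- ∑ i, ω i ^ x.2))] at h2
    · have h3 := add_right_cancel h2
      simp only [← hab, h0, one_mul] at h3
      exact h3
    · rintro ⟨x, y⟩ hx
      simp only [Finset.mem_erase, Finset.mem_filter, Finset.HasAntidiagonal.mem_antidiagonal] at hx
      have hx0 : x ≠ 0 := by
        rintro rfl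
        apply hx.1; ext <;> simp; omega
      rw [hab, ih y (by omega) (by omega)]

theorem weil_of_rec (N : ℕ) (a S : ℕ → ℂ) (h0 : a 0 = 1) (hN : ∀ n, N < n → a n = 0)
    (hrec : ∀ n : ℕ, (n : ℂ) * a n = ∑ x ∈ (Finset.HasAntidiagonal.antidiagonal n).filter (fun x => x.1 < n), a x.1 * S x.2)
    (r K : ℝ) (hr : 0 < r) (k0 : ℕ) (hS : ∀ k ≥ k0, ‖S k‖ ≤ K * r ^ k) :
    ‖S 1‖ ≤ N * r := by
  obtain ⟨ω, hω⟩ := exists_roots N a S h0 hN hrec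
  have hb := root_bound ω r K hr (k0 + 1) (fun k hk => by
    rw [← norm_neg, ← hω k (by omega)]; exact hS k (by omega))
  rw [hω 1 one_pos, norm_neg]
  refine (norm_sum_le _ _).trans ?_
  refine (Finset.sum_le_card_nsmul _ _ r (fun i _ => by simpa using hb i)).trans ?_
  simp
end Stp

open Polynomial
set_option linter.unusedSectionVars false
namespace Stp
section PD
variable (L : Type) [Field L] [Fintype L]

lemma finite_mon (n : ℕ) : {p : L[X] | p.Monic ∧ p.natDegree = n}.Finite := by
  apply Set.Finite.of_finite_image (f := fun p : L[X] => fun i : Fin (n+1) => p.coeff i)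
  · exact Set.toFinite _
  · intro p hp r hr h
    ext i
    by_cases hi : i < n + 1
    · exact congrFun h ⟨i, hi⟩
    · rw [coeff_eq_zero_of_natDegree_lt, coeff_eq_zero_of_natDegree_lt]
      · have := hr.2; omega
      · have := hp.2; omega

/-- monic polynomials of degree `n` -/
noncomputable def Mon (n : ℕ) : Finset L[X] := (finite_mon L n).toFinset

variable {L}
lemma mem_Mon {n : ℕ} {p : L[X]} : p ∈ Mon L n ↔ p.Monic ∧ p.natDegree = n := by
  simp [Mon]

variable (L) in
abbrev Om := AlgebraicClosure L

variable (L) in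
/-- the elements of the degree-k extension -/
noncomputable def EE (k : ℕ) : Finset (Om L) := by
  classical exact ((X : (Om L)[X]) ^ (Fintype.card L) ^ k - X).roots.toFinset

lemma card_gt : 1 < Fintype.card L := Fintype.one_lt_card

lemma mem_EE {k : ℕ} (hk : 0 < k) {x : Om L} : x ∈ EE L k ↔ x ^ (Fintype.card L) ^ k = x := by
  classical
  have h1 : 1 < (Fintype.card L) ^ k := Nat.one_lt_pow hk.ne' card_gt
  simp only [EE, Multiset.mem_toFinset]
  rw [mem_roots (FiniteField.X_pow_card_sub_X_ne_zero _ h1)]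
  simp [sub_eq_zero]

noncomputable def hxp (k : ℕ) (x : Om L) : L[X] := (minpoly L x) ^ (k / (minpoly L x).natDegree)

lemma int_Om (x : Om L) : IsIntegral L x := (Algebra.IsAlgebraic.isAlgebraic x).isIntegral

lemma mem_EE_iff {k : ℕ} (hk : 0 < k) {x : Om L} :
    x ∈ EE L k ↔ (minpoly L x).natDegree ∣ k := by
  rw [mem_EE hk, (minpoly.irreducible (int_Om x)).natDegree_dvd_iff_dvd_X_pow_card_pow_sub_X,
    minpoly.dvd_iff, Nat.card_eq_fintype_card]
  simp [sub_eq_zero]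

lemma hxp_monic (k : ℕ) (x : Om L) : (hxp k x).Monic := (minpoly.monic (int_Om x)).pow _

lemma hxp_deg {k : ℕ} (hk : 0 < k) {x : Om L} (hx : x ∈ EE L k) : (hxp k x).natDegree = k := by
  rw [hxp, (minpoly.monic (int_Om x)).natDegree_pow]
  exact Nat.div_mul_cancel ((mem_EE_iff hk).1 hx)

lemma pow_minpoly_dvd (x : Om L) (i : ℕ) : ∀ h : L[X],
    (minpoly L x) ^ i ∣ h ↔ (X - C x) ^ i ∣ h.map (algebraMap L (Om L)) := by
  obtain ⟨V, hV⟩ : (X - C x) ∣ (minpoly L x).map (algebraMap L (Om L)) := by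
    rw [dvd_iff_isRoot, IsRoot, eval_map_algebraMap]; exact minpoly.aeval L x
  have hs : ((minpoly L x).map (algebraMap L (Om L))).Separable :=
    (PerfectField.separable_of_irreducible (minpoly.irreducible (int_Om x))).map
  rw [hV] at hs
  have hc : IsCoprime (X - C x) V := hs.isCoprime
  induction i with
  | zero => simp
  | succ i ih =>
    intro h
    constructor
    · rintro ⟨w, rfl⟩
      rw [Polynomial.map_mul, Polynomial.map_pow, hV, mul_pow, mul_assoc]
      exact Dvd.intro _ rfl
    · intro hd
      have h1 : minpoly L x ∣ h := by
        rw [minpoly.dvd_iff]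
        have : (X - C x) ∣ h.map (algebraMap L (Om L)) :=
          (dvd_pow_self _ (Nat.succ_ne_zero i)).trans hd
        rwa [dvd_iff_isRoot, IsRoot, eval_map_algebraMap] at this
      obtain ⟨w, rfl⟩ := h1
      rw [pow_succ']
      apply mul_dvd_mul_left
      rw [ih]
      rw [Polynomial.map_mul, hV, pow_succ', mul_assoc] at hd
      have := (mul_dvd_mul_iff_left (X_sub_C_ne_zero x)).1 hd
      exact (hc.pow_left).dvd_of_dvd_mul_left this

lemma count_E (n : ℕ) (h : L[X]) (hm : h.Monic) (hn : h.natDegree = n) :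
    ∑ j ∈ Finset.Icc 1 n, (Finset.card (by classical exact (EE L j).filter (fun x => hxp j x ∣ h))) = n := by
  classical
  have hh : h.map (algebraMap L (Om L)) ≠ 0 := (hm.map _).ne_zero
  set R := (h.map (algebraMap L (Om L))).roots with hR
  have h1 : ∀ j ∈ Finset.Icc 1 n, ((EE L j).filter (fun x => hxp j x ∣ h)) =
      R.toFinset.filter (fun x => x ∈ EE L j ∧ hxp j x ∣ h) := by
    intro j hj
    rw [Finset.mem_Icc] at hj
    ext x
    simp only [Finset.mem_filter, Multiset.mem_toFinset]
    constructor
    · rintro ⟨a, b⟩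
      refine ⟨?_, a, b⟩
      rw [hR, mem_roots hh, IsRoot, eval_map_algebraMap]
      have hd := (mem_EE_iff (by omega)).1 a
      have hpos : j / (minpoly L x).natDegree ≠ 0 := by
        have := Nat.div_mul_cancel hd
        intro h0; rw [h0] at this; omega
      have : minpoly L x ∣ h := (dvd_pow_self _ hpos).trans b
      exact (minpoly.dvd_iff).1 this
    · rintro ⟨_, a⟩; exact a
  have h1' : ∀ j ∈ Finset.Icc 1 n, (Finset.card ((EE L j).filter (fun x => hxp j x ∣ h))) =
      ∑ x ∈ R.toFinset, if x ∈ EE L j ∧ hxp j x ∣ h then 1 else 0 := by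
    intro j hj
    rw [h1 j hj, Finset.card_filter]
  have goal1 : ∑ j ∈ Finset.Icc 1 n, Finset.card ((EE L j).filter (fun x => hxp j x ∣ h)) = n := by
    rw [Finset.sum_congr rfl h1', Finset.sum_comm]
    have h2 : ∀ x ∈ R.toFinset, (∑ j ∈ Finset.Icc 1 n, if x ∈ EE L j ∧ hxp j x ∣ h then 1 else 0) =
        R.count x := by
      intro x hx
      rw [← Finset.card_filter, hR, count_roots]
      set μ := rootMultiplicity x (h.map (algebraMap L (Om L))) with hμ
      set d := (minpoly L x).natDegree with hd
      have hdpos : 0 < d := minpoly.natDegree_pos (int_Om x)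
      have key : ∀ i, (minpoly L x) ^ i ∣ h ↔ i ≤ μ := by
        intro i
        rw [pow_minpoly_dvd, ← le_rootMultiplicity_iff hh]
      have : (Finset.Icc 1 n).filter (fun j => x ∈ EE L j ∧ hxp j x ∣ h) =
          (Finset.Icc 1 μ).image (fun i => i * d) := by
        ext j
        simp only [Finset.mem_filter, Finset.mem_Icc, Finset.mem_image]
        constructor
        · rintro ⟨⟨a, b⟩, c, e⟩
          rw [mem_EE_iff (by omega), ← hd] at c
          rw [hxp, ← hd, key] at e
          refine ⟨j / d, ⟨?_, e⟩, Nat.div_mul_cancel c⟩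
          exact Nat.div_pos (Nat.le_of_dvd (by omega) c) hdpos
        · rintro ⟨i, ⟨a, b⟩, rfl⟩
          have hpos : 0 < i * d := Nat.mul_pos a hdpos
          have hdv := (key i).2 b
          refine ⟨⟨hpos, ?_⟩, ?_, ?_⟩
          · have := natDegree_le_of_dvd hdv hm.ne_zero
            rw [(minpoly.monic (int_Om x)).natDegree_pow, hn] at this
            exact this
          · rw [mem_EE_iff hpos]; exact Dvd.intro_left _ rfl
          · rw [hxp, ← hd, Nat.mul_div_cancel _ hdpos]; exact hdv
      rw [this, Finset.card_image_of_injective _ (fun a b hab => Nat.eq_of_mul_eq_mul_right hdpos hab)]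
      simp
    rw [Finset.sum_congr rfl h2, Multiset.toFinset_sum_count_eq, hR,
      ← (IsAlgClosed.splits (h.map (algebraMap L (Om L)))).natDegree_eq_card_roots, natDegree_map, hn]
  convert goal1

theorem recursion (lam : L[X] → ℂ) 
    (hmul : ∀ g h : L[X], g.Monic → h.Monic → lam (g * h) = lam g * lam h) (n : ℕ) :
    (n : ℂ) * ∑ h ∈ Mon L n, lam h =
      ∑ x ∈ (Finset.HasAntidiagonal.antidiagonal n).filter (fun x => x.1 < n),
        (∑ h ∈ Mon L x.1, lam h) * ∑ y ∈ EE L x.2, lam (hxp x.2 y) := by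
  classical
  have e1 : ∑ x ∈ (Finset.HasAntidiagonal.antidiagonal n).filter (fun x => x.1 < n),
        (∑ h ∈ Mon L x.1, lam h) * ∑ y ∈ EE L x.2, lam (hxp x.2 y) =
      ∑ j ∈ Finset.Icc 1 n, (∑ h ∈ Mon L (n - j), lam h) * ∑ y ∈ EE L j, lam (hxp j y) := by
    symm
    apply Finset.sum_bij (fun j _ => (n - j, j))
    · intro j hj; rw [Finset.mem_Icc] at hj
      simp only [Finset.mem_filter, Finset.HasAntidiagonal.mem_antidiagonal]; omega
    · intro a _ b _ h; simp at h; exact h.2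
    · rintro ⟨a, b⟩ hab
      simp only [Finset.mem_filter, Finset.HasAntidiagonal.mem_antidiagonal] at hab
      refine ⟨b, by rw [Finset.mem_Icc]; omega, ?_⟩
      simp; omega
    · intros; rfl
  rw [e1]
  have e2 : ∀ j ∈ Finset.Icc 1 n, (∑ h ∈ Mon L (n - j), lam h) * ∑ y ∈ EE L j, lam (hxp j y) =
      ∑ h ∈ Mon L n, lam h * ((EE L j).filter (fun x => hxp j x ∣ h)).card := by
    intro j hj
    rw [Finset.mem_Icc] at hj
    rw [mul_comm, Finset.sum_mul]
    have e3 : ∀ x ∈ EE L j, lam (hxp j x) * ∑ h ∈ Mon L (n - j), lam h =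
        ∑ h ∈ Mon L n, if hxp j x ∣ h then lam h else 0 := by
      intro x hx
      rw [← Finset.sum_filter, Finset.mul_sum]
      apply Finset.sum_bij (fun g _ => hxp j x * g)
      · intro g hg
        rw [mem_Mon] at hg
        rw [Finset.mem_filter, mem_Mon]
        refine ⟨⟨(hxp_monic j x).mul hg.1, ?_⟩, Dvd.intro _ rfl⟩
        rw [(hxp_monic j x).natDegree_mul hg.1, hxp_deg (by omega) hx, hg.2]; omega
      · intro a _ b _ h; exact mul_left_cancel₀ (hxp_monic j x).ne_zero h
      · intro h hh
        rw [Finset.mem_filter, mem_Mon] at hh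
        obtain ⟨⟨hm, hd⟩, g, rfl⟩ := hh
        have hgm : g.Monic := (hxp_monic j x).of_mul_monic_left hm
        refine ⟨g, ?_, rfl⟩
        rw [mem_Mon]
        refine ⟨hgm, ?_⟩
        rw [(hxp_monic j x).natDegree_mul hgm, hxp_deg (by omega) hx] at hd
        omega
      · intro g hg
        rw [mem_Mon] at hg
        exact (hmul _ _ (hxp_monic j x) hg.1).symm
    rw [Finset.sum_congr rfl e3, Finset.sum_comm]
    apply Finset.sum_congr rfl
    intro h _
    rw [← Finset.sum_filter, Finset.sum_const, nsmul_eq_mul, mul_comm]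
  rw [Finset.sum_congr rfl e2, Finset.sum_comm, Finset.mul_sum]
  apply Finset.sum_congr rfl
  intro h hh
  rw [mem_Mon] at hh
  rw [← Finset.mul_sum, mul_comm]
  congr 1
  have := count_E n h hh.1 hh.2
  rw [← Nat.cast_sum]
  congr 1
  rw [← this]
  refine Finset.sum_congr ?_ ?_
  · rw [this]
  · intros; congr 

end PD
end Stp

open Polynomial
set_option linter.unusedSectionVars false
namespace Stp
section PC
variable {L : Type} [Field L] [Fintype L]

noncomputable def nm (f v : L[X]) : L := resultant f v f.natDegree v.natDegree

lemma nm_alg {f : L[X]} (hf : f.Monic) (v : L[X]) : algebraMap L (Om L) (nm f v) =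
    ((f.map (algebraMap L (Om L))).roots.map (fun ρ => aeval ρ v)).prod := by
  rw [nm, ← resultant_map_map]
  have := resultant_eq_prod_eval (f.map (algebraMap L (Om L))) (v.map (algebraMap L (Om L)))
    v.natDegree natDegree_map_le (IsAlgClosed.splits _)
  rw [natDegree_map] at this
  rw [this, (hf.map _).leadingCoeff, one_pow, one_mul]
  congr 2
  ext ρ
  rw [eval_map_algebraMap]

lemma alg_inj : Function.Injective (algebraMap L (Om L)) := (algebraMap L (Om L)).injective

lemma nm_mul_right {f : L[X]} (hf : f.Monic) (v w : L[X]) : nm f (v * w) = nm f v * nm f w := by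
  apply alg_inj
  rw [map_mul, nm_alg hf, nm_alg hf, nm_alg hf, ← Multiset.prod_map_mul]
  simp

lemma nm_one_right {f : L[X]} (hf : f.Monic) : nm f 1 = 1 := by
  apply alg_inj
  rw [nm_alg hf]; simp

lemma nm_mul_left {f g : L[X]} (hf : f.Monic) (hg : g.Monic) (v : L[X]) :
    nm (f * g) v = nm f v * nm g v := by
  apply alg_inj
  rw [map_mul, nm_alg hf, nm_alg hg, nm_alg (hf.mul hg), Polynomial.map_mul, roots_mul]
  · simp
  · exact ((hf.map _).mul (hg.map _)).ne_zero

lemma nm_one_left (v : L[X]) : nm 1 v = 1 := by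
  apply alg_inj
  rw [nm_alg monic_one]; simp

lemma nm_pow_left {f : L[X]} (hf : f.Monic) (n : ℕ) (v : L[X]) :
    nm (f ^ n) v = nm f v ^ n := by
  induction n with
  | zero => simp [nm_one_left]
  | succ n ih => rw [pow_succ, pow_succ, nm_mul_left (hf.pow n) hf, ih]

lemma nm_congr {f : L[X]} (hf : f.Monic) {v w : L[X]} (h : f ∣ v - w) : nm f v = nm f w := by
  apply alg_inj
  rw [nm_alg hf, nm_alg hf]
  congr 1
  apply Multiset.map_congr rfl
  intro ρ hρ
  rw [mem_roots (hf.map _).ne_zero, IsRoot, eval_map_algebraMap] at hρ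
  obtain ⟨u, hu⟩ := h
  rw [← sub_eq_zero, ← map_sub, hu, map_mul, hρ, zero_mul]

lemma nm_comm (f g : L[X]) : nm f g = (-1) ^ (f.natDegree * g.natDegree) * nm g f :=
  resultant_comm _ _ _ _

lemma aeval_pow_card (f : L[X]) (x : Om L) (i : ℕ) :
    aeval (x ^ (Fintype.card L) ^ i) f = (aeval x f) ^ (Fintype.card L) ^ i := by
  induction i with
  | zero => simp
  | succ i ih =>
    rw [pow_succ, pow_mul, pow_mul, ← ih, ← FiniteField.frobeniusAlgHom_apply L (Om L),
      ← FiniteField.frobeniusAlgHom_apply L (Om L), aeval_algHom_apply]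

lemma frob_inj (i : ℕ) : Function.Injective (fun x : Om L => x ^ (Fintype.card L) ^ i) := by
  induction i with
  | zero => intro a b; simp
  | succ i ih =>
    intro a b h
    apply ih
    simp only [pow_succ, pow_mul] at h
    exact (FiniteField.frobeniusAlgHom L (Om L)).toRingHom.injective h

lemma roots_minpoly (x : Om L) : ((minpoly L x).map (algebraMap L (Om L))).roots =
    (Multiset.range (minpoly L x).natDegree).map (fun i => x ^ (Fintype.card L) ^ i) := by
  classical
  set d := (minpoly L x).natDegree with hd
  have hdpos : 0 < d := minpoly.natDegree_pos (int_Om x)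
  have hnd : ((minpoly L x).map (algebraMap L (Om L))).roots.Nodup :=
    nodup_roots ((PerfectField.separable_of_irreducible (minpoly.irreducible (int_Om x))).map)
  symm
  have hlt : ∀ i j, i < j → j < d → x ^ (Fintype.card L) ^ i ≠ x ^ (Fintype.card L) ^ j := by
    intro i j hij hjd h
    have hp : 0 < j - i := by omega
    have : x ∈ EE L (j - i) := by
      rw [mem_EE hp]
      apply frob_inj i
      simp only
      rw [← pow_mul, ← pow_add, Nat.sub_add_cancel hij.le]
      exact h.symm
    rw [mem_EE_iff hp] at this
    have := Nat.le_of_dvd hp this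
    omega
  have hnd2 : ((Multiset.range d).map (fun i => x ^ (Fintype.card L) ^ i)).Nodup := by
    rw [Multiset.nodup_map_iff_of_inj_on]
    · exact Multiset.nodup_range d
    · intro i hi j hj h
      rw [Multiset.mem_range] at hi hj
      rcases lt_trichotomy i j with h1 | h1 | h1
      · exact absurd h (hlt i j h1 hj)
      · exact h1
      · exact absurd h.symm (hlt j i h1 hi)
  apply Multiset.eq_of_le_of_card_le
  · rw [Multiset.le_iff_subset hnd2]
    intro y hy
    rw [Multiset.mem_map] at hy
    obtain ⟨i, hi, rfl⟩ := hy
    rw [mem_roots ((minpoly.monic (int_Om x)).map _).ne_zero, IsRoot, eval_map_algebraMap,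
      aeval_pow_card, minpoly.aeval, zero_pow]
    exact (pow_pos (by have := card_gt (L := L); omega) _).ne'
  · refine (card_roots' _).trans ?_
    simp [hd]

lemma nm_hxp {k : ℕ} (hk : 0 < k) {x : Om L} (hx : x ∈ EE L k) (f : L[X]) :
    algebraMap L (Om L) (nm (hxp k x) f) =
      (aeval x f) ^ (∑ i ∈ Finset.range k, (Fintype.card L) ^ i) := by
  set d := (minpoly L x).natDegree with hd
  have hdpos : 0 < d := minpoly.natDegree_pos (int_Om x)
  obtain ⟨e, rfl⟩ := (mem_EE_iff hk).1 hx
  have hP := minpoly.monic (int_Om x)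
  rw [hxp, ← hd, Nat.mul_div_cancel_left _ hdpos, nm_pow_left hP, map_pow, nm_alg hP,
    roots_minpoly, Multiset.map_map, ← hd]
  have h1 : (Multiset.map ((fun ρ => aeval ρ f) ∘ fun i => x ^ Fintype.card L ^ i)
      (Multiset.range d)).prod = ∏ i ∈ Finset.range d, (aeval x f) ^ (Fintype.card L) ^ i := by
    rw [Finset.prod]
    congr 1
    apply Multiset.map_congr rfl
    intro i _
    exact aeval_pow_card f x i
  rw [h1, ← Finset.prod_pow_eq_pow_sum]
  have hy : ∀ j, (aeval x f) ^ (Fintype.card L) ^ (d * j) = aeval x f := by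
    intro j
    rcases Nat.eq_zero_or_pos j with rfl | hj
    · simp
    rw [← aeval_pow_card]
    congr 1
    have : x ∈ EE L (d * j) := by
      rw [mem_EE_iff (Nat.mul_pos hdpos hj)]; exact Dvd.intro _ rfl
    rw [(mem_EE (Nat.mul_pos hdpos hj)).1 this]
  clear hx hk
  induction e with
  | zero => simp
  | succ e ih =>
    rw [pow_succ, ih, Nat.mul_succ, Finset.prod_range_add]
    congr 1
    apply Finset.prod_congr rfl
    intro i _
    rw [pow_add, pow_mul, hy]

lemma nm_surj {g : L[X]} (hg : g.Monic) (hi : Irreducible g) (t : L) : ∃ v, nm g v = t := by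
  have : Fact (Irreducible g) := ⟨hi⟩
  have : Module.Finite L (AdjoinRoot g) := hg.finite_adjoinRoot
  have : Finite (AdjoinRoot g) := Module.finite_of_finite L
  obtain ⟨z, hz⟩ := FiniteField.norm_surjective L (AdjoinRoot g) t
  obtain ⟨v, rfl⟩ := AdjoinRoot.mk_surjective z
  have h1 := FiniteField.algebraMap_norm_eq_pow (K := L) (x := AdjoinRoot.mk g v)
  rw [hz] at h1
  obtain ⟨x, hx⟩ := IsAlgClosed.exists_aeval_eq_zero (Om L) g hi.degree_pos.ne'
  have hgm : minpoly L x = g := (minpoly.eq_of_irreducible_of_monic hi hx hg).symm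
  have hdpos : 0 < g.natDegree := hi.natDegree_pos
  have hxE : x ∈ EE L g.natDegree := by rw [mem_EE_iff hdpos, hgm]
  have hxp1 : hxp g.natDegree x = g := by rw [hxp, hgm, Nat.div_self hdpos, pow_one]
  refine ⟨v, alg_inj ?_⟩
  have h2 := nm_hxp hdpos hxE v
  rw [hxp1] at h2
  rw [h2]
  have h3 := congrArg (AdjoinRoot.liftAlgHom g (Algebra.ofId L (Om L)) x (by simpa [aeval_def] using hx)) h1
  rw [AlgHom.commutes, map_pow, AdjoinRoot.liftAlgHom_mk] at h3
  rw [h3, Nat.geomSum_eq card_gt]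
  congr 3
  · rw [← Nat.card_eq_fintype_card, Module.natCard_eq_pow_finrank (K := L) (V := AdjoinRoot g),
      (AdjoinRoot.powerBasis' hg).finrank]; rfl
  · rw [Nat.card_eq_fintype_card]
  
lemma mulChar_pow (χ : MulChar L ℂ) {t : L} (ht : t ≠ 0) : χ t ^ (Fintype.card L - 1) = 1 := by
  rw [← map_pow, FiniteField.pow_card_sub_one_eq_one t ht, map_one]

lemma exists_t (χ : MulChar L ℂ) (hχ : χ ≠ 1) (k : ℕ) (hk : Nat.Coprime k (Fintype.card L - 1)) :
    ∃ t : L, t ≠ 0 ∧ χ t ^ k ≠ 1 := by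
  obtain ⟨a, ha⟩ := MulChar.ne_one_iff.1 hχ
  refine ⟨a, a.ne_zero, fun h => ha ?_⟩
  have h1 := mulChar_pow χ a.ne_zero
  have := pow_gcd_eq_one.2 ⟨h, h1⟩
  rwa [hk.gcd_eq_one, pow_one] at this

noncomputable def lam (χ₁ χ₂ : MulChar L ℂ) (f₁ f₂ h : L[X]) : ℂ :=
  χ₁ (nm h X) * χ₂ (nm h f₁) * χ₂⁻¹ (nm h f₂)

lemma lam_mul (χ₁ χ₂ : MulChar L ℂ) (f₁ f₂ : L[X]) (g h : L[X]) (hg : g.Monic) (hh : h.Monic) :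
    lam χ₁ χ₂ f₁ f₂ (g * h) = lam χ₁ χ₂ f₁ f₂ g * lam χ₁ χ₂ f₁ f₂ h := by
  simp only [lam, nm_mul_left hg hh, map_mul]; ring

lemma exists_v (χ₂ : MulChar L ℂ) (hχ : χ₂ ≠ 1) (f₁ f₂ : L[X]) (h1 : f₁.Monic)
    (h2 : f₂.Monic) (hc : IsCoprime f₁ f₂) (k : ℕ) (g : L[X]) (hk : 0 < k) (hg : g.Monic)
    (hi : Irreducible g) (hgX : g ≠ X) (hkc : Nat.gcd k (Fintype.card L - 1) = 1)
    (hd : g ^ k ∣ f₁ * f₂) (hnd : ¬ g ^ (k + 1) ∣ f₁ * f₂) :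
    ∃ v : L[X], IsCoprime v (X * f₁ * f₂) ∧ nm X v = 1 ∧ χ₂ (nm f₁ v) * χ₂⁻¹ (nm f₂ v) ≠ 1 := by
  -- symmetric core
  have core : ∀ (χ : MulChar L ℂ), χ ≠ 1 → ∀ (a b : L[X]), a.Monic → b.Monic → IsCoprime a b →
      g ∣ a → g ^ k ∣ a * b → ¬ g ^ (k+1) ∣ a * b →
      ∃ v : L[X], IsCoprime v (X * (a * b)) ∧ nm X v = 1 ∧ nm b v = 1 ∧ χ (nm a v) ≠ 1 := by
    intro χ hχ a b ha hb hab hga hd hnd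
    have hgb : IsCoprime g b := hab.of_isCoprime_of_dvd_left hga
    have hda : g ^ k ∣ a := (hgb.pow_left).dvd_of_dvd_mul_right hd
    obtain ⟨u, rfl⟩ := hda
    have hu : u.Monic := (hg.pow k).of_mul_monic_left ha
    have hgu : IsCoprime g u := by
      rw [hi.coprime_iff_not_dvd]
      rintro ⟨w, rfl⟩
      exact hnd ⟨w * b, by ring⟩
    have hgX' : IsCoprime g X := by
      rw [hi.coprime_iff_not_dvd]
      intro h
      exact hgX (eq_of_monic_of_associated hg monic_X
        (hi.associated_of_dvd irreducible_X h))
    have hM : IsCoprime g (X * (u * b)) := hgX'.mul_right (hgu.mul_right hgb)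
    obtain ⟨t, ht, htk⟩ := exists_t χ hχ k hkc
    obtain ⟨v0, hv0⟩ := nm_surj hg hi t
    obtain ⟨r, s, hrs⟩ := hM
    set v := v0 * (s * (X * (u * b))) + r * g with hv'
    have hvg : g ∣ v - v0 := ⟨r - v0 * r, by
      rw [hv']; linear_combination v0 * hrs⟩
    have hvM : X * (u * b) ∣ v - 1 := ⟨(v0 - 1) * s, by
      rw [hv']; linear_combination hrs⟩
    have hv0g : IsCoprime v g := by
      rw [isCoprime_comm, hi.coprime_iff_not_dvd]
      intro h
      have : g ∣ v0 := by
        have := dvd_sub h hvg; simpa using this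
      have h0 : nm g v0 = nm g 0 := nm_congr hg (by simpa using this)
      have h00 : nm g 0 = 0 := by
        have := nm_mul_right hg 0 v0
        obtain ⟨w, hw⟩ := nm_surj hg hi (0:L)
        have h3 := nm_mul_right hg w 0
        rwa [mul_zero, hw, zero_mul] at h3
      exact ht (by rw [← hv0, h0, h00])
    have hvMc : IsCoprime v (X * (u * b)) := by
      obtain ⟨w, hw⟩ := hvM
      exact ⟨1, -w, by linear_combination hw⟩
    refine ⟨v, ?_, ?_, ?_, ?_⟩
    · have := (hv0g.pow_right (n := k)).mul_right hvMc
      convert this using 1; ring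
    · rw [nm_congr monic_X ((Dvd.intro _ rfl).trans hvM), nm_one_right monic_X]
    · rw [nm_congr hb (Dvd.dvd.trans ⟨X * u, by ring⟩ hvM), nm_one_right hb]
    · rw [nm_mul_left (hg.pow k) hu, nm_pow_left hg, nm_congr hg hvg, hv0,
        nm_congr hu (Dvd.dvd.trans ⟨X * b, by ring⟩ hvM), nm_one_right hu, mul_one, map_pow]
      exact htk
  have hp : Prime g := hi.prime
  have hgd : g ∣ f₁ * f₂ := (dvd_pow_self g hk.ne').trans hd
  rcases hp.dvd_or_dvd hgd with h | h
  · obtain ⟨v, a, b, c, d⟩ := core χ₂ hχ f₁ f₂ h1 h2 hc h hd hnd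
    refine ⟨v, by rwa [mul_assoc], b, ?_⟩
    rw [c, map_one, mul_one]; exact d
  · obtain ⟨v, a, b, c, d⟩ := core χ₂⁻¹ (inv_ne_one.2 hχ) f₂ f₁ h2 h1 hc.symm h (by rwa [mul_comm]) (by rwa [mul_comm])
    refine ⟨v, by convert a using 1; ring, b, ?_⟩
    rw [c, map_one, one_mul]; exact d

lemma lam_vanish (χ₁ χ₂ : MulChar L ℂ) (hχ : χ₂ ≠ 1) (f₁ f₂ : L[X]) (h1 : f₁.Monic)
    (h2 : f₂.Monic) (hc : IsCoprime f₁ f₂) (k : ℕ) (g : L[X]) (hk : 0 < k) (hg : g.Monic)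
    (hi : Irreducible g) (hgX : g ≠ X) (hkc : Nat.gcd k (Fintype.card L - 1) = 1)
    (hd : g ^ k ∣ f₁ * f₂) (hnd : ¬ g ^ (k + 1) ∣ f₁ * f₂) (n : ℕ)
    (hn : (X * f₁ * f₂).natDegree ≤ n) : ∑ h ∈ Mon L n, lam χ₁ χ₂ f₁ f₂ h = 0 := by
  obtain ⟨v, hv, hv1, hv2⟩ := exists_v χ₂ hχ f₁ f₂ h1 h2 hc k g hk hg hi hgX hkc hd hnd
  set R := X * f₁ * f₂ with hR
  have hRm : R.Monic := (monic_X.mul h1).mul h2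
  have hR1 : R ≠ 1 := by
    intro h
    have := congrArg natDegree h
    rw [hR, (monic_X.mul h1).natDegree_mul h2, monic_X.natDegree_mul h1] at this
    simp at this
  let ψ : L[X] → L[X] → L[X] := fun v h => h + ((v - 1) * h) %ₘ R
  have hψdeg : ∀ v h, ((v - 1) * h %ₘ R).degree < R.degree := fun v h => degree_modByMonic_lt _ hRm
  have hRn : R.degree ≤ n := by
    rw [degree_eq_natDegree hRm.ne_zero]; exact_mod_cast hn
  have hψ : ∀ v h, h ∈ Mon L n → ψ v h ∈ Mon L n := by
    intro v h hh
    rw [mem_Mon] at hh ⊢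
    have hdh : h.degree = n := by rw [degree_eq_natDegree hh.1.ne_zero, hh.2]
    have hlt : ((v - 1) * h %ₘ R).degree < h.degree := by
      rw [hdh]; exact (hψdeg v h).trans_le hRn
    exact ⟨hh.1.add_of_left hlt, by rw [natDegree_add_eq_left_of_degree_lt hlt, hh.2]⟩
  have hψmod : ∀ v h, R ∣ ψ v h - v * h := by
    intro v h
    refine ⟨- ((v - 1) * h /ₘ R), ?_⟩
    have := modByMonic_add_div ((v-1) * h) R
    simp only [ψ]
    linear_combination this
  obtain ⟨w, s, hws⟩ := hv
  have hdiff : ∀ v w h, R ∣ v * w - 1 → h ∈ Mon L n → ψ v (ψ w h) = h := by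
    intro v w h hvw hh
    have hm := mem_Mon.1 (hψ v _ (hψ w h hh))
    have hd : R ∣ ψ v (ψ w h) - h := by
      have e : ψ v (ψ w h) - h = (ψ v (ψ w h) - v * ψ w h) + v * (ψ w h - w * h) + (v * w - 1) * h := by ring
      rw [e]
      exact dvd_add (dvd_add (hψmod _ _) ((hψmod _ _).mul_left _)) (hvw.mul_right _)
    have hlt : (ψ v (ψ w h) - h).degree < R.degree := by
      have e : ψ v (ψ w h) - h = ((w - 1) * h) %ₘ R + ((v - 1) * ψ w h) %ₘ R := by
        simp only [ψ]; ring
      rw [e]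
      exact (degree_add_le _ _).trans_lt (max_lt (hψdeg _ _) (hψdeg _ _))
    exact sub_eq_zero.1 (eq_zero_of_dvd_of_degree_lt hd hlt)
  have hvw : R ∣ v * w - 1 := ⟨-s, by linear_combination hws⟩
  have hlam : ∀ h ∈ Mon L n, lam χ₁ χ₂ f₁ f₂ (ψ v h) =
      (χ₂ (nm f₁ v) * χ₂⁻¹ (nm f₂ v)) * lam χ₁ χ₂ f₁ f₂ h := by
    intro h hh
    have key : ∀ f : L[X], f.Monic → f ∣ R → nm (ψ v h) f = nm f v * nm h f := by
      intro f hf hfR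
      rw [nm_comm, nm_congr hf (hfR.trans (hψmod v h)), nm_mul_right hf, nm_comm h f,
        (mem_Mon.1 hh).2, (mem_Mon.1 (hψ v h hh)).2]
      ring
    simp only [lam]
    rw [key X monic_X ⟨f₁ * f₂, by rw [hR]; ring⟩, key f₁ h1 ⟨X * f₂, by rw [hR]; ring⟩,
      key f₂ h2 ⟨X * f₁, by rw [hR]; ring⟩, hv1, map_mul, map_mul, map_mul, map_one]
    ring
  have hsum : ∑ h ∈ Mon L n, lam χ₁ χ₂ f₁ f₂ (ψ v h) = ∑ h ∈ Mon L n, lam χ₁ χ₂ f₁ f₂ h := by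
    apply Finset.sum_bij' (fun h _ => ψ v h) (fun h _ => ψ w h)
    · exact fun h hh => hψ v h hh
    · exact fun h hh => hψ w h hh
    · exact fun h hh => hdiff w v h (by rwa [mul_comm]) hh
    · exact fun h hh => hdiff v w h hvw hh
    · intros; rfl
  rw [Finset.sum_congr rfl hlam, ← Finset.mul_sum] at hsum
  have : (χ₂ (nm f₁ v) * χ₂⁻¹ (nm f₂ v) - 1) * ∑ h ∈ Mon L n, lam χ₁ χ₂ f₁ f₂ h = 0 := by
    rw [sub_mul, hsum, one_mul, sub_self]
  exact (mul_eq_zero.1 this).resolve_left (sub_ne_zero.2 hv2)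

lemma lam_one (χ₁ χ₂ : MulChar L ℂ) (f₁ f₂ : L[X]) : lam χ₁ χ₂ f₁ f₂ 1 = 1 := by
  simp [lam, nm_one_left]

lemma Mon_zero : Mon L 0 = {1} := by
  ext p
  rw [mem_Mon, Finset.mem_singleton]
  constructor
  · rintro ⟨a, b⟩; exact a.natDegree_eq_zero.1 b
  · rintro rfl; exact ⟨monic_one, natDegree_one⟩

lemma EE_one : EE L 1 = by classical exact Finset.univ.image (algebraMap L (Om L)) := by
  classical
  symm
  apply Finset.eq_of_subset_of_card_le
  · intro x hx
    have hx' : x ∈ Finset.univ.image (algebraMap L (Om L)) := by convert hx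
    rw [Finset.mem_image] at hx'
    obtain ⟨a, _, rfl⟩ := hx'
    rw [mem_EE Nat.one_pos, pow_one, ← map_pow, FiniteField.pow_card]
  · have : (Finset.univ.image (algebraMap L (Om L))).card = Fintype.card L := by
      rw [Finset.card_image_of_injective _ alg_inj, Finset.card_univ]
    have h2 : (EE L 1).card ≤ Fintype.card L := by
      have h1 : 1 < (Fintype.card L) ^ 1 := by rw [pow_one]; exact card_gt
      simp only [EE]
      refine (Multiset.toFinset_card_le _).trans ((card_roots' _).trans ?_)
      rw [FiniteField.X_pow_card_sub_X_natDegree_eq _ h1, pow_one]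
    refine h2.trans (le_of_eq ?_)
    rw [← this]

lemma S_one (χ₁ χ₂ : MulChar L ℂ) (f₁ f₂ : L[X]) :
    ∑ y ∈ EE L 1, lam χ₁ χ₂ f₁ f₂ (hxp 1 y) =
      ∑ x : L, χ₁ x * χ₂ (f₁.eval x) * χ₂⁻¹ (f₂.eval x) := by
  classical
  have e : EE L 1 = Finset.univ.image (algebraMap L (Om L)) := by rw [EE_one]
  rw [e, Finset.sum_image (fun a _ b _ h => alg_inj h)]
  apply Finset.sum_congr rfl
  intro x _
  have : ∀ f : L[X], nm (hxp 1 (algebraMap L (Om L) x)) f = f.eval x := by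
    intro f
    apply alg_inj
    rw [nm_hxp Nat.one_pos]
    · simp [aeval_algebraMap_apply]
    · rw [mem_EE Nat.one_pos, pow_one, ← map_pow, FiniteField.pow_card]
  simp only [lam, this, eval_X]

end PC
end Stp

open Polynomial
set_option linter.unusedSectionVars false
namespace Stp
section PF
variable {L : Type} [Field L] [Fintype L]

/-- the exponent `1 + Q + ... + Q^(k-1)` -/
noncomputable def geo (L : Type) [Fintype L] (k : ℕ) : ℕ := ∑ i ∈ Finset.range k, (Fintype.card L) ^ i

lemma geo_eq (k : ℕ) : (Fintype.card L - 1) * geo L k + 1 = (Fintype.card L) ^ k := by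
  have h1 := card_gt (L := L)
  have := Nat.pred_mul_geom_sum_le (Fintype.card L) 1 k
  have h := geom_sum_mul_add (Fintype.card L - 1) k
  rw [Nat.sub_add_cancel h1.le] at h
  rw [geo, mul_comm]; exact h

lemma D_ne_zero : ((Fintype.card L - 1 : ℕ) : Om L) ≠ 0 := by
  have h1 := card_gt (L := L)
  rw [Nat.cast_sub h1.le]
  have : ((Fintype.card L : ℕ) : Om L) = 0 := by
    rw [← map_natCast (algebraMap L (Om L)), Nat.cast_card_eq_zero L, map_zero]
  rw [this]; simp

lemma card_EE {k : ℕ} (hk : 0 < k) : (EE L k).card = (Fintype.card L) ^ k := by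
  classical
  have h1 : 1 < (Fintype.card L) ^ k := Nat.one_lt_pow hk.ne' card_gt
  simp only [EE]
  obtain ⟨p, hp⟩ := CharP.exists L
  obtain ⟨a, hpr, ha⟩ := FiniteField.card L p
  have : Fact p.Prime := ⟨hpr⟩
  have hcp : CharP (Om L) p := charP_of_injective_algebraMap alg_inj p
  have hsep : ((X : (Om L)[X]) ^ (Fintype.card L) ^ k - X).Separable := by
    apply galois_poly_separable p
    rw [ha, ← pow_mul]
    exact dvd_pow_self p (Nat.mul_pos a.pos hk).ne'
  rw [Multiset.toFinset_card_of_nodup (nodup_roots hsep),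
    ← (IsAlgClosed.splits _).natDegree_eq_card_roots,
    FiniteField.X_pow_card_sub_X_natDegree_eq _ h1]

/-- shape of `f₁ f₂^(D-1)` -/
lemma shape (f₁ f₂ : L[X]) (hc : IsCoprime f₁ f₂) (k : ℕ) (g : L[X]) (hk : 0 < k)
    (hi : Irreducible g) (D : ℕ) (hD : 0 < D) (hkc : Nat.gcd k D = 1)
    (hd : g ^ k ∣ f₁ * f₂) (hnd : ¬ g ^ (k + 1) ∣ f₁ * f₂) :
    ∃ (E : ℕ) (U : L[X]), f₁ * f₂ ^ (D - 1) = g ^ E * U ∧ ¬ g ∣ U ∧ Nat.Coprime E D := by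
  have hp : Prime g := hi.prime
  have hgd : g ∣ f₁ * f₂ := (dvd_pow_self g hk.ne').trans hd
  rcases hp.dvd_or_dvd hgd with h | h
  · have hg2 : IsCoprime g f₂ := hc.of_isCoprime_of_dvd_left h
    have hda : g ^ k ∣ f₁ := (hg2.pow_left).dvd_of_dvd_mul_right hd
    obtain ⟨u, rfl⟩ := hda
    refine ⟨k, u * f₂ ^ (D - 1), by ring, ?_, hkc⟩
    intro h'
    rcases hp.dvd_or_dvd h' with ⟨w, rfl⟩ | h''
    · exact hnd ⟨w * f₂, by ring⟩
    · exact (hi.coprime_iff_not_dvd.1 hg2) (hp.dvd_of_dvd_pow h'')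
  · have hg2 : IsCoprime g f₁ := hc.symm.of_isCoprime_of_dvd_left h
    have hda : g ^ k ∣ f₂ := (hg2.pow_left).dvd_of_dvd_mul_left hd
    obtain ⟨u, rfl⟩ := hda
    refine ⟨k * (D - 1), f₁ * u ^ (D - 1), by ring, ?_, ?_⟩
    · intro h'
      rcases hp.dvd_or_dvd h' with h'' | h''
      · exact (hi.coprime_iff_not_dvd.1 hg2) h''
      · obtain ⟨w, rfl⟩ := hp.dvd_of_dvd_pow h''
        exact hnd ⟨w * f₁, by ring⟩
    · apply Nat.Coprime.mul_left hkc
      have : Nat.Coprime (D - 1) (D - 1 + 1) := by simp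
      rwa [Nat.sub_add_cancel hD] at this

lemma fiber_bound (s0 : ℕ) (hQ : Fintype.card L = s0 ^ 2) (f₁ f₂ : L[X])
    (hc : IsCoprime f₁ f₂) (kk : ℕ) (g : L[X]) (hk0 : 0 < kk) (hg : g.Monic)
    (hi : Irreducible g) (hgX : g ≠ X) (hkc : Nat.gcd kk (Fintype.card L - 1) = 1)
    (hd : g ^ kk ∣ f₁ * f₂) (hnd : ¬ g ^ (kk + 1) ∣ f₁ * f₂)
    (D m : ℕ) (hD : D = Fintype.card L - 1) (hm : m = (f₁ * f₂ ^ (D - 1)).natDegree * D)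
    (k : ℕ) (hk : 0 < k) (hbig : 2 * (D * (D * m + 3)) ≤ s0 ^ k) (u v : L) (hu : u ≠ 0) (hv : v ≠ 0)
    (Z : Finset (Om L)) (hZ : ∀ x ∈ Z, x ∈ EE L k ∧ nm (hxp k x) X = u ∧
      nm (hxp k x) f₁ / nm (hxp k x) f₂ = v) :
    D * D * Z.card ≤ (s0 ^ k) ^ 2 + (D * (D * m + 3) + m + D * m) * s0 ^ k := by
  classical
  have hQ1 := card_gt (L := L)
  have hDpos : 0 < D := by omega
  have hDne : ((D : ℕ) : Om L) ≠ 0 := by rw [hD]; exact D_ne_zero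
  obtain ⟨p, hp⟩ := CharP.exists L
  obtain ⟨a, hpr, ha⟩ := FiniteField.card L p
  have : Fact p.Prime := ⟨hpr⟩
  have hcp : CharP (Om L) p := charP_of_injective_algebraMap alg_inj p
  have hhk := geo_eq (L := L) k
  rw [← hD] at hhk
  have hhpos : 0 < geo L k := by
    rcases Nat.eq_zero_or_pos (geo L k) with h | h
    · rw [h] at hhk
      have := Nat.one_lt_pow hk.ne' hQ1
      omega
    · exact h
  obtain ⟨c, hcu⟩ := IsAlgClosed.exists_pow_nat_eq (algebraMap L (Om L) u) hhpos
  have hau : algebraMap L (Om L) u ≠ 0 := (_root_.map_ne_zero _).2 hu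
  have hc0 : c ≠ 0 := by
    rintro rfl
    rw [zero_pow hhpos.ne'] at hcu
    exact hau hcu.symm
  obtain ⟨γ, hγ⟩ := IsAlgClosed.exists_aeval_eq_zero (Om L) g hi.degree_pos.ne'
  have hgm : minpoly L γ = g := (minpoly.eq_of_irreducible_of_monic hi hγ hg).symm
  have hγ0 : γ ≠ 0 := by
    rintro rfl
    rw [minpoly.zero] at hgm
    exact hgX hgm.symm
  obtain ⟨δ, hδ⟩ := IsAlgClosed.exists_pow_nat_eq (γ / c) hDpos
  have hδ0 : δ ^ D ≠ 0 := by rw [hδ]; exact div_ne_zero hγ0 hc0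
  obtain ⟨E, U, hEU, hgU, hED⟩ := shape f₁ f₂ hc kk g hk0 hi D hDpos (by rw [hD]; exact hkc) hd hnd
  obtain ⟨V0, hV0⟩ : (X - C γ) ∣ g.map (algebraMap L (Om L)) := by
    rw [dvd_iff_isRoot, IsRoot, eval_map_algebraMap]; exact hγ
  have hV0γ : V0.eval γ ≠ 0 := by
    have hs : (g.map (algebraMap L (Om L))).Separable :=
      (PerfectField.separable_of_irreducible hi).map
    rw [hV0] at hs
    have := hs.isCoprime
    obtain ⟨r, s, hrs⟩ := this
    intro h0
    have := congrArg (eval γ) hrs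
    simp [h0] at this
  have hUγ : (U.map (algebraMap L (Om L))).eval γ ≠ 0 := by
    rw [eval_map_algebraMap]
    intro h
    exact hgU (hgm ▸ minpoly.dvd L γ h)
  obtain ⟨W0, hW0⟩ : (X - C δ) ∣ (X ^ D - C (δ ^ D)) := by
    rw [dvd_iff_isRoot]; simp
  have hW0δ : W0.eval δ ≠ 0 := by
    have hs : ((X : (Om L)[X]) ^ D - C (δ ^ D)).Separable :=
      separable_X_pow_sub_C _ hDne hδ0
    rw [hW0] at hs
    obtain ⟨r, s, hrs⟩ := hs.isCoprime
    intro h0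
    have := congrArg (eval δ) hrs
    simp [h0] at this
  set G := (f₁ * f₂ ^ (D - 1)).map (algebraMap L (Om L)) with hG
  set F := G.comp (C c * X ^ D) with hF
  set W := (C c * W0) ^ E * (V0 ^ E * U.map (algebraMap L (Om L))).comp (C c * X ^ D) with hW
  have hcδ : c * δ ^ D = γ := by rw [hδ]; field_simp
  have hFW : F = (X - C δ) ^ E * W := by
    have h1 : C c * X ^ D - C γ = (X - C δ) * (C c * W0) := by
      rw [← hcδ, C_mul]
      linear_combination C c * hW0
    have h2 : G = (X - C γ) ^ E * (V0 ^ E * U.map (algebraMap L (Om L))) := by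
      rw [hG, hEU, Polynomial.map_mul, Polynomial.map_pow, hV0, mul_pow, mul_assoc]
    rw [hF, h2, mul_comp, pow_comp, sub_comp, X_comp, C_comp, h1, hW, mul_pow, mul_assoc]
  have hWδ : W.eval δ ≠ 0 := by
    rw [hW]
    simp only [eval_mul, eval_pow, eval_C, eval_comp, eval_X, hcδ]
    exact mul_ne_zero (pow_ne_zero _ (mul_ne_zero hc0 hW0δ)) (mul_ne_zero (pow_ne_zero _ hV0γ) hUγ)
  have hFm : F.natDegree ≤ m := by
    rw [hF, natDegree_comp, hm, hG]
    apply Nat.mul_le_mul natDegree_map_le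
    exact natDegree_C_mul_X_pow_le _ _
  -- the points
  set T : Finset (Om L) := Z.biUnion (fun x => (X ^ D - C (x / c)).roots.toFinset) with hT
  have hmemT : ∀ x t, t ∈ (X ^ D - C (x / c)).roots.toFinset → c * t ^ D = x := by
    intro x t ht
    rw [Multiset.mem_toFinset, mem_roots (X_pow_sub_C_ne_zero hDpos _)] at ht
    simp only [IsRoot, eval_sub, eval_pow, eval_X, eval_C, sub_eq_zero] at ht
    rw [ht]; field_simp
  have hx0 : ∀ x ∈ Z, x ^ geo L k = algebraMap L (Om L) u := by
    intro x hx
    obtain ⟨h1, h2, _⟩ := hZ x hx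
    have := nm_hxp hk h1 X
    rw [h2, aeval_X] at this
    exact this.symm
  have hTcard : T.card = D * Z.card := by
    rw [hT, Finset.card_biUnion, mul_comm, ← smul_eq_mul, ← Finset.sum_const]
    · apply Finset.sum_congr rfl
      intro x hx
      have hxne : x / c ≠ 0 := by
        apply div_ne_zero _ hc0
        rintro rfl
        have := hx0 0 hx
        rw [zero_pow hhpos.ne'] at this
        exact hau this.symm
      rw [Multiset.toFinset_card_of_nodup (nodup_roots (separable_X_pow_sub_C _ hDne hxne)),
        ← (IsAlgClosed.splits _).natDegree_eq_card_roots, natDegree_X_pow_sub_C]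
    · intro x _ y _ hxy
      rw [Function.onFun, Finset.disjoint_left]
      intro t h1 h2
      exact hxy ((hmemT x t h1).symm.trans (hmemT y t h2))
  have hpn : p ^ ((a:ℕ) * k) = (Fintype.card L) ^ k := by rw [ha, pow_mul]
  have key := stepanov p ((a:ℕ) * k) D (geo L k) E m (s0 ^ k) F W δ (algebraMap L (Om L) v) hFW hWδ hFm hED
    hDpos (by rw [hpn, hhk]) (by rw [hpn, hQ]; ring) hbig T (by
      intro t ht
      rw [hT, Finset.mem_biUnion] at ht
      obtain ⟨x, hx, htx⟩ := ht
      have hct := hmemT x t htx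
      obtain ⟨hxE, hxu, hxv⟩ := hZ x hx
      have hFt : F.eval t = aeval x f₁ * (aeval x f₂) ^ (D - 1) := by
        rw [hF, eval_comp]
        simp only [eval_mul, eval_C, eval_pow, eval_X, hct]
        rw [hG, eval_map_algebraMap]; simp
      have hn1 := nm_hxp hk hxE f₁
      have hn2 := nm_hxp hk hxE f₂
      have hf2 : nm (hxp k x) f₂ ≠ 0 := by
        intro h0; rw [h0, div_zero] at hxv; exact hv hxv.symm
      have hFh : F.eval t ^ geo L k = algebraMap L (Om L) v := by
        rw [hFt, mul_pow, ← pow_mul, mul_comm (D - 1), pow_mul]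
        unfold geo
        rw [← hn1, ← hn2, ← map_pow, ← map_mul, ← hxv]
        congr 1
        rw [div_eq_mul_inv]
        congr 1
        apply eq_inv_of_mul_eq_one_left
        rw [← pow_succ, Nat.sub_add_cancel hDpos, hD, FiniteField.pow_card_sub_one_eq_one _ hf2]
      refine ⟨?_, ?_, hFh⟩
      · rw [hpn, ← hhk, pow_add, pow_mul, pow_one]
        have : (t ^ D) ^ geo L k = 1 := by
          have h1 : (c * t ^ D) ^ geo L k = c ^ geo L k := by rw [hct, hx0 x hx, hcu]
          rw [mul_pow] at h1
          exact mul_left_cancel₀ (pow_ne_zero _ hc0) (h1.trans (mul_one _).symm)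
        rw [this, one_mul]
      · intro h0
        rw [h0, zero_pow hhpos.ne'] at hFh
        exact hv ((map_eq_zero _).1 hFh.symm))
  rw [hTcard] at key
  calc D * D * Z.card = D * Z.card * D := by ring
    _ ≤ _ := key

lemma lam_eq (χ₁ χ₂ : MulChar L ℂ) (f₁ f₂ h : L[X]) :
    lam χ₁ χ₂ f₁ f₂ h = χ₁ (nm h X) * χ₂ (nm h f₁ / nm h f₂) := by
  rw [lam, MulChar.inv_apply', div_eq_mul_inv, map_mul, mul_assoc]

lemma norm_mulChar_le (χ : MulChar L ℂ) (x : L) : ‖χ x‖ ≤ 1 := by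
  by_cases hx : x = 0
  · subst hx; rw [χ.map_zero]; simp
  · have h := congrArg norm (mulChar_pow χ hx)
    rw [norm_pow, norm_one] at h
    have hQ1 := card_gt (L := L)
    exact ((pow_eq_one_iff_of_nonneg (norm_nonneg _) (by omega)).1 h).le

/-- The combinatorial estimate. -/
lemma char_sum_bound (χ₁ χ₂ : MulChar L ℂ) (hχ : χ₂ ≠ 1) {ι : Type*} (E : Finset ι) (A B : ι → L)
    (D c T : ℝ) (hD : D = Fintype.card L - 1)
    (hN : ∀ u v : L, u ≠ 0 → v ≠ 0 → D * D * ((by classical exact E.filter (fun x => A x = u ∧ B x = v)) : Finset ι).card ≤ c)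
    (hT : (E.card : ℝ) - T ≤ ((by classical exact E.filter (fun x => A x ≠ 0 ∧ B x ≠ 0)) : Finset ι).card) :
    ‖∑ x ∈ E, χ₁ (A x) * χ₂ (B x)‖ ≤ c - E.card + T := by
  classical
  have hQ1 := card_gt (L := L)
  have hDpos : 0 < D := by rw [hD]; have : (1:ℝ) < Fintype.card L := by exact_mod_cast hQ1
                           linarith
  set N : L × L → ℕ := fun w => (E.filter (fun x => A x = w.1 ∧ B x = w.2)).card with hNdef
  set P : Finset (L × L) := (Finset.univ.erase 0) ×ˢ (Finset.univ.erase 0) with hP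
  have hPmem : ∀ w, w ∈ P ↔ w.1 ≠ 0 ∧ w.2 ≠ 0 := by intro w; simp [hP]
  have hPcard : (P.card : ℝ) = D * D := by
    rw [hP, Finset.card_product, Finset.card_erase_of_mem (Finset.mem_univ _), Finset.card_univ, hD]
    push_cast [Nat.cast_sub hQ1.le]; ring
  have h1 : ∑ x ∈ E, χ₁ (A x) * χ₂ (B x) = ∑ w ∈ P, χ₁ w.1 * χ₂ w.2 * (N w : ℂ) := by
    have h2 : ∑ x ∈ E, χ₁ (A x) * χ₂ (B x) =
        ∑ x ∈ E.filter (fun x => (A x, B x) ∈ P), χ₁ (A x) * χ₂ (B x) := by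
      rw [Finset.sum_filter_of_ne]
      intro x _ hx
      rw [hPmem]
      constructor
      · intro h0; apply hx; simp only at h0; rw [h0, MulChar.map_zero]; simp
      · intro h0; apply hx; simp only at h0; rw [h0, MulChar.map_zero]; simp
    rw [h2, ← Finset.sum_fiberwise_of_maps_to (g := fun x => (A x, B x)) (t := P)
      (fun x hx => (Finset.mem_filter.1 hx).2)]
    apply Finset.sum_congr rfl
    intro w hw
    rw [Finset.filter_filter]
    have h3 : E.filter (fun x => (A x, B x) ∈ P ∧ (A x, B x) = w) =
        E.filter (fun x => A x = w.1 ∧ B x = w.2) := by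
      apply Finset.filter_congr
      intro x _
      constructor
      · rintro ⟨_, rfl⟩; exact ⟨rfl, rfl⟩
      · rintro ⟨a, b⟩
        have : (A x, B x) = w := Prod.ext a b
        exact ⟨this ▸ hw, this⟩
    rw [h3, Finset.sum_congr rfl (g := fun _ => χ₁ w.1 * χ₂ w.2), Finset.sum_const, nsmul_eq_mul, mul_comm]
    intro x hx
    have := (Finset.mem_filter.1 hx).2
    rw [this.1, this.2]
  have h4 : ∑ w ∈ P, χ₁ w.1 * χ₂ w.2 = 0 := by
    rw [hP, Finset.sum_product]
    have : ∑ v ∈ Finset.univ.erase (0:L), χ₂ v = 0 := by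
      rw [← MulChar.sum_eq_zero_of_ne_one hχ, Finset.sum_erase]; exact χ₂.map_zero
    simp [← Finset.mul_sum, this]
  have h5 : ∑ x ∈ E, χ₁ (A x) * χ₂ (B x) =
      - ∑ w ∈ P, χ₁ w.1 * χ₂ w.2 * ((c / (D * D) - N w : ℝ) : ℂ) := by
    rw [h1]
    push_cast
    simp only [mul_sub, Finset.sum_sub_distrib]
    rw [← Finset.sum_mul, h4]; simp
  have hcard : (∑ w ∈ P, (N w : ℝ)) = ((E.filter (fun x => A x ≠ 0 ∧ B x ≠ 0)).card : ℝ) := by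
    rw [Finset.card_eq_sum_card_fiberwise (f := fun x => (A x, B x)) (t := P)]
    · push_cast
      apply Finset.sum_congr rfl
      intro w hw
      rw [hNdef]
      simp only
      congr 2
      rw [Finset.filter_filter]
      apply Finset.filter_congr
      intro x _
      rw [hPmem] at hw
      constructor
      · rintro ⟨a, b⟩
        exact ⟨⟨a ▸ hw.1, b ▸ hw.2⟩, Prod.ext a b⟩
      · rintro ⟨_, rfl⟩; exact ⟨rfl, rfl⟩
    · intro x hx
      have := (Finset.mem_filter.1 hx).2
      exact (hPmem _).2 this
  rw [h5, norm_neg]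
  calc _ ≤ ∑ w ∈ P, ‖χ₁ w.1 * χ₂ w.2 * ((c / (D * D) - N w : ℝ) : ℂ)‖ := norm_sum_le _ _
    _ ≤ ∑ w ∈ P, (c / (D * D) - N w) := by
      apply Finset.sum_le_sum
      intro w hw
      rw [hPmem] at hw
      have hnn : 0 ≤ c / (D * D) - N w := by
        rw [sub_nonneg, le_div_iff₀ (mul_pos hDpos hDpos), mul_comm]
        convert hN w.1 w.2 hw.1 hw.2
      rw [norm_mul, norm_mul, Complex.norm_real, Real.norm_of_nonneg hnn]
      calc _ ≤ 1 * 1 * (c / (D * D) - N w) := by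
            gcongr
            · exact norm_mulChar_le _ _
            · exact norm_mulChar_le _ _
        _ = _ := by ring
    _ = c - ∑ w ∈ P, (N w : ℝ) := by
      rw [Finset.sum_sub_distrib, Finset.sum_const, nsmul_eq_mul, hPcard,
        mul_div_cancel₀ _ (mul_pos hDpos hDpos).ne']
    _ ≤ _ := by
      rw [hcard]
      have : (E.card : ℝ) - T ≤ ((E.filter (fun x => A x ≠ 0 ∧ B x ≠ 0)).card : ℝ) := by
        convert hT
      linarith

theorem weil (s0 N : ℕ) (hQ : Fintype.card L = s0 ^ 2) (χ₁ χ₂ : MulChar L ℂ) (hχ : χ₂ ≠ 1)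
    (f₁ f₂ : L[X]) (h1 : f₁.Monic)
    (h2 : f₂.Monic) (hc : IsCoprime f₁ f₂) (k : ℕ) (g : L[X]) (hk : 0 < k) (hg : g.Monic)
    (hi : Irreducible g) (hgX : g ≠ X) (hkc : Nat.gcd k (Fintype.card L - 1) = 1)
    (hd : g ^ k ∣ f₁ * f₂) (hnd : ¬ g ^ (k + 1) ∣ f₁ * f₂)
    (hN : (X * f₁ * f₂).natDegree ≤ N + 1) :
    ‖∑ x : L, χ₁ x * χ₂ (f₁.eval x) * χ₂⁻¹ (f₂.eval x)‖ ≤ N * s0 := by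
  classical
  have hQ1 := card_gt (L := L)
  have hs0 : 2 ≤ s0 := by
    by_contra h
    have : s0 = 0 ∨ s0 = 1 := by omega
    rcases this with rfl | rfl <;> simp at hQ <;> omega
  set D := Fintype.card L - 1 with hD
  set m := (f₁ * f₂ ^ (D - 1)).natDegree * D with hm
  set C0 := D * (D * m + 3) + m + D * m with hC0
  set R := X * f₁ * f₂ with hR
  have hRm : R.Monic := (monic_X.mul h1).mul h2
  rw [← S_one]
  apply weil_of_rec N (fun n => ∑ h ∈ Mon L n, lam χ₁ χ₂ f₁ f₂ h)
    (fun k => ∑ y ∈ EE L k, lam χ₁ χ₂ f₁ f₂ (hxp k y)) (r := (s0:ℝ)) (K := (C0 : ℝ) + R.natDegree)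
    (k0 := 2 * (D * (D * m + 3)) + 1)
  · simp [Mon_zero, lam_one]
  · intro n hn
    exact lam_vanish χ₁ χ₂ hχ f₁ f₂ h1 h2 hc k g hk hg hi hgX hkc hd hnd n (by rw [← hR]; omega)
  · intro n
    exact recursion _ (lam_mul χ₁ χ₂ f₁ f₂) n
  · exact_mod_cast (by omega : 0 < s0)
  · intro j hj
    have hjpos : 0 < j := by omega
    have hbig : 2 * (D * (D * m + 3)) ≤ s0 ^ j := by
      have h3 : j < 2 ^ j := Nat.lt_two_pow_self
      have h4 : 2 ^ j ≤ s0 ^ j := Nat.pow_le_pow_left hs0 j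
      omega
    simp only [lam_eq]
    have hcE := card_EE (L := L) hjpos
    have := char_sum_bound χ₁ χ₂ hχ (EE L j) (fun x => nm (hxp j x) X)
      (fun x => nm (hxp j x) f₁ / nm (hxp j x) f₂) (D : ℝ) ((s0 ^ j) ^ 2 + C0 * s0 ^ j) R.natDegree
      (by rw [hD, Nat.cast_sub hQ1.le]; simp) (by
        intro u v hu hv
        have := fiber_bound s0 hQ f₁ f₂ hc k g hk hg hi hgX hkc hd hnd D m hD hm j hjpos hbig u v hu hv
          ((EE L j).filter (fun x => nm (hxp j x) X = u ∧ nm (hxp j x) f₁ / nm (hxp j x) f₂ = v))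
          (by intro x hx; exact Finset.mem_filter.1 hx)
        exact_mod_cast this) (by
        have hsub : (EE L j).filter (fun x => ¬ (nm (hxp j x) X ≠ 0 ∧ nm (hxp j x) f₁ / nm (hxp j x) f₂ ≠ 0)) ⊆
            (R.map (algebraMap L (Om L))).roots.toFinset := by
          intro x hx
          rw [Finset.mem_filter] at hx
          obtain ⟨hxE, hx2⟩ := hx
          rw [Multiset.mem_toFinset, mem_roots (hRm.map _).ne_zero, IsRoot, eval_map_algebraMap]
          by_contra hne
          rw [hR, map_mul, map_mul] at hne
          apply hx2
          have hz : ∀ f : L[X], aeval x f ≠ 0 → nm (hxp j x) f ≠ 0 := by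
            intro f hf h0
            have := nm_hxp hjpos hxE f
            rw [h0, map_zero] at this
            exact pow_ne_zero _ hf this.symm
          have ha := left_ne_zero_of_mul hne
          exact ⟨hz _ (left_ne_zero_of_mul ha),
            div_ne_zero (hz _ (right_ne_zero_of_mul ha)) (hz _ (right_ne_zero_of_mul hne))⟩
        have hcard := Finset.card_le_card hsub
        have hroots : (R.map (algebraMap L (Om L))).roots.toFinset.card ≤ R.natDegree :=
          (Multiset.toFinset_card_le _).trans ((card_roots' _).trans natDegree_map_le)
        have hadd := Finset.card_filter_add_card_filter_not (s := EE L j) (fun x => (nm (hxp j x) X ≠ 0 ∧ nm (hxp j x) f₁ / nm (hxp j x) f₂ ≠ 0))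
        have hle : (EE L j).card ≤ ((EE L j).filter (fun x => (nm (hxp j x) X ≠ 0 ∧ nm (hxp j x) f₁ / nm (hxp j x) f₂ ≠ 0))).card + R.natDegree := by omega
        have hle' : ((EE L j).card : ℝ) ≤ ((EE L j).filter (fun x => (nm (hxp j x) X ≠ 0 ∧ nm (hxp j x) f₁ / nm (hxp j x) f₂ ≠ 0))).card + R.natDegree := by exact_mod_cast hle
        linarith)
    refine this.trans ?_
    rw [hcE, hQ]
    push_cast
    have hs1 : (1:ℝ) ≤ (s0:ℝ) ^ j := one_le_pow₀ (by exact_mod_cast (by omega : 1 ≤ s0))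
    have e : ((s0:ℝ) ^ j) ^ 2 = ((s0:ℝ) ^ 2) ^ j := by ring
    rw [e]
    have : (0:ℝ) ≤ R.natDegree := Nat.cast_nonneg _
    nlinarith

end PF
end Stp

open Polynomial
set_option linter.unusedSectionVars false
namespace Stp
section PG
variable {L : Type} [Field L] [Fintype L]

lemma exists_chp (p : ℕ) : ∃ χ : MulChar L ℂ, p.Prime → p ∣ Fintype.card L - 1 → orderOf χ = p := by
  by_cases h : p.Prime ∧ p ∣ Fintype.card L - 1
  · obtain ⟨χ, hχ⟩ := MulChar.exists_mulChar_orderOf L h.2 (Complex.isPrimitiveRoot_exp p h.1.ne_zero)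
    exact ⟨χ, fun _ _ => hχ⟩
  · exact ⟨1, fun a b => absurd ⟨a, b⟩ h⟩

noncomputable def chp (p : ℕ) : MulChar L ℂ := (exists_chp p).choose

variable (L) in
def PrimeD (p : ℕ) : Prop := p.Prime ∧ p ∣ Fintype.card L - 1

lemma chp_order {p : ℕ} (h : PrimeD L p) : orderOf (chp p : MulChar L ℂ) = p :=
  (exists_chp p).choose_spec h.1 h.2

lemma chp_pow {p : ℕ} (h : PrimeD L p) : (chp p : MulChar L ℂ) ^ p = 1 := by
  have := pow_orderOf_eq_one (chp p : MulChar L ℂ)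
  rwa [chp_order h] at this

lemma mulChar_pow_apply (χ : MulChar L ℂ) (n : ℕ) {y : L} (hy : y ≠ 0) : (χ ^ n) y = χ y ^ n := by
  obtain ⟨u, rfl⟩ := hy.isUnit
  exact MulChar.pow_apply_coe χ n u

noncomputable def acoef (p j : ℕ) : ℝ := if j = 0 then 1 - 1 / p else - 1 / p

open Classical in
noncomputable def wp (p : ℕ) (y : L) : ℝ := if (chp p : MulChar L ℂ) y = 1 then 0 else 1

lemma wp_eq {p : ℕ} (h : PrimeD L p) {y : L} (hy : y ≠ 0) :
    ((wp p y : ℝ) : ℂ) = ∑ j ∈ Finset.range p, (acoef p j : ℂ) * ((chp p : MulChar L ℂ) y) ^ j := by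
  have hp0 : (p : ℂ) ≠ 0 := by exact_mod_cast h.1.ne_zero
  set z := (chp p : MulChar L ℂ) y with hz
  have hzp : z ^ p = 1 := by
    rw [hz, ← mulChar_pow_apply _ _ hy, chp_pow h]
    exact MulChar.one_apply hy.isUnit
  have e : ∑ j ∈ Finset.range p, (acoef p j : ℂ) * z ^ j =
      1 - (1 / p) * ∑ j ∈ Finset.range p, z ^ j := by
    obtain ⟨n, rfl⟩ : ∃ n, p = n + 1 := ⟨p - 1, by have := h.1.pos; omega⟩
    rw [Finset.sum_range_succ', Finset.sum_range_succ']
    simp only [acoef]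
    simp only [Nat.add_eq_zero_iff, one_ne_zero, and_false, if_false, if_true, pow_zero]
    rw [← Finset.mul_sum]
    push_cast
    ring
  rw [e, wp]
  by_cases h1 : z = 1
  · rw [if_pos h1, h1]; simp; field_simp; simp
  · rw [if_neg h1]
    have : ∑ j ∈ Finset.range p, z ^ j = 0 := by
      have := geom_sum_mul z p
      rw [hzp, sub_self] at this
      exact (mul_eq_zero.1 this).resolve_right (sub_ne_zero.2 h1)
    rw [this]; simp

noncomputable def cf (C : Finset ℕ) (J : (p : ℕ) → p ∈ C → ℕ) : ℝ := ∏ x ∈ C.attach, acoef x.1 (J x.1 x.2)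
noncomputable def Xc (C : Finset ℕ) (J : (p : ℕ) → p ∈ C → ℕ) : MulChar L ℂ :=
  ∏ x ∈ C.attach, chp x.1 ^ (J x.1 x.2)

lemma Xc_apply (C : Finset ℕ) (J : (p : ℕ) → p ∈ C → ℕ) {y : L} (hy : y ≠ 0) :
    (Xc C J : MulChar L ℂ) y = ∏ x ∈ C.attach, ((chp x.1 : MulChar L ℂ) y) ^ (J x.1 x.2) := by
  let ev : MulChar L ℂ →* ℂ :=
    { toFun := fun χ => χ y
      map_one' := MulChar.one_apply hy.isUnit
      map_mul' := fun a b => rfl }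
  have h1 := map_prod ev (fun x : {x // x ∈ C} => (chp x.1 : MulChar L ℂ) ^ (J x.1 x.2)) C.attach
  calc (Xc C J : MulChar L ℂ) y = ev (Xc C J) := rfl
    _ = _ := by
      rw [Xc, h1]
      apply Finset.prod_congr rfl
      intro x _
      exact mulChar_pow_apply _ _ hy

lemma Xc_ne_one (C : Finset ℕ) (hC : ∀ p ∈ C, PrimeD L p) (J : (p : ℕ) → p ∈ C → ℕ)
    (hJ : ∀ p hp, J p hp < p) (p : ℕ) (hp : p ∈ C) (h0 : J p hp ≠ 0) : (Xc C J : MulChar L ℂ) ≠ 1 := by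
  intro h1
  set m := ∏ r ∈ C.erase p, r with hm
  have h2 : (Xc C J : MulChar L ℂ) ^ m = chp p ^ (J p hp * m) := by
    rw [Xc, ← Finset.prod_pow, Finset.prod_eq_single ⟨p, hp⟩]
    · rw [pow_mul]
    · intro x _ hx
      have hxp : x.1 ≠ p := fun h => hx (Subtype.ext h)
      have hd : x.1 ∣ m := Finset.dvd_prod_of_mem _ (Finset.mem_erase.2 ⟨hxp, x.2⟩)
      obtain ⟨w, hw⟩ := hd
      rw [hw, ← pow_mul]
      rw [show J x.1 x.2 * (x.1 * w) = x.1 * (J x.1 x.2 * w) by ring, pow_mul, chp_pow (hC _ x.2), one_pow]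
    · intro h; exact absurd (Finset.mem_attach _ _) h
  rw [h1, one_pow] at h2
  have h3 := orderOf_dvd_of_pow_eq_one h2.symm
  rw [chp_order (hC p hp)] at h3
  have hpp := (hC p hp).1
  rcases hpp.dvd_mul.1 h3 with h | h
  · exact absurd (Nat.le_of_dvd (Nat.pos_of_ne_zero h0) h) (not_le.2 (hJ p hp))
  · rw [hm, hpp.prime.dvd_finsetProd_iff] at h
    obtain ⟨r, hr, hpr⟩ := h
    rw [Finset.mem_erase] at hr
    exact hr.1 ((Nat.prime_dvd_prime_iff_eq hpp (hC r hr.2).1).1 hpr).symm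

noncomputable def wt (C : Finset ℕ) (t : ℕ → Finset ℕ) (y : L) : ℂ :=
  ∏ p ∈ C, ∑ j ∈ t p, (acoef p j : ℂ) * ((chp p : MulChar L ℂ) y) ^ j

lemma wt_eq (C : Finset ℕ) (t : ℕ → Finset ℕ) {y : L} (hy : y ≠ 0) :
    wt C t y = ∑ J ∈ C.pi t, (cf C J : ℂ) * (Xc C J : MulChar L ℂ) y := by
  rw [wt, Finset.prod_sum]
  apply Finset.sum_congr rfl
  intro J _
  rw [Finset.prod_mul_distrib, Xc_apply C J hy, cf]
  push_cast; rfl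

lemma sum_abs_cf (C : Finset ℕ) (t : ℕ → Finset ℕ) :
    ∑ J ∈ C.pi t, |cf C J| = ∏ p ∈ C, ∑ j ∈ t p, |acoef p j| := by
  rw [Finset.prod_sum]
  apply Finset.sum_congr rfl
  intro J _
  rw [cf, Finset.abs_prod]

lemma abs_acoef_zero {p : ℕ} (hp : p.Prime) : |acoef p 0| = 1 - 1 / p := by
  have : (1:ℝ) / p ≤ 1 := by
    rw [div_le_one (by exact_mod_cast hp.pos)]; exact_mod_cast hp.one_lt.le
  simp only [acoef, if_true]; rw [abs_of_nonneg (by linarith)]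

lemma sum_abs_acoef_pos {p : ℕ} (hp : p.Prime) :
    ∑ j ∈ (Finset.range p).erase 0, |acoef p j| = 1 - 1 / p := by
  have hp0 : (p:ℝ) ≠ 0 := by exact_mod_cast hp.ne_zero
  rw [Finset.sum_congr rfl (g := fun _ => (1:ℝ)/p)]
  · rw [Finset.sum_const, Finset.card_erase_of_mem (by simp [hp.pos]), Finset.card_range, nsmul_eq_mul,
      Nat.cast_sub hp.one_lt.le]
    field_simp; simp
  · intro j hj
    rw [acoef, if_neg (Finset.mem_erase.1 hj).1, abs_div, abs_neg, abs_one, Nat.abs_cast]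

lemma sum_abs_acoef {p : ℕ} (hp : p.Prime) :
    ∑ j ∈ Finset.range p, |acoef p j| = 2 * (1 - 1 / p) := by
  rw [← Finset.add_sum_erase _ _ (by simp [hp.pos] : 0 ∈ Finset.range p), sum_abs_acoef_pos hp,
    abs_acoef_zero hp]; ring

noncomputable def theta (C : Finset ℕ) : ℝ := ∏ p ∈ C, (1 - 1 / (p:ℝ))

lemma theta_pos (C : Finset ℕ) (hC : ∀ p ∈ C, PrimeD L p) : 0 < theta C := by
  apply Finset.prod_pos
  intro p hp
  have : (1:ℝ) < p := by exact_mod_cast (hC p hp).1.one_lt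
  rw [sub_pos, div_lt_one (by linarith)]; exact this

lemma sum_abs_full (C : Finset ℕ) (hC : ∀ p ∈ C, PrimeD L p) :
    ∑ J ∈ C.pi Finset.range, |cf C J| = theta C * 2 ^ C.card := by
  rw [sum_abs_cf, Finset.prod_congr rfl (fun p hp => sum_abs_acoef (hC p hp).1),
    Finset.prod_mul_distrib, Finset.prod_const, theta, mul_comm]

noncomputable def ww (C : Finset ℕ) (y : L) : ℝ := ∏ p ∈ C, wp p y

lemma ww_eq (C : Finset ℕ) (hC : ∀ p ∈ C, PrimeD L p) {y : L} (hy : y ≠ 0) :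
    ((ww C y : ℝ) : ℂ) = wt C Finset.range y := by
  rw [ww, wt]; push_cast
  exact Finset.prod_congr rfl (fun p hp => wp_eq (hC p hp) hy)

def J0 (C : Finset ℕ) : (p : ℕ) → p ∈ C → ℕ := fun _ _ => 0

lemma J0_mem (C : Finset ℕ) (hC : ∀ p ∈ C, PrimeD L p) : J0 C ∈ C.pi Finset.range := by
  rw [Finset.mem_pi]; intro p hp; simp [J0, (hC p hp).1.pos]

lemma cf_J0 (C : Finset ℕ) : cf C (J0 C) = theta C := by
  simp only [cf, J0, acoef, if_true, theta]
  exact Finset.prod_attach C (fun p => 1 - 1 / (p:ℝ))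

lemma Xc_J0 (C : Finset ℕ) : (Xc C (J0 C) : MulChar L ℂ) = 1 := by
  simp [Xc, J0]

lemma Xc_ne_one' (C : Finset ℕ) (hC : ∀ p ∈ C, PrimeD L p) (J : (p : ℕ) → p ∈ C → ℕ)
    (hJ : J ∈ C.pi Finset.range) (h0 : J ≠ J0 C) : (Xc C J : MulChar L ℂ) ≠ 1 := by
  rw [Finset.mem_pi] at hJ
  have : ∃ p, ∃ hp : p ∈ C, J p hp ≠ 0 := by
    by_contra h
    push Not at h
    exact h0 (by funext p hp; exact h p hp)
  obtain ⟨p, hp, h⟩ := this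
  exact Xc_ne_one C hC J (fun p hp => Finset.mem_range.1 (hJ p hp)) p hp h

/-- generic bound -/
lemma gen_bound {ι κ : Type*} (A : Finset ι) (y₁ y₂ : ι → L) (B : ℝ)
    (hB : ∀ χ₁ χ₂ : MulChar L ℂ, (χ₁ ≠ 1 ∨ χ₂ ≠ 1) → ‖∑ x ∈ A, χ₁ (y₁ x) * χ₂ (y₂ x)‖ ≤ B)
    (I : Finset κ) (a : κ → ℝ) (χ₁ χ₂ : κ → MulChar L ℂ) (hI : ∀ i ∈ I, χ₁ i ≠ 1 ∨ χ₂ i ≠ 1) :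
    ‖∑ i ∈ I, (a i : ℂ) * ∑ x ∈ A, χ₁ i (y₁ x) * χ₂ i (y₂ x)‖ ≤ B * ∑ i ∈ I, |a i| := by
  refine (norm_sum_le _ _).trans ?_
  rw [Finset.mul_sum]
  apply Finset.sum_le_sum
  intro i hi
  rw [norm_mul, Complex.norm_real, Real.norm_eq_abs, mul_comm]
  exact mul_le_mul_of_nonneg_right (hB _ _ (hI i hi)) (abs_nonneg _)

/-- expansion of a double weighted sum -/
lemma expand {ι : Type*} (A : Finset ι) (y₁ y₂ : ι → L) (hy₁ : ∀ x ∈ A, y₁ x ≠ 0)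
    (hy₂ : ∀ x ∈ A, y₂ x ≠ 0) (C₁ C₂ : Finset ℕ) (t₁ t₂ : ℕ → Finset ℕ) :
    ∑ x ∈ A, wt C₁ t₁ (y₁ x) * wt C₂ t₂ (y₂ x) =
      ∑ J ∈ C₁.pi t₁ ×ˢ C₂.pi t₂, ((cf C₁ J.1 * cf C₂ J.2 : ℝ) : ℂ) *
        ∑ x ∈ A, (Xc C₁ J.1 : MulChar L ℂ) (y₁ x) * (Xc C₂ J.2 : MulChar L ℂ) (y₂ x) := by
  simp only [Finset.mul_sum]
  rw [Finset.sum_comm]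
  apply Finset.sum_congr rfl
  intro x hx
  rw [wt_eq _ _ (hy₁ x hx), wt_eq _ _ (hy₂ x hx), Finset.sum_mul_sum, Finset.sum_product]
  apply Finset.sum_congr rfl; intro J _
  apply Finset.sum_congr rfl; intro J' _
  push_cast; ring

lemma sum_abs_prod (C₁ C₂ : Finset ℕ) (t₁ t₂ : ℕ → Finset ℕ) :
    ∑ J ∈ C₁.pi t₁ ×ˢ C₂.pi t₂, |cf C₁ J.1 * cf C₂ J.2| =
      (∑ J ∈ C₁.pi t₁, |cf C₁ J|) * ∑ J ∈ C₂.pi t₂, |cf C₂ J| := by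
  rw [Finset.sum_mul_sum, Finset.sum_product]
  simp only [abs_mul]

lemma main_term {ι : Type*} (A : Finset ι) (y₁ y₂ : ι → L) (B : ℝ) (hy₁ : ∀ x ∈ A, y₁ x ≠ 0)
    (hy₂ : ∀ x ∈ A, y₂ x ≠ 0)
    (hB : ∀ χ₁ χ₂ : MulChar L ℂ, (χ₁ ≠ 1 ∨ χ₂ ≠ 1) → ‖∑ x ∈ A, χ₁ (y₁ x) * χ₂ (y₂ x)‖ ≤ B)
    (C C' : Finset ℕ) (hC : ∀ p ∈ C, PrimeD L p) (hC' : ∀ p ∈ C', PrimeD L p) :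
    |∑ x ∈ A, ww C (y₁ x) * ww C' (y₂ x) - theta C * theta C' * A.card| ≤
      B * (theta C * theta C' * (2 ^ C.card * 2 ^ C'.card - 1)) := by
  classical
  have h1 : ((∑ x ∈ A, ww C (y₁ x) * ww C' (y₂ x) : ℝ) : ℂ) =
      ∑ x ∈ A, wt C Finset.range (y₁ x) * wt C' Finset.range (y₂ x) := by
    push_cast
    apply Finset.sum_congr rfl
    intro x hx
    rw [ww_eq C hC (hy₁ x hx), ww_eq C' hC' (hy₂ x hx)]
  rw [expand A y₁ y₂ hy₁ hy₂] at h1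
  have hmem : (J0 C, J0 C') ∈ C.pi Finset.range ×ˢ C'.pi Finset.range :=
    Finset.mem_product.2 ⟨J0_mem C hC, J0_mem C' hC'⟩
  rw [← Finset.add_sum_erase _ _ hmem] at h1
  simp only [cf_J0, Xc_J0] at h1
  have h2 : ∑ x ∈ A, (1 : MulChar L ℂ) (y₁ x) * (1 : MulChar L ℂ) (y₂ x) = A.card := by
    rw [Finset.sum_congr rfl (g := fun _ => (1:ℂ))]
    · simp
    · intro x hx
      rw [MulChar.one_apply (hy₁ x hx).isUnit, MulChar.one_apply (hy₂ x hx).isUnit, one_mul]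
  rw [h2] at h1
  have h3 := gen_bound A y₁ y₂ B hB ((C.pi Finset.range ×ˢ C'.pi Finset.range).erase (J0 C, J0 C'))
    (fun J => cf C J.1 * cf C' J.2) (fun J => Xc C J.1) (fun J => Xc C' J.2) (by
      intro J hJ
      rw [Finset.mem_erase, Finset.mem_product] at hJ
      by_cases h : J.1 = J0 C
      · right
        apply Xc_ne_one' C' hC' _ hJ.2.2
        intro h'
        exact hJ.1 (Prod.ext h h')
      · left; exact Xc_ne_one' C hC _ hJ.2.1 h)
  have h4 : ∑ J ∈ (C.pi Finset.range ×ˢ C'.pi Finset.range).erase (J0 C, J0 C'), |cf C J.1 * cf C' J.2| =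
      theta C * theta C' * (2 ^ C.card * 2 ^ C'.card - 1) := by
    have := Finset.add_sum_erase _ (fun J : ((p : ℕ) → p ∈ C → ℕ) × ((p : ℕ) → p ∈ C' → ℕ) => |cf C J.1 * cf C' J.2|) hmem
    rw [sum_abs_prod, sum_abs_full C hC, sum_abs_full C' hC'] at this
    simp only [cf_J0] at this
    rw [abs_of_pos (mul_pos (theta_pos C hC) (theta_pos C' hC'))] at this
    linarith
  rw [h4] at h3
  rw [← Real.norm_eq_abs, ← Complex.norm_real]
  convert h3 using 2
  rw [Complex.ofReal_sub, h1]
  push_cast; ring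

/-- the difference term -/
lemma diff_term {ι : Type*} (A : Finset ι) (y₁ y₂ : ι → L) (B : ℝ) (hy₁ : ∀ x ∈ A, y₁ x ≠ 0)
    (hy₂ : ∀ x ∈ A, y₂ x ≠ 0)
    (hB : ∀ χ₁ χ₂ : MulChar L ℂ, (χ₁ ≠ 1 ∨ χ₂ ≠ 1) → ‖∑ x ∈ A, χ₁ (y₁ x) * χ₂ (y₂ x)‖ ≤ B)
    (C C' : Finset ℕ) (hC : ∀ p ∈ C, PrimeD L p) (hC' : ∀ p ∈ C', PrimeD L p)
    (p : ℕ) (hp : PrimeD L p) (hpC : p ∉ C) :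
    |∑ x ∈ A, (wp p (y₁ x) - (1 - 1 / p)) * ww C (y₁ x) * ww C' (y₂ x)| ≤
      B * (theta C * theta C' * (2 ^ C.card * 2 ^ C'.card) * (1 - 1 / p)) := by
  classical
  set t : ℕ → Finset ℕ := fun r => if r = p then (Finset.range p).erase 0 else Finset.range r with ht
  have hCi : ∀ r ∈ insert p C, PrimeD L r := by
    intro r hr
    rcases Finset.mem_insert.1 hr with rfl | hr
    · exact hp
    · exact hC r hr
  have h0 : (0:ℕ) ∈ Finset.range p := by simp [hp.1.pos]
  have h1 : ((∑ x ∈ A, (wp p (y₁ x) - (1 - 1 / p)) * ww C (y₁ x) * ww C' (y₂ x) : ℝ) : ℂ) =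
      ∑ x ∈ A, wt (insert p C) t (y₁ x) * wt C' Finset.range (y₂ x) := by
    push_cast
    apply Finset.sum_congr rfl
    intro x hx
    rw [← ww_eq C' hC' (hy₂ x hx), wt, Finset.prod_insert hpC]
    congr 1
    congr 1
    · have := wp_eq hp (hy₁ x hx)
      rw [this, ← Finset.add_sum_erase _ _ h0]
      simp only [ht, if_true]
      simp [acoef]
    · rw [ww_eq C hC (hy₁ x hx), wt]
      apply Finset.prod_congr rfl
      intro r hr
      have : r ≠ p := by rintro rfl; exact hpC hr
      simp [ht, this]
  rw [expand A y₁ y₂ hy₁ hy₂] at h1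
  have h3 := gen_bound A y₁ y₂ B hB ((insert p C).pi t ×ˢ C'.pi Finset.range)
    (fun J => cf (insert p C) J.1 * cf C' J.2) (fun J => Xc (insert p C) J.1) (fun J => Xc C' J.2) (by
      intro J hJ
      rw [Finset.mem_product, Finset.mem_pi] at hJ
      left
      apply Xc_ne_one (insert p C) hCi J.1 _ p (Finset.mem_insert_self _ _)
      · have := hJ.1 p (Finset.mem_insert_self _ _)
        simp only [ht, if_true] at this
        exact (Finset.mem_erase.1 this).1
      · intro r hr
        have := hJ.1 r hr
        simp only [ht] at this
        split_ifs at this with h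
        · exact lt_of_lt_of_eq (Finset.mem_range.1 (Finset.mem_erase.1 this).2) h.symm
        · exact Finset.mem_range.1 this)
  rw [sum_abs_prod, sum_abs_full C' hC', sum_abs_cf, Finset.prod_insert hpC, ← h1, Complex.norm_real, Real.norm_eq_abs] at h3
  refine h3.trans (le_of_eq ?_)
  have e1 : ∑ j ∈ t p, |acoef p j| = 1 - 1 / p := by
    simp only [ht, if_true]; exact sum_abs_acoef_pos hp.1
  have e2 : ∏ r ∈ C, ∑ j ∈ t r, |acoef r j| = theta C * 2 ^ C.card := by
    rw [← sum_abs_full C hC, sum_abs_cf]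
    apply Finset.prod_congr rfl
    intro r hr
    have : r ≠ p := by rintro rfl; exact hpC hr
    simp [ht, this]
  rw [e1, e2]; ring

lemma wp_01 (p : ℕ) (y : L) : wp p y = 0 ∨ wp p y = 1 := by
  unfold wp; split_ifs <;> simp

lemma ww_nonneg (C : Finset ℕ) (y : L) : 0 ≤ ww C y :=
  Finset.prod_nonneg fun p _ => by rcases wp_01 p y with h | h <;> simp [h]

lemma ww_le_one (C : Finset ℕ) (y : L) : ww C y ≤ 1 :=
  Finset.prod_le_one (fun p _ => by rcases wp_01 p y with h | h <;> simp [h])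
    (fun p _ => by rcases wp_01 p y with h | h <;> simp [h])

lemma one_sub_le_ww (R : Finset ℕ) (y : L) : 1 - ∑ p ∈ R, (1 - wp p y) ≤ ww R y := by
  classical
  induction R using Finset.induction with
  | empty => simp [ww]
  | insert p R hp ih =>
    rw [Finset.sum_insert hp, ww, Finset.prod_insert hp]
    have h1 := ww_nonneg R y
    have h2 := ww_le_one R y
    change _ ≤ wp p y * ww R y
    rcases wp_01 p y with h | h
    · rw [h]
      have : 0 ≤ ∑ p ∈ R, (1 - wp p y) := Finset.sum_nonneg fun p _ => by
        rcases wp_01 p y with h | h <;> simp [h]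
      linarith
    · rw [h]; linarith

theorem sieve {ι : Type*} (A : Finset ι) (y₁ y₂ : ι → L) (B : ℝ) (hy₁ : ∀ x ∈ A, y₁ x ≠ 0)
    (hy₂ : ∀ x ∈ A, y₂ x ≠ 0)
    (hB : ∀ χ₁ χ₂ : MulChar L ℂ, (χ₁ ≠ 1 ∨ χ₂ ≠ 1) → ‖∑ x ∈ A, χ₁ (y₁ x) * χ₂ (y₂ x)‖ ≤ B)
    (C R : Finset ℕ) (hC : ∀ p ∈ C, PrimeD L p) (hR : ∀ p ∈ R, PrimeD L p) (hCR : Disjoint C R)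
    (δ : ℝ) (hδ : δ = 1 - 2 * ∑ p ∈ R, 1 / (p:ℝ)) (hδ0 : 0 ≤ δ) :
    theta C ^ 2 * (δ * (A.card + B) - B * (2 ^ C.card) ^ 2 * (2 * δ + 2 * R.card - 1)) ≤
      ∑ x ∈ A, ww (C ∪ R) (y₁ x) * ww (C ∪ R) (y₂ x) := by
  classical
  set N := ∑ x ∈ A, ww C (y₁ x) * ww C (y₂ x) with hN
  set W : ℝ := 2 ^ C.card with hW
  have hm := main_term A y₁ y₂ B hy₁ hy₂ hB C C hC hC
  rw [← hN] at hm
  have hm' := (abs_le.1 hm).1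
  have hd1 : ∀ p ∈ R, ∑ x ∈ A, (1 - wp p (y₁ x)) * (ww C (y₁ x) * ww C (y₂ x)) ≤
      N / p + B * (theta C ^ 2 * W ^ 2 * (1 - 1 / p)) := by
    intro p hp
    have h := diff_term A y₁ y₂ B hy₁ hy₂ hB C C hC hC p (hR p hp) (fun h => Finset.disjoint_left.1 hCR h hp)
    have h' := (abs_le.1 h).1
    have e : ∑ x ∈ A, (1 - wp p (y₁ x)) * (ww C (y₁ x) * ww C (y₂ x)) =
      N / p - ∑ x ∈ A, (wp p (y₁ x) - (1 - 1 / p)) * ww C (y₁ x) * ww C (y₂ x) := by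
      rw [hN, Finset.sum_div, ← Finset.sum_sub_distrib]
      apply Finset.sum_congr rfl; intro x _; ring
    rw [e]
    have e2 : B * (theta C * theta C * (2 ^ C.card * 2 ^ C.card) * (1 - 1 / p)) = B * (theta C ^ 2 * W ^ 2 * (1 - 1 / p)) := by rw [hW]; ring
    linarith
  have hd2 : ∀ p ∈ R, ∑ x ∈ A, (1 - wp p (y₂ x)) * (ww C (y₁ x) * ww C (y₂ x)) ≤
      N / p + B * (theta C ^ 2 * W ^ 2 * (1 - 1 / p)) := by
    intro p hp
    have h := diff_term A y₂ y₁ B hy₂ hy₁ (fun a b hab => by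
      have := hB b a hab.symm
      rw [Finset.sum_congr rfl (fun x _ => mul_comm (a (y₂ x)) (b (y₁ x)))]; exact this) C C hC hC p (hR p hp) (fun h => Finset.disjoint_left.1 hCR h hp)
    have h' := (abs_le.1 h).1
    have e : ∑ x ∈ A, (1 - wp p (y₂ x)) * (ww C (y₁ x) * ww C (y₂ x)) =
      N / p - ∑ x ∈ A, (wp p (y₂ x) - (1 - 1 / p)) * ww C (y₂ x) * ww C (y₁ x) := by
      rw [hN, Finset.sum_div, ← Finset.sum_sub_distrib]
      apply Finset.sum_congr rfl; intro x _; ring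
    rw [e]
    have e2 : B * (theta C * theta C * (2 ^ C.card * 2 ^ C.card) * (1 - 1 / p)) = B * (theta C ^ 2 * W ^ 2 * (1 - 1 / p)) := by rw [hW]; ring
    linarith
  have hpt : ∀ x ∈ A, ww C (y₁ x) * ww C (y₂ x) - ∑ p ∈ R, ((1 - wp p (y₁ x)) * (ww C (y₁ x) * ww C (y₂ x))
      + (1 - wp p (y₂ x)) * (ww C (y₁ x) * ww C (y₂ x))) ≤ ww (C ∪ R) (y₁ x) * ww (C ∪ R) (y₂ x) := by
    intro x _
    have e : ∀ y : L, ww (C ∪ R) y = ww C y * ww R y := fun y => Finset.prod_union hCR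
    rw [e, e]
    have a1 := one_sub_le_ww R (y₁ x)
    have a2 := one_sub_le_ww R (y₂ x)
    have b1 := ww_le_one R (y₁ x)
    have b2 := ww_le_one R (y₂ x)
    have c0 : 0 ≤ ww C (y₁ x) * ww C (y₂ x) := mul_nonneg (ww_nonneg _ _) (ww_nonneg _ _)
    rw [Finset.sum_add_distrib, ← Finset.sum_mul, ← Finset.sum_mul]
    have key : 1 - (∑ p ∈ R, (1 - wp p (y₁ x)) + ∑ p ∈ R, (1 - wp p (y₂ x))) ≤ ww R (y₁ x) * ww R (y₂ x) := by
      nlinarith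
    nlinarith
  have hs := Finset.sum_le_sum hpt
  rw [Finset.sum_sub_distrib, ← hN, Finset.sum_comm] at hs
  have hs2 : ∑ p ∈ R, ∑ x ∈ A, ((1 - wp p (y₁ x)) * (ww C (y₁ x) * ww C (y₂ x))
      + (1 - wp p (y₂ x)) * (ww C (y₁ x) * ww C (y₂ x))) ≤
      ∑ p ∈ R, 2 * (N / p + B * (theta C ^ 2 * W ^ 2 * (1 - 1 / p))) := by
    apply Finset.sum_le_sum
    intro p hp
    rw [Finset.sum_add_distrib]
    linarith [hd1 p hp, hd2 p hp]
  have hs3 : ∑ p ∈ R, 2 * (N / p + B * (theta C ^ 2 * W ^ 2 * (1 - 1 / (p:ℝ)))) =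
      N * (1 - δ) + B * (theta C ^ 2 * W ^ 2) * (2 * R.card - (1 - δ)) := by
    have e : ∀ p ∈ R, 2 * (N / p + B * (theta C ^ 2 * W ^ 2 * (1 - 1 / (p:ℝ)))) =
      2 * (N - B * (theta C ^ 2 * W ^ 2)) * (1 / (p:ℝ)) + 2 * (B * (theta C ^ 2 * W ^ 2)) := by
      intro p _; ring
    rw [Finset.sum_congr rfl e, Finset.sum_add_distrib, ← Finset.mul_sum, Finset.sum_const, nsmul_eq_mul]
    have : ∑ p ∈ R, 1 / (p:ℝ) = (1 - δ) / 2 := by rw [hδ]; ring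
    rw [this]; ring
  have hNl : theta C ^ 2 * (A.card + B - B * W ^ 2) ≤ N := by
    have e : B * (theta C * theta C * (2 ^ C.card * 2 ^ C.card - 1)) = B * theta C ^ 2 * (W ^ 2 - 1) := by rw [hW]; ring
    rw [e] at hm'
    nlinarith
  have hfin := mul_le_mul_of_nonneg_left hNl hδ0
  nlinarith

end PG
end Stp

open Polynomial
set_option linter.unusedSectionVars false
namespace Stp
section PI
variable {L : Type} [Field L] [Fintype L]

lemma card_roots_le [DecidableEq L] (P : L[X]) (hP : P ≠ 0) (n : ℕ) (hn : P.natDegree ≤ n) :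
    (Finset.univ.filter fun x : L => P.eval x = 0).card ≤ n := by
  have : (Finset.univ.filter fun x : L => P.eval x = 0) ⊆ P.roots.toFinset := by
    intro x hx
    rw [Multiset.mem_toFinset, mem_roots hP]
    exact (Finset.mem_filter.1 hx).2
  calc _ ≤ P.roots.toFinset.card := Finset.card_le_card this
    _ ≤ P.roots.card := Multiset.toFinset_card_le _
    _ ≤ P.natDegree := P.card_roots'
    _ ≤ n := hn

lemma natDegree_three {f₁ f₂ : L[X]} (h1 : f₁.natDegree ≤ 3) (h2 : f₂.natDegree ≤ 2) :
    (X * f₁ * f₂).natDegree ≤ 5 + 1 := by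
  refine natDegree_mul_le.trans ?_
  have : (X * f₁).natDegree ≤ 1 + 3 := natDegree_mul_le.trans (add_le_add natDegree_X_le h1)
  omega

/-- Weil bound for not necessarily monic polynomials. -/
theorem weil_gen (s0 : ℕ) (hQ : Fintype.card L = s0 ^ 2) (χ₁ χ₂ : MulChar L ℂ) (hχ : χ₂ ≠ 1)
    (f₁ f₂ : L[X]) (h1 : f₁ ≠ 0) (h2 : f₂ ≠ 0) (hd1 : f₁.natDegree ≤ 3) (hd2 : f₂.natDegree ≤ 2)
    (hc : IsCoprime f₁ f₂) (k : ℕ) (g : L[X]) (hk : 0 < k) (hg : g.Monic) (hi : Irreducible g)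
    (hgX : g ≠ X) (hkc : Nat.gcd k (Fintype.card L - 1) = 1) (hd : g ^ k ∣ f₁ * f₂)
    (hnd : ¬ g ^ (k + 1) ∣ f₁ * f₂) :
    ‖∑ x : L, χ₁ x * χ₂ (f₁.eval x) * χ₂⁻¹ (f₂.eval x)‖ ≤ 5 * s0 := by
  set a := f₁.leadingCoeff with ha
  set b := f₂.leadingCoeff with hb
  have ha0 : a ≠ 0 := leadingCoeff_ne_zero.2 h1
  have hb0 : b ≠ 0 := leadingCoeff_ne_zero.2 h2
  set F := f₁ * C a⁻¹ with hF
  set G := f₂ * C b⁻¹ with hG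
  have hFm : F.Monic := monic_mul_leadingCoeff_inv h1
  have hGm : G.Monic := monic_mul_leadingCoeff_inv h2
  have e1 : f₁ = C a * F := by
    rw [hF, mul_comm, mul_assoc, ← C_mul, inv_mul_cancel₀ ha0, C_1, mul_one]
  have e2 : f₂ = C b * G := by
    rw [hG, mul_comm, mul_assoc, ← C_mul, inv_mul_cancel₀ hb0, C_1, mul_one]
  have ua : IsUnit (C a : L[X]) := isUnit_C.2 ha0.isUnit
  have ub : IsUnit (C b : L[X]) := isUnit_C.2 hb0.isUnit
  have ua' : IsUnit (C a⁻¹ : L[X]) := isUnit_C.2 (inv_ne_zero ha0).isUnit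
  have ub' : IsUnit (C b⁻¹ : L[X]) := isUnit_C.2 (inv_ne_zero hb0).isUnit
  have hFG : f₁ * f₂ = (C a * C b) * (F * G) := by
    conv_lhs => rw [e1, e2]
    ring
  have uab := ua.mul ub
  have key : ∀ P : L[X], P ∣ f₁ * f₂ ↔ P ∣ F * G := by
    intro P; rw [hFG]; exact uab.dvd_mul_left
  have hcFG : IsCoprime F G := by
    rw [hF, hG]
    exact (isCoprime_mul_unit_right_left ua' _ _).2 ((isCoprime_mul_unit_right_right ub' _ _).2 hc)
  have hdF : F.natDegree ≤ 3 := by rw [hF]; exact natDegree_mul_C_le _ _ |>.trans hd1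
  have hdG : G.natDegree ≤ 2 := by rw [hG]; exact natDegree_mul_C_le _ _ |>.trans hd2
  have hw := weil s0 5 hQ χ₁ χ₂ hχ F G hFm hGm hcFG k g hk hg hi hgX hkc ((key _).1 hd)
    (fun h => hnd ((key _).2 h)) (natDegree_three hdF hdG)
  have : ∑ x : L, χ₁ x * χ₂ (f₁.eval x) * χ₂⁻¹ (f₂.eval x) =
      (χ₂ a * χ₂⁻¹ b) * ∑ x : L, χ₁ x * χ₂ (F.eval x) * χ₂⁻¹ (G.eval x) := by
    rw [Finset.mul_sum]
    refine Finset.sum_congr rfl fun x _ => ?_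
    have q1 : f₁.eval x = a * F.eval x := by
      conv_lhs => rw [e1]
      rw [eval_mul, eval_C]
    have q2 : f₂.eval x = b * G.eval x := by
      conv_lhs => rw [e2]
      rw [eval_mul, eval_C]
    rw [q1, q2, _root_.map_mul, _root_.map_mul]
    ring
  rw [this, norm_mul]
  have n1 : ‖χ₂ a * χ₂⁻¹ b‖ ≤ 1 := by
    rw [norm_mul]
    exact mul_le_one₀ (norm_mulChar_le _ _) (norm_nonneg _) (norm_mulChar_le _ _)
  calc _ ≤ 1 * (5 * (s0:ℝ)) := mul_le_mul n1 (by exact_mod_cast hw) (norm_nonneg _) zero_le_one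
    _ = _ := one_mul _

open Classical in
noncomputable def Aset (f₁ f₂ : L[X]) : Finset L :=
  Finset.univ.filter fun x => ¬ (X * f₁ * f₂).eval x = 0

lemma mem_Aset {f₁ f₂ : L[X]} {x : L} :
    x ∈ Aset f₁ f₂ ↔ x ≠ 0 ∧ f₁.eval x ≠ 0 ∧ f₂.eval x ≠ 0 := by
  simp [Aset, not_or, and_assoc]

lemma card_Aset {f₁ f₂ : L[X]} (h1 : f₁ ≠ 0) (h2 : f₂ ≠ 0) (hd1 : f₁.natDegree ≤ 3)
    (hd2 : f₂.natDegree ≤ 2) : Fintype.card L ≤ (Aset f₁ f₂).card + 6 := by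
  classical
  have h := card_roots_le (X * f₁ * f₂) (mul_ne_zero (mul_ne_zero X_ne_zero h1) h2) 6
    (natDegree_three hd1 hd2)
  have := Finset.card_filter_add_card_filter_not (s := (Finset.univ : Finset L)) (fun x : L => (X * f₁ * f₂).eval x = 0)
  rw [Finset.card_univ] at this
  have e : Aset f₁ f₂ = Finset.univ.filter (fun x : L => ¬ (X * f₁ * f₂).eval x = 0) := by
    unfold Aset; congr
  rw [e]
  omega

theorem hB_main (s0 : ℕ) (hs : 2 ≤ s0) (hQ : Fintype.card L = s0 ^ 2)
    (f₁ f₂ : L[X]) (h1 : f₁ ≠ 0) (h2 : f₂ ≠ 0) (hd1 : f₁.natDegree ≤ 3) (hd2 : f₂.natDegree ≤ 2)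
    (hc : IsCoprime f₁ f₂) (k : ℕ) (g : L[X]) (hk : 0 < k) (hg : g.Monic) (hi : Irreducible g)
    (hgX : g ≠ X) (hkc : Nat.gcd k (Fintype.card L - 1) = 1) (hd : g ^ k ∣ f₁ * f₂)
    (hnd : ¬ g ^ (k + 1) ∣ f₁ * f₂) (χ₁ χ₂ : MulChar L ℂ) (hχ : χ₁ ≠ 1 ∨ χ₂ ≠ 1) :
    ‖∑ x ∈ Aset f₁ f₂, χ₁ x * χ₂ (f₁.eval x / f₂.eval x)‖ ≤ 5 * s0 := by
  classical
  have hs' : (2:ℝ) ≤ s0 := by exact_mod_cast hs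
  by_cases h : χ₂ = 1
  · have h1' : χ₁ ≠ 1 := by tauto
    have hz := MulChar.sum_eq_zero_of_ne_one h1'
    have e : ∑ x ∈ Aset f₁ f₂, χ₁ x * χ₂ (f₁.eval x / f₂.eval x) = ∑ x ∈ Aset f₁ f₂, χ₁ x := by
      refine Finset.sum_congr rfl fun x hx => ?_
      rw [mem_Aset] at hx
      rw [h, MulChar.one_apply (div_ne_zero hx.2.1 hx.2.2).isUnit, mul_one]
    rw [e]
    have e2 : ∑ x ∈ Aset f₁ f₂, χ₁ x = - ∑ x ∈ (Aset f₁ f₂)ᶜ, χ₁ x := by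
      rw [eq_neg_iff_add_eq_zero, Finset.sum_add_sum_compl, hz]
    rw [e2, norm_neg]
    have hcd : ((Aset f₁ f₂)ᶜ).card ≤ 6 := by
      rw [Finset.card_compl]
      have := card_Aset h1 h2 hd1 hd2
      omega
    calc _ ≤ ∑ x ∈ (Aset f₁ f₂)ᶜ, ‖χ₁ x‖ := norm_sum_le _ _
      _ ≤ ∑ x ∈ (Aset f₁ f₂)ᶜ, (1:ℝ) := Finset.sum_le_sum fun x _ => norm_mulChar_le _ _
      _ = (((Aset f₁ f₂)ᶜ).card : ℝ) := by simp
      _ ≤ 6 := by exact_mod_cast hcd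
      _ ≤ 5 * s0 := by linarith
  · have e : ∑ x ∈ Aset f₁ f₂, χ₁ x * χ₂ (f₁.eval x / f₂.eval x) =
        ∑ x : L, χ₁ x * χ₂ (f₁.eval x) * χ₂⁻¹ (f₂.eval x) := by
      rw [← Finset.sum_subset (Finset.subset_univ (Aset f₁ f₂))]
      · refine Finset.sum_congr rfl fun x hx => ?_
        rw [MulChar.inv_apply', div_eq_mul_inv, _root_.map_mul, mul_assoc]
      · intro x _ hx
        rw [mem_Aset] at hx
        have : x = 0 ∨ f₁.eval x = 0 ∨ f₂.eval x = 0 := by tauto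
        rcases this with h | h | h <;> rw [h, MulChar.map_zero] <;> simp
    rw [e]
    exact weil_gen s0 hQ χ₁ χ₂ h f₁ f₂ h1 h2 hd1 hd2 hc k g hk hg hi hgX hkc hd hnd

end PI
end Stp

open Polynomial
set_option linter.unusedSectionVars false
namespace Stp
section PJ
variable {K L : Type} [Field K] [Fintype K] [Field L] [Fintype L] [Algebra K L]

lemma norm_gaussSum_sq {χ : MulChar L ℂ} (hχ : χ ≠ 1) {ψ : AddChar L ℂ} (hψ : ψ.IsPrimitive) :
    ‖gaussSum χ ψ‖ ^ 2 = Fintype.card L := by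
  have h := gaussSum_mul_gaussSum_eq_card hχ hψ
  rw [← star_gaussSum_eq] at h
  have h2 : (gaussSum χ ψ) * (starRingEnd ℂ) (gaussSum χ ψ) = Fintype.card L := h
  rw [Complex.mul_conj, Complex.normSq_eq_norm_sq] at h2
  exact_mod_cast h2

noncomputable def psi (φ : L →ₗ[K] K) (a : K) : AddChar L ℂ where
  toFun x := AddChar.FiniteField.primitiveChar_to_Complex K (a * φ x)
  map_zero_eq_one' := by simp
  map_add_eq_mul' x y := by simp [mul_add, AddChar.map_add_eq_mul]

lemma psi_prim {φ : L →ₗ[K] K} (hφ : φ ≠ 0) {a : K} (ha : a ≠ 0) : (psi φ a).IsPrimitive := by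
  apply AddChar.IsPrimitive.of_ne_one
  intro h
  have hp := AddChar.FiniteField.primitiveChar_to_Complex_isPrimitive K
  have hn : AddChar.FiniteField.primitiveChar_to_Complex K ≠ 1 := by
    intro h1
    apply hp one_ne_zero
    rw [AddChar.mulShift_one, h1]
  apply hn
  obtain ⟨x, hx⟩ : ∃ x, φ x ≠ 0 := by
    by_contra! hh
    exact hφ (LinearMap.ext hh)
  ext b
  have : psi φ a ((b * (a * φ x)⁻¹) • x) = 1 := by rw [h]; rfl
  have e : a * φ ((b * (a * φ x)⁻¹) • x) = b := by
    rw [map_smul, smul_eq_mul]; field_simp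
  change AddChar.FiniteField.primitiveChar_to_Complex K (a * φ ((b * (a * φ x)⁻¹) • x)) = 1 at this
  rw [e] at this
  rw [this]; rfl

open Classical in
noncomputable def Hset (φ : L →ₗ[K] K) : Finset L := Finset.univ.filter fun x => φ x = 0

open Classical in
lemma ind_eq (φ : L →ₗ[K] K) (x : L) :
    (Fintype.card K : ℂ) * (if φ x = 0 then 1 else 0) = ∑ a : K, psi φ a x := by
  have := AddChar.sum_mulShift (φ x) (AddChar.FiniteField.primitiveChar_to_Complex_isPrimitive K)
  change _ = ∑ a : K, AddChar.FiniteField.primitiveChar_to_Complex K (a * φ x)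
  rw [this]
  split_ifs <;> simp

lemma ker_bound (s0 : ℕ) (hQ : Fintype.card L = s0 ^ 2) {φ : L →ₗ[K] K} (hφ : φ ≠ 0) {χ : MulChar L ℂ} (hχ : χ ≠ 1) :
    ‖∑ x ∈ Hset φ, χ x‖ ≤ s0 := by
  classical
  have hK : (0:ℝ) < Fintype.card K := by exact_mod_cast Fintype.card_pos
  have e : (Fintype.card K : ℂ) * ∑ x ∈ Hset φ, χ x = ∑ a ∈ Finset.univ.erase (0:K), gaussSum χ (psi φ a) := by
    have e1 : ∑ a : K, gaussSum χ (psi φ a) = (Fintype.card K : ℂ) * ∑ x ∈ Hset φ, χ x := by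
      unfold gaussSum Hset
      rw [Finset.sum_comm, Finset.sum_filter, Finset.mul_sum]
      refine Finset.sum_congr rfl fun x _ => ?_
      rw [← Finset.mul_sum, ← ind_eq]
      split_ifs <;> simp <;> ring
    rw [← e1, ← Finset.add_sum_erase _ _ (Finset.mem_univ (0:K))]
    have : gaussSum χ (psi φ 0) = 0 := by
      unfold gaussSum
      have : ∀ x, χ x * psi φ 0 x = χ x := by
        intro x
        have : psi φ 0 x = 1 := by
          change AddChar.FiniteField.primitiveChar_to_Complex K (0 * φ x) = 1
          simp
        rw [this, mul_one]
      simp only [this]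
      exact MulChar.sum_eq_zero_of_ne_one hχ
    rw [this, zero_add]
  have n : ‖(Fintype.card K : ℂ) * ∑ x ∈ Hset φ, χ x‖ ≤ Fintype.card K * s0 := by
    rw [e]
    calc _ ≤ ∑ a ∈ Finset.univ.erase (0:K), ‖gaussSum χ (psi φ a)‖ := norm_sum_le _ _
      _ ≤ ∑ a ∈ Finset.univ.erase (0:K), (s0:ℝ) := by
        refine Finset.sum_le_sum fun a ha => ?_
        have := norm_gaussSum_sq hχ (psi_prim hφ (Finset.mem_erase.1 ha).1)
        rw [hQ] at this
        push_cast at this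
        exact le_of_eq ((sq_eq_sq₀ (norm_nonneg _) (by positivity)).1 this)
      _ ≤ ∑ a : K, (s0:ℝ) := Finset.sum_le_sum_of_subset_of_nonneg (Finset.erase_subset _ _) (fun _ _ _ => by positivity)
      _ = _ := by simp
  rw [norm_mul, Complex.norm_natCast] at n
  exact le_of_mul_le_mul_left n hK

lemma card_Hset {φ : L →ₗ[K] K} (hφ : φ ≠ 0) : (Hset φ).card * Fintype.card K = Fintype.card L := by
  classical
  have hr := LinearMap.finrank_range_add_finrank_ker φ
  have hs : Function.Surjective φ := LinearMap.surjective hφ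
  rw [LinearMap.range_eq_top.2 hs, finrank_top, Module.finrank_self] at hr
  have h1 : Fintype.card (LinearMap.ker φ) = (Hset φ).card := by
    rw [Fintype.card_subtype]
    unfold Hset
    congr 1
  rw [← h1, Module.card_eq_pow_finrank (K := K) (V := LinearMap.ker φ), Module.card_eq_pow_finrank (K := K) (V := L), ← hr]
  ring

open Classical in
/-- weighted count on hyperplane -/
lemma ker_count (s0 : ℕ) (hQ : Fintype.card L = s0 ^ 2) {φ : L →ₗ[K] K} (hφ : φ ≠ 0)
    (C : Finset ℕ) (hC : ∀ p ∈ C, PrimeD L p) :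
    ∑ x ∈ (Hset φ).erase 0, ww C x ≤ theta C * ((Hset φ).card + 2 ^ C.card * s0) := by
  classical
  set A := (Hset φ).erase 0 with hA
  have hy : ∀ x ∈ A, x ≠ 0 := fun x hx => (Finset.mem_erase.1 hx).1
  have hb : ∀ χ : MulChar L ℂ, χ ≠ 1 → ‖∑ x ∈ A, χ x‖ ≤ s0 := by
    intro χ hχ
    have h0 : (0:L) ∈ Hset φ := by simp [Hset]
    have := Finset.add_sum_erase (Hset φ) (fun x => χ x) h0
    rw [MulChar.map_zero, zero_add] at this
    rw [hA, this]
    exact ker_bound s0 hQ hφ hχ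
  have e : ((∑ x ∈ A, ww C x : ℝ) : ℂ) = ∑ J ∈ C.pi Finset.range, (cf C J : ℂ) * ∑ x ∈ A, Xc C J x := by
    push_cast
    calc _ = ∑ x ∈ A, ∑ J ∈ C.pi Finset.range, (cf C J : ℂ) * Xc C J x := by
          refine Finset.sum_congr rfl fun x hx => ?_
          rw [ww_eq C hC (hy x hx), wt_eq _ _ (hy x hx)]
      _ = _ := by
          rw [Finset.sum_comm]
          refine Finset.sum_congr rfl fun J _ => ?_
          rw [Finset.mul_sum]
  have n : ‖((∑ x ∈ A, ww C x : ℝ) : ℂ)‖ ≤ theta C * ((Hset φ).card + 2 ^ C.card * s0) := by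
    rw [e]
    calc _ ≤ ∑ J ∈ C.pi Finset.range, ‖(cf C J : ℂ) * ∑ x ∈ A, Xc C J x‖ := norm_sum_le _ _
      _ ≤ ∑ J ∈ C.pi Finset.range, (|cf C J| * s0 + if J = J0 C then theta C * (Hset φ).card else 0) := by
        refine Finset.sum_le_sum fun J hJ => ?_
        rw [norm_mul, Complex.norm_real, Real.norm_eq_abs]
        split_ifs with h
        · subst h
          rw [cf_J0, abs_of_pos (theta_pos C hC)]
          have : ‖∑ x ∈ A, (Xc C (J0 C) : MulChar L ℂ) x‖ ≤ (Hset φ).card := by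
            calc _ ≤ ∑ x ∈ A, ‖(Xc C (J0 C) : MulChar L ℂ) x‖ := norm_sum_le _ _
              _ ≤ ∑ x ∈ A, (1:ℝ) := Finset.sum_le_sum fun x _ => norm_mulChar_le _ _
              _ = (A.card : ℝ) := by simp
              _ ≤ _ := by exact_mod_cast Finset.card_le_card (Finset.erase_subset _ _)
          have := mul_le_mul_of_nonneg_left this (theta_pos C hC).le
          have h2 : 0 ≤ theta C * s0 := mul_nonneg (theta_pos C hC).le (by positivity)
          linarith
        · rw [add_zero]
          exact mul_le_mul_of_nonneg_left (hb _ (Xc_ne_one' C hC J hJ h)) (abs_nonneg _)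
      _ = _ := by
        rw [Finset.sum_add_distrib, ← Finset.sum_mul, sum_abs_full C hC, Finset.sum_ite_eq' , if_pos (J0_mem C hC)]
        ring
  rw [Complex.norm_real, Real.norm_eq_abs] at n
  exact (le_abs_self _).trans n

end PJ
end Stp

open Polynomial
set_option linter.unusedSectionVars false
namespace Stp
section PK
variable {K L : Type} [Field K] [Fintype K] [Field L] [Fintype L] [Algebra K L]

variable (K L) in
noncomputable abbrev sg : Module.End K L := (FiniteField.frobeniusAlgHom K L).toLinearMap

lemma sg_pow (i : ℕ) (β : L) : ((sg K L) ^ i) β = β ^ Fintype.card K ^ i := by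
  induction i generalizing β with
  | zero => simp
  | succ n ih =>
    rw [pow_succ, Module.End.mul_apply, ih]
    change (β ^ Fintype.card K) ^ _ = _
    rw [← pow_mul, pow_succ, mul_comm]

lemma finrank4 (hc : Fintype.card L = Fintype.card K ^ 4) : Module.finrank K L = 4 := by
  rw [Module.card_eq_pow_finrank (K := K) (V := L)] at hc
  exact Nat.pow_right_injective (Fintype.one_lt_card) hc

lemma minpoly_sg (hc : Fintype.card L = Fintype.card K ^ 4) : minpoly K (sg K L) = X ^ 4 - 1 := by
  rw [FiniteField.minpoly_frobeniusAlgHom, finrank4 hc]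

lemma aeval_sg (hc : Fintype.card L = Fintype.card K ^ 4) : aeval (sg K L) (X ^ 4 - 1 : K[X]) = 0 := by
  rw [← minpoly_sg (K := K) (L := L) hc]; exact minpoly.aeval _ _

lemma ne0 : (X ^ 4 - 1 : K[X]) ≠ 0 := (monic_X_pow_sub_C (1:K) (by norm_num : (4:ℕ) ≠ 0)).ne_zero

lemma aeval_ne (hc : Fintype.card L = Fintype.card K ^ 4) {P D : K[X]} (hP : Irreducible P) (hPD : P * D = X ^ 4 - 1) :
    aeval (sg K L) D ≠ 0 := by
  intro h
  have h1 := minpoly.dvd K _ h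
  rw [minpoly_sg hc, ← hPD] at h1
  have hD : D ≠ 0 := by rintro rfl; rw [mul_zero] at hPD; exact ne0 hPD.symm
  obtain ⟨e, he⟩ := h1
  apply hP.not_isUnit
  have : D * 1 = D * (P * e) := by rw [mul_one]; conv_lhs => rw [he]
                                   ring
  exact IsUnit.of_mul_eq_one e (mul_left_cancel₀ hD this).symm

lemma nonnormal (hc : Fintype.card L = Fintype.card K ^ 4) {β : L} (h : ¬ IsNormalElem K 4 β) :
    ∃ P D : K[X], Irreducible P ∧ P * D = X ^ 4 - 1 ∧ aeval (sg K L) D β = 0 := by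
  classical
  have hli : ¬ LinearIndependent K (fun i : Fin 4 => β ^ Fintype.card K ^ (i : ℕ)) := by
    intro hl
    exact h ⟨hl, hl.span_eq_top_of_card_eq_finrank' (by rw [finrank4 hc, Fintype.card_fin])⟩
  rw [Fintype.not_linearIndependent_iff] at hli
  obtain ⟨a, ha, i0, hi0⟩ := hli
  set H : K[X] := ∑ i : Fin 4, C (a i) * X ^ (i:ℕ) with hH
  have hcoef : ∀ j : Fin 4, H.coeff j = a j := by
    intro j
    rw [hH, finsetSum_coeff]
    simp only [coeff_C_mul_X_pow]
    rw [Finset.sum_eq_single j]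
    · simp
    · intro b _ hb
      rw [if_neg]
      intro hh; exact hb (Fin.ext hh.symm)
    · simp
  have hH0 : H ≠ 0 := by
    intro h0; apply hi0; rw [← hcoef, h0, coeff_zero]
  have hdeg : H.natDegree ≤ 3 := by
    rw [hH]
    apply natDegree_sum_le_of_forall_le
    intro i _
    refine (natDegree_C_mul_X_pow_le _ _).trans ?_
    omega
  have hHβ : aeval (sg K L) H β = 0 := by
    rw [hH, map_sum, LinearMap.sum_apply, ← ha]
    refine Finset.sum_congr rfl fun i _ => ?_
    rw [_root_.map_mul, aeval_C, map_pow, aeval_X, Module.End.mul_apply, sg_pow]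
    rfl
  set g := EuclideanDomain.gcd H (X ^ 4 - 1 : K[X]) with hg
  have hgβ : aeval (sg K L) g β = 0 := by
    rw [hg, EuclideanDomain.gcd_eq_gcd_ab]
    rw [mul_comm H, mul_comm (X ^ 4 - 1 : K[X]), map_add, _root_.map_mul, _root_.map_mul, aeval_sg hc, mul_zero, add_zero, Module.End.mul_apply, hHβ, map_zero]
  obtain ⟨e, he⟩ := EuclideanDomain.gcd_dvd_right H (X ^ 4 - 1 : K[X])
  rw [← hg] at he
  have he0 : e ≠ 0 := by rintro rfl; rw [mul_zero] at he; exact ne0 he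
  have heu : ¬ IsUnit e := by
    intro hu
    have h1 : (X ^ 4 - 1 : K[X]) ∣ H := by
      rw [he]
      exact hu.mul_right_dvd.2 (EuclideanDomain.gcd_dvd_left _ _)
    have h2 := natDegree_le_of_dvd h1 hH0
    have h3 : (X ^ 4 - 1 : K[X]).natDegree = 4 := natDegree_X_pow_sub_C (r := (1:K))
    omega
  obtain ⟨P, hP, e', he'⟩ := WfDvdMonoid.exists_irreducible_factor heu he0
  refine ⟨P, e' * g, hP, by rw [he, he']; ring, ?_⟩
  rw [_root_.map_mul, Module.End.mul_apply, hgβ, map_zero]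

lemma exists_phi {T : Module.End K L} (hT : T ≠ 0) : ∃ φ : L →ₗ[K] K, φ ≠ 0 ∧ ∀ β, T β = 0 → φ β = 0 := by
  obtain ⟨x, hx⟩ : ∃ x, T x ≠ 0 := by
    by_contra! hh
    exact hT (LinearMap.ext hh)
  obtain ⟨f, hf⟩ : ∃ f : Module.Dual K L, f (T x) ≠ 0 := by
    by_contra! hh
    exact hx ((Module.forall_dual_apply_eq_zero_iff K (T x)).1 hh)
  refine ⟨f ∘ₗ T, fun h0 => hf ?_, fun β hβ => ?_⟩
  · have := LinearMap.congr_fun h0 x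
    simpa using this
  · rw [LinearMap.comp_apply, hβ, map_zero]

/-- a set of functionals whose kernels cover non-normal elements -/
lemma cover (hc : Fintype.card L = Fintype.card K ^ 4) (S : Finset K[X])
    (hS : ∀ s ∈ S, Irreducible s ∧ s ∣ X ^ 4 - 1)
    (hall : ∀ P : K[X], Irreducible P → P ∣ X ^ 4 - 1 → ∃ s ∈ S, P ∣ s) :
    ∃ Φ : Finset (L →ₗ[K] K), (∀ φ ∈ Φ, φ ≠ 0) ∧ Φ.card ≤ S.card ∧
      ∀ β : L, ¬ IsNormalElem K 4 β → ∃ φ ∈ Φ, φ β = 0 := by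
  classical
  have : ∀ s : K[X], ∃ φ : L →ₗ[K] K, s ∈ S → φ ≠ 0 ∧ ∀ β D, s * D = X ^ 4 - 1 → aeval (sg K L) D β = 0 → φ β = 0 := by
    intro s
    by_cases hs : s ∈ S
    · obtain ⟨h1, D, hD⟩ := hS s hs
      obtain ⟨φ, hφ, hφ2⟩ := exists_phi (aeval_ne hc h1 hD.symm)
      refine ⟨φ, fun _ => ⟨hφ, fun β D' hD' hβ => hφ2 β ?_⟩⟩
      have : D' = D := mul_left_cancel₀ h1.ne_zero (hD'.trans hD)
      rwa [← this]
    · exact ⟨0, fun h => absurd h hs⟩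
  choose φ hφ using this
  refine ⟨S.image φ, ?_, Finset.card_image_le, ?_⟩
  · intro f hf
    obtain ⟨s, hs, rfl⟩ := Finset.mem_image.1 hf
    exact (hφ s hs).1
  · intro β hβ
    obtain ⟨P, D, hP, hPD, hD⟩ := nonnormal hc hβ
    obtain ⟨s, hs, hPs⟩ := hall P hP ⟨D, hPD.symm⟩
    refine ⟨φ s, Finset.mem_image_of_mem _ hs, ?_⟩
    obtain ⟨u, hu⟩ := hP.associated_of_dvd (hS s hs).1 hPs
    refine (hφ s hs).2 β ((↑u⁻¹ : K[X]) * D) ?_ ?_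
    · rw [← hu, ← hPD]
      have : (u : K[X]) * (↑u⁻¹ : K[X]) = 1 := by simp
      linear_combination P * D * this
    · rw [_root_.map_mul, Module.End.mul_apply, hD, map_zero]

lemma fac4 : (X ^ 4 - 1 : K[X]) = (X - C 1) * ((X + C 1) * (X ^ 2 + C 1)) := by
  simp only [map_one]; ring

lemma cover_even (h2 : Fintype.card K % 2 = 0) : ∃ S : Finset K[X], S.card ≤ 1 ∧ (∀ s ∈ S, Irreducible s ∧ s ∣ X ^ 4 - 1) ∧
    ∀ P : K[X], Irreducible P → P ∣ X ^ 4 - 1 → ∃ s ∈ S, P ∣ s := by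
  refine ⟨{X - C 1}, by simp, ?_, ?_⟩
  · intro s hs
    rw [Finset.mem_singleton] at hs
    rw [hs]
    exact ⟨irreducible_X_sub_C _, by rw [fac4]; exact dvd_mul_right _ _⟩
  · intro P hP hd
    have : CharP K 2 := by
      have := FiniteField.even_card_iff_char_two (F := K) |>.2 h2
      exact this ▸ ringChar.charP K
    refine ⟨_, Finset.mem_singleton_self _, ?_⟩
    have e : (X ^ 4 - 1 : K[X]) = (X - C 1) ^ 4 := by
      have h2 : (2 : K[X]) = 0 := CharTwo.two_eq_zero
      simp only [map_one]
      linear_combination (2 * X^3 - 3 * X ^ 2 + 2 * X - 1) * h2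
    rw [e] at hd
    exact hP.prime.dvd_of_dvd_pow hd

lemma cover_odd : ∃ S : Finset K[X], S.card ≤ 4 ∧ (Fintype.card K % 4 = 3 → S.card ≤ 3) ∧ (∀ s ∈ S, Irreducible s ∧ s ∣ X ^ 4 - 1) ∧
    ∀ P : K[X], Irreducible P → P ∣ X ^ 4 - 1 → ∃ s ∈ S, P ∣ s := by
  classical
  have hadd : ∀ a : K, Irreducible (X + C a : K[X]) := by
    intro a
    have := irreducible_X_sub_C (-a)
    rwa [C_neg, sub_neg_eq_add] at this
  by_cases hs : IsSquare (-1 : K)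
  · obtain ⟨i, hi⟩ := hs
    have e : (X ^ 2 + C 1 : K[X]) = (X - C i) * (X + C i) := by
      have : (C (-1) : K[X]) = C i * C i := by rw [← C_mul, hi]
      rw [C_neg] at this
      linear_combination -this
    refine ⟨{X - C 1, X + C 1, X - C i, X + C i}, Finset.card_le_four, ?_, ?_, ?_⟩
    · intro h
      exact absurd h (FiniteField.isSquare_neg_one_iff.1 ⟨i, hi⟩)
    · intro s hs
      simp only [Finset.mem_insert, Finset.mem_singleton] at hs
      rw [fac4, e]
      rcases hs with rfl | rfl | rfl | rfl
      · exact ⟨irreducible_X_sub_C _, dvd_mul_right _ _⟩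
      · exact ⟨hadd _, dvd_mul_of_dvd_right (dvd_mul_right _ _) _⟩
      · exact ⟨irreducible_X_sub_C _, dvd_mul_of_dvd_right (dvd_mul_of_dvd_right (dvd_mul_right _ _) _) _⟩
      · exact ⟨hadd _, dvd_mul_of_dvd_right (dvd_mul_of_dvd_right (dvd_mul_left _ _) _) _⟩
    · intro P hP hd
      rw [fac4, e] at hd
      rcases hP.prime.dvd_or_dvd hd with h | h
      · exact ⟨_, by simp, h⟩
      rcases hP.prime.dvd_or_dvd h with h | h
      · exact ⟨X + C 1, by simp, h⟩
      rcases hP.prime.dvd_or_dvd h with h | h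
      · exact ⟨X - C i, by simp, h⟩
      · exact ⟨X + C i, by simp, h⟩
  · have hirr : Irreducible (X ^ 2 + C 1 : K[X]) := by
      have := X_pow_sub_C_irreducible_iff_of_prime (K := K) Nat.prime_two (a := -1)
      rw [C_neg, sub_neg_eq_add] at this
      refine this.2 fun b hb => hs ⟨b, ?_⟩
      rw [← hb]; ring
    refine ⟨{X - C 1, X + C 1, X ^ 2 + C 1}, Finset.card_le_three.trans (by norm_num), fun _ => Finset.card_le_three, ?_, ?_⟩
    · intro s hs
      simp only [Finset.mem_insert, Finset.mem_singleton] at hs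
      rw [fac4]
      rcases hs with rfl | rfl | rfl
      · exact ⟨irreducible_X_sub_C _, dvd_mul_right _ _⟩
      · exact ⟨hadd _, dvd_mul_of_dvd_right (dvd_mul_right _ _) _⟩
      · exact ⟨hirr, dvd_mul_of_dvd_right (dvd_mul_left _ _) _⟩
    · intro P hP hd
      rw [fac4] at hd
      rcases hP.prime.dvd_or_dvd hd with h | h
      · exact ⟨_, by simp, h⟩
      rcases hP.prime.dvd_or_dvd h with h | h
      · exact ⟨X + C 1, by simp, h⟩
      · exact ⟨X ^ 2 + C 1, by simp, h⟩

end PK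
end Stp

open Polynomial
set_option linter.unusedSectionVars false
namespace Stp
section PL
variable {K L : Type} [Field K] [Fintype K] [Field L] [Fintype L] [Algebra K L]

lemma prim_of (y : L) (hy : y ≠ 0) (h : ∀ p : ℕ, PrimeD L p → (chp p : MulChar L ℂ) y ≠ 1) :
    IsPrimitiveElem y := by
  classical
  have hcard := card_gt (L := L)
  unfold IsPrimitiveElem
  obtain ⟨u, rfl⟩ := hy.isUnit
  rw [orderOf_units]
  have hcu : Fintype.card Lˣ = Fintype.card L - 1 := Fintype.card_units L
  refine orderOf_eq_of_pow_and_pow_div_prime (by omega) (by rw [← hcu]; exact pow_card_eq_one) ?_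
  intro p hp hpd hpow
  obtain ⟨g, hg⟩ := IsCyclic.exists_generator (α := Lˣ)
  obtain ⟨k, hk⟩ := (mem_powers_iff_mem_zpowers.2 (hg u))
  have hog : orderOf g = Fintype.card L - 1 := by
    rw [← hcu, ← Nat.card_eq_fintype_card]; exact orderOf_eq_card_of_forall_mem_zpowers hg
  obtain ⟨m, hm⟩ := hpd
  have hk' : g ^ k = u := hk
  rw [← hk', ← pow_mul] at hpow
  have hd := orderOf_dvd_of_pow_eq_one hpow
  have hm0 : 0 < m := by
    rcases Nat.eq_zero_or_pos m with h0 | h0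
    · subst h0; omega
    · exact h0
  rw [hog, hm, Nat.mul_div_cancel_left _ hp.pos] at hd
  have hpk : p ∣ k := Nat.dvd_of_mul_dvd_mul_right hm0 hd
  obtain ⟨j, rfl⟩ := hpk
  have hP : PrimeD L p := ⟨hp, ⟨m, hm⟩⟩
  apply h p hP
  rw [← hk', mul_comm p j, pow_mul]
  push_cast
  rw [map_pow, ← mulChar_pow_apply _ _ (by simp), chp_pow hP]
  exact MulChar.one_apply (by simp)

lemma ww_ne_zero {S : Finset ℕ} {y : L} (h : ww S y ≠ 0) : ∀ p ∈ S, (chp p : MulChar L ℂ) y ≠ 1 := by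
  intro p hp h1
  apply h
  unfold ww
  apply Finset.prod_eq_zero hp
  simp [wp, h1]

lemma ratEval_div (f₁ f₂ : L[X]) (hf2 : f₂ ≠ 0) {x : L} (hx : f₂.eval x ≠ 0) :
    ratEval (algebraMap L[X] (RatFunc L) f₁ / algebraMap L[X] (RatFunc L) f₂) x =
      f₁.eval x / f₂.eval x := by
  have e1 : ∀ g : L[X], (algebraMap L[X] (RatFunc L) g).eval (RingHom.id L) x = g.eval x := by
    intro g
    rw [RatFunc.eval_algebraMap]
    simp [eval₂_id]
  have h0 : algebraMap L[X] (RatFunc L) f₂ ≠ 0 := RatFunc.algebraMap_ne_zero hf2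
  have h := RatFunc.eval_mul (RingHom.id L) x
    (x := algebraMap L[X] (RatFunc L) f₁ / algebraMap L[X] (RatFunc L) f₂)
    (y := algebraMap L[X] (RatFunc L) f₂) (by
      intro hz
      apply hx
      have := eval₂_eq_zero_of_dvd_of_eval₂_eq_zero (RingHom.id L) x (RatFunc.denom_div_dvd f₁ f₂) hz
      rwa [eval₂_id] at this) (by simp [RatFunc.denom_algebraMap])
  rw [div_mul_cancel₀ _ h0, e1, e1] at h
  unfold ratEval
  rw [eq_div_iff hx, h]

theorem crit (q c : ℕ) (hK : Fintype.card K = q) (hL : Fintype.card L = q ^ 4)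
    (S : Finset K[X]) (hSc : S.card ≤ c)
    (hS : ∀ s ∈ S, Irreducible s ∧ s ∣ X ^ 4 - 1)
    (hall : ∀ P : K[X], Irreducible P → P ∣ X ^ 4 - 1 → ∃ s ∈ S, P ∣ s)
    (C R : Finset ℕ) (hCR : Disjoint C R) (hun : C ∪ R = (q ^ 4 - 1).primeFactors)
    (δ : ℝ) (hδ : δ = 1 - 2 * ∑ p ∈ R, 1 / (p:ℝ)) (hδ0 : 0 ≤ δ)
    (hineq : (c:ℝ) * (q + 2 ^ C.card) <
      theta C * (δ * q ^ 2 - 5 * (2 ^ C.card) ^ 2 * (2 * δ + 2 * R.card - 1)))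
    (f : RatFunc L) (hf : f ∈ Upsilon L 3 2) :
    ∃ α : L, IsPrimitiveElem α ∧ IsNormalElem K 4 α ∧ IsPrimitiveElem (ratEval f α) := by
  classical
  obtain ⟨f₁, f₂, hf2, rfl, hd1, hd2, hco, k, g, hk, hg, hi, hgX, hkc, hd, hnd⟩ := hf
  have hf1 : f₁ ≠ 0 := by
    rintro rfl; apply hnd; rw [zero_mul]; exact dvd_zero _
  have hq2 : 2 ≤ q := by rw [← hK]; exact Fintype.one_lt_card
  have hq2' : (2:ℝ) ≤ q := by exact_mod_cast hq2
  have hQ : Fintype.card L = (q ^ 2) ^ 2 := by rw [hL]; ring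
  have hPD : ∀ p, p ∈ C ∪ R ↔ PrimeD L p := by
    intro p
    rw [hun, PrimeD, hL, Nat.mem_primeFactors]
    have : q ^ 4 - 1 ≠ 0 := by
      have : 2 ^ 4 ≤ q ^ 4 := Nat.pow_le_pow_left hq2 4
      omega
    tauto
  have hC : ∀ p ∈ C, PrimeD L p := fun p hp => (hPD p).1 (Finset.mem_union_left _ hp)
  have hR : ∀ p ∈ R, PrimeD L p := fun p hp => (hPD p).1 (Finset.mem_union_right _ hp)
  obtain ⟨Φ, hΦ, hΦc, hcov⟩ := cover (K := K) (L := L) (by rw [hL, hK]) S hS hall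
  by_contra hno
  have hθ := theta_pos C hC
  have hs := sieve (Aset f₁ f₂) (fun x => x) (fun x => f₁.eval x / f₂.eval x) (5 * ((q ^ 2 : ℕ) : ℝ))
    (fun x hx => (mem_Aset.1 hx).1) (fun x hx => div_ne_zero (mem_Aset.1 hx).2.1 (mem_Aset.1 hx).2.2)
    (fun χ₁ χ₂ h => hB_main (q ^ 2) (by nlinarith) hQ f₁ f₂ hf1 hf2 hd1 hd2 hco k g hk hg hi hgX hkc hd hnd χ₁ χ₂ h)
    C R hC hR hCR δ hδ hδ0
  have hA : (q:ℝ) ^ 4 ≤ (Aset f₁ f₂).card + 5 * ((q ^ 2 : ℕ) : ℝ) := by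
    have h1 := card_Aset hf1 hf2 hd1 hd2
    rw [hL] at h1
    have h2 : (q:ℝ) ^ 4 ≤ (Aset f₁ f₂).card + 6 := by exact_mod_cast h1
    push_cast
    nlinarith
  have hub : ∑ x ∈ Aset f₁ f₂, ww (C ∪ R) x * ww (C ∪ R) (f₁.eval x / f₂.eval x) ≤
      ∑ φ ∈ Φ, ∑ x ∈ (Hset φ).erase 0, ww C x := by
    have h1 : ∀ x ∈ Aset f₁ f₂, ww (C ∪ R) x * ww (C ∪ R) (f₁.eval x / f₂.eval x) ≤
        ∑ φ ∈ Φ, if x ∈ (Hset φ).erase 0 then ww C x else 0 := by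
      intro x hx
      rw [mem_Aset] at hx
      have hnn : ∀ φ ∈ Φ, 0 ≤ if x ∈ (Hset φ).erase 0 then ww C x else 0 := by
        intro φ _; split_ifs
        · exact ww_nonneg _ _
        · exact le_rfl
      by_cases hz : ww (C ∪ R) x * ww (C ∪ R) (f₁.eval x / f₂.eval x) = 0
      · rw [hz]; exact Finset.sum_nonneg hnn
      · have hz1 := left_ne_zero_of_mul hz
        have hz2 := right_ne_zero_of_mul hz
        have hnon : ¬ IsNormalElem K 4 x := by
          intro hnorm
          apply hno
          refine ⟨x, prim_of x hx.1 fun p hp => ww_ne_zero hz1 p ((hPD p).2 hp), hnorm, ?_⟩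
          have he := ratEval_div f₁ f₂ hf2 hx.2.2
          rw [he]
          exact prim_of _ (div_ne_zero hx.2.1 hx.2.2) fun p hp => ww_ne_zero hz2 p ((hPD p).2 hp)
        obtain ⟨φ, hφ, hφx⟩ := hcov x hnon
        refine le_trans ?_ (Finset.single_le_sum hnn hφ)
        rw [if_pos (Finset.mem_erase.2 ⟨hx.1, by simp [Hset, hφx]⟩)]
        calc _ ≤ ww (C ∪ R) x * 1 := mul_le_mul_of_nonneg_left (ww_le_one _ _) (ww_nonneg _ _)
          _ = ww C x * ww R x := by rw [mul_one]; unfold ww; rw [Finset.prod_union hCR]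
          _ ≤ ww C x * 1 := mul_le_mul_of_nonneg_left (ww_le_one _ _) (ww_nonneg _ _)
          _ = _ := mul_one _
    calc _ ≤ ∑ x ∈ Aset f₁ f₂, ∑ φ ∈ Φ, (if x ∈ (Hset φ).erase 0 then ww C x else 0) := Finset.sum_le_sum h1
      _ ≤ ∑ x : L, ∑ φ ∈ Φ, (if x ∈ (Hset φ).erase 0 then ww C x else 0) := by
        apply Finset.sum_le_sum_of_subset_of_nonneg (Finset.subset_univ _)
        intro x _ _
        apply Finset.sum_nonneg
        intro φ _; split_ifs
        · exact ww_nonneg _ _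
        · exact le_rfl
      _ = _ := by
        rw [Finset.sum_comm]
        refine Finset.sum_congr rfl fun φ _ => ?_
        rw [Finset.sum_ite_mem, Finset.univ_inter]
  have hub2 : ∑ φ ∈ Φ, ∑ x ∈ (Hset φ).erase 0, ww C x ≤ c * (theta C * (q ^ 3 + 2 ^ C.card * q ^ 2)) := by
    have hnn : 0 ≤ theta C * ((q:ℝ) ^ 3 + 2 ^ C.card * q ^ 2) := mul_nonneg hθ.le (by positivity)
    calc _ ≤ ∑ φ ∈ Φ, theta C * ((q:ℝ) ^ 3 + 2 ^ C.card * q ^ 2) := by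
          refine Finset.sum_le_sum fun φ hφ => ?_
          have h1 := ker_count (q ^ 2) hQ (hΦ φ hφ) C hC
          have h2 := card_Hset (hΦ φ hφ)
          rw [hK, hL] at h2
          have h3 : (Hset φ).card = q ^ 3 := by
            have : (Hset φ).card * q = q ^ 3 * q := by rw [h2]; ring
            exact Nat.eq_of_mul_eq_mul_right (by omega) this
          rw [h3] at h1
          push_cast at h1
          exact h1
      _ = Φ.card * (theta C * ((q:ℝ) ^ 3 + 2 ^ C.card * q ^ 2)) := by simp
      _ ≤ _ := by
        apply mul_le_mul_of_nonneg_right _ hnn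
        exact_mod_cast hΦc.trans hSc
  have hfin := hs.trans (hub.trans hub2)
  have hδA := mul_le_mul_of_nonneg_left hA hδ0
  push_cast at hfin hδA
  have h5 : theta C ^ 2 * (δ * q ^ 4 - 5 * q ^ 2 * (2 ^ C.card) ^ 2 * (2 * δ + 2 * R.card - 1)) ≤
      c * (theta C * (q ^ 3 + 2 ^ C.card * q ^ 2)) := by
    refine le_trans (mul_le_mul_of_nonneg_left ?_ (by positivity)) hfin
    linarith
  have h6 : (theta C * q ^ 2) * (theta C * (δ * q ^ 2 - 5 * (2 ^ C.card) ^ 2 * (2 * δ + 2 * R.card - 1))) ≤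
      (theta C * q ^ 2) * (c * (q + 2 ^ C.card)) := by
    linear_combination h5
  have h7 := le_of_mul_le_mul_left h6 (by positivity)
  linarith

end PL
end Stp

open Polynomial
set_option linter.unusedSectionVars false
namespace Stp
section PM

/-- numerical criterion -/
def Crit (q c : ℕ) : Prop := ∃ C R : Finset ℕ, Disjoint C R ∧ C ∪ R = (q ^ 4 - 1).primeFactors ∧
  0 ≤ 1 - 2 * ∑ p ∈ R, 1 / (p:ℝ) ∧
  (c:ℝ) * (q + 2 ^ C.card) < theta C * ((1 - 2 * ∑ p ∈ R, 1 / (p:ℝ)) * q ^ 2 -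
    5 * (2 ^ C.card) ^ 2 * (2 * (1 - 2 * ∑ p ∈ R, 1 / (p:ℝ)) + 2 * R.card - 1))

lemma memB_of_crit4 {q : ℕ} (h : Crit q 4) : memB 3 2 q 4 := by
  intro K L _ _ _ _ _ hK hL f hf
  obtain ⟨C, R, h1, h2, h3, h4⟩ := h
  obtain ⟨S, hS, _, hS2, hS3⟩ := cover_odd (K := K)
  exact crit q 4 hK hL S hS hS2 hS3 C R h1 h2 _ rfl h3 h4 f hf

lemma memB_of_crit3 {q : ℕ} (hq : q % 4 = 3) (h : Crit q 3) : memB 3 2 q 4 := by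
  intro K L _ _ _ _ _ hK hL f hf
  obtain ⟨C, R, h1, h2, h3, h4⟩ := h
  obtain ⟨S, _, hS, hS2, hS3⟩ := cover_odd (K := K)
  exact crit q 3 hK hL S (hS (by rw [hK, hq])) hS2 hS3 C R h1 h2 _ rfl h3 h4 f hf

lemma memB_of_crit1 {q : ℕ} (hq : q % 2 = 0) (h : Crit q 1) : memB 3 2 q 4 := by
  intro K L _ _ _ _ _ hK hL f hf
  obtain ⟨C, R, h1, h2, h3, h4⟩ := h
  obtain ⟨S, hS, hS2, hS3⟩ := cover_even (K := K) (by rw [hK, hq])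
  exact crit q 1 hK hL S hS hS2 hS3 C R h1 h2 _ rfl h3 h4 f hf

def ptest (p : ℕ) : Bool := decide (2 ≤ p) && (List.range 340).all fun d => decide (d < 2) || decide (p < d * d) || !decide (p % d = 0)

lemma ptest_prime {p : ℕ} (hp : p < 339 * 339) (h : ptest p = true) : p.Prime := by
  unfold ptest at h
  rw [Bool.and_eq_true, decide_eq_true_eq, List.all_eq_true] at h
  obtain ⟨h2, h⟩ := h
  by_contra hn
  have hm := Nat.minFac_sq_le_self (by omega) hn
  have hm1 : 2 ≤ p.minFac := (Nat.minFac_prime (by omega)).two_le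
  have hlt : p.minFac < 340 := by nlinarith
  have := h p.minFac (List.mem_range.2 hlt)
  have hd : p % p.minFac = 0 := Nat.mod_eq_zero_of_dvd (Nat.minFac_dvd p)
  simp only [hd, Bool.or_eq_true, decide_eq_true_eq] at this
  simp at this
  rcases this with h | h
  · omega
  · nlinarith

def dq (R : List ℕ) : ℚ := 1 - 2 * (R.map fun p : ℕ => 1 / (p:ℚ)).sum
def tq (C : List ℕ) : ℚ := (C.map fun p : ℕ => 1 - 1 / (p:ℚ)).prod

def chk (x : ℕ × ℕ × List ℕ × List ℕ) : Bool :=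
  let q := x.1; let c := x.2.1; let C := x.2.2.1; let R := x.2.2.2
  decide ((C ++ R).Nodup) && (C ++ R).all (fun p => decide (p < 339 * 339) && ptest p && decide (p ∣ q ^ 4 - 1)) &&
  decide (q ^ 4 - 1 ∣ (C ++ R).prod ^ 16) && decide (2 ≤ q) && decide (0 ≤ dq R) &&
  decide ((c:ℚ) * (q + 2 ^ C.length) < tq C * (dq R * q ^ 2 - 5 * (2 ^ C.length) ^ 2 * (2 * dq R + 2 * R.length - 1))) &&
  (decide (c = 4) || (decide (c = 3) && decide (q % 4 = 3)) || (decide (c = 1) && decide (q % 2 = 0)))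

lemma chk_memB (x : ℕ × ℕ × List ℕ × List ℕ) (h : chk x = true) : memB 3 2 x.1 4 := by
  obtain ⟨q, c, C, R⟩ := x
  simp only [chk, Bool.and_eq_true, decide_eq_true_eq, List.all_eq_true, Bool.or_eq_true] at h
  obtain ⟨⟨⟨⟨⟨⟨hnd, hall⟩, hdv⟩, hq⟩, hd0⟩, hin⟩, hc⟩ := h
  have hcrit : Crit q c := by
    have hq1 : q ^ 4 - 1 ≠ 0 := by
      have : 2 ^ 4 ≤ q ^ 4 := Nat.pow_le_pow_left hq 4
      omega
    rw [List.nodup_append'] at hnd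
    obtain ⟨hC, hR, hdis⟩ := hnd
    have hsum : 1 - 2 * ∑ p ∈ R.toFinset, 1 / (p:ℝ) = ((dq R : ℚ) : ℝ) := by
      rw [List.sum_toFinset _ hR, dq]
      push_cast
      rw [List.map_map]
      congr 3
      apply List.map_congr_left
      intro a _; simp
    have hprod : theta C.toFinset = ((tq C : ℚ) : ℝ) := by
      rw [theta, List.prod_toFinset _ hC, tq]
      push_cast
      rw [List.map_map]
      congr 1
      apply List.map_congr_left
      intro a _; simp
    refine ⟨C.toFinset, R.toFinset, ?_, ?_, ?_, ?_⟩
    · rw [Finset.disjoint_left]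
      intro a ha hb
      exact hdis (List.mem_toFinset.1 ha) (List.mem_toFinset.1 hb)
    · ext p
      rw [← List.toFinset_append, List.mem_toFinset, Nat.mem_primeFactors]
      constructor
      · intro hp
        have := hall p hp
        exact ⟨ptest_prime this.1.1 this.1.2, this.2, hq1⟩
      · rintro ⟨hp, hpd, _⟩
        have h1 := hp.dvd_of_dvd_pow (hpd.trans hdv)
        obtain ⟨a, ha, hpa⟩ := (hp.prime.dvd_prod_iff).1 h1
        have := hall a ha
        rwa [(Nat.prime_dvd_prime_iff_eq hp (ptest_prime this.1.1 this.1.2)).1 hpa]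
    · rw [hsum]; exact_mod_cast hd0
    · rw [hsum, hprod, List.toFinset_card_of_nodup hC, List.toFinset_card_of_nodup hR]
      exact_mod_cast hin
  rcases hc with (rfl | ⟨rfl, h⟩) | ⟨rfl, h⟩
  · exact memB_of_crit4 hcrit
  · exact memB_of_crit3 h hcrit
  · exact memB_of_crit1 h hcrit

def data : List (ℕ × ℕ × List ℕ × List ℕ) :=
  [(32, 1, [3], [5, 11, 31, 41]),
   (49, 4, [2, 3], [5, 1201]),
   (53, 4, [2, 3], [5, 13, 281]),
   (59, 3, [2, 3], [5, 29, 1741]),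
   (61, 4, [2, 3], [5, 31, 1861]),
   (64, 1, [3, 5], [7, 13, 17, 241]),
   (67, 3, [2, 3, 5], [11, 17, 449]),
   (71, 3, [2, 3, 5], [7, 2521]),
   (73, 4, [2, 3, 5], [13, 37, 41]),
   (79, 3, [2, 3, 5], [13, 3121]),
   (81, 4, [2, 5], [17, 41, 193]),
   (89, 4, [2, 3, 5], [11, 17, 233]),
   (97, 4, [2, 3, 5], [7, 941]),
   (101, 4, [2, 3, 5], [17, 5101]),
   (103, 3, [2, 3, 5], [13, 17, 1061]),
   (107, 3, [2, 3, 5], [53, 229]),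
   (109, 4, [2, 3, 5], [11, 13, 457]),
   (113, 4, [2, 3, 5], [7, 19, 1277]),
   (121, 4, [2, 3, 5], [61, 7321]),
   (125, 4, [2, 3, 7], [13, 31, 601]),
   (127, 3, [2, 3, 5], [7, 1613]),
   (128, 1, [3, 5], [29, 43, 113, 127]),
   (131, 3, [2, 3, 5], [11, 13, 8581]),
   (137, 4, [2, 3, 5], [17, 23, 1877]),
   (139, 3, [2, 3, 5], [7, 23, 9661]),
   (149, 4, [2, 3, 5], [17, 37, 653]),
   (151, 3, [2, 3, 5], [13, 19, 877]),
   (157, 4, [2, 3, 5], [13, 17, 29, 79]),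
   (163, 3, [2, 3, 5], [41, 2657]),
   (167, 3, [2, 3, 5], [7, 83, 2789]),
   (169, 4, [2, 3, 5, 7], [17, 14281]),
   (173, 4, [2, 3, 5], [29, 41, 43, 73]),
   (179, 3, [2, 3, 5], [37, 89, 433]),
   (181, 4, [2, 3, 5, 7], [13, 16381]),
   (191, 3, [2, 3, 5], [17, 19, 29, 37]),
   (193, 4, [2, 3, 5], [97, 149]),
   (197, 4, [2, 3, 5, 7], [11, 3881]),
   (199, 3, [2, 3, 5, 11], [19801]),
   (211, 3, [2, 3, 5, 7], [53, 113, 197]),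
   (223, 3, [2, 3, 5, 7], [37, 4973]),
   (227, 3, [2, 3, 5], [19, 113, 5153]),
   (229, 4, [2, 3, 5], [13, 19, 23, 2017]),
   (233, 4, [2, 3, 5], [13, 29, 61, 89]),
   (239, 3, [2, 3, 5, 7], [13, 17]),
   (241, 4, [2, 3, 5, 11], [113, 257]),
   (243, 3, [2, 5, 11], [61, 1181]),
   (251, 3, [2, 3, 5, 7], [17, 109]),
   (256, 1, [3, 5, 17], [257, 65537]),
   (257, 4, [2, 3, 5], [43, 1321]),
   (263, 3, [2, 3, 5, 11], [131, 6917]),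
   (269, 4, [2, 3, 5], [67, 97, 373]),
   (271, 3, [2, 3, 5, 17], [36721]),
   (277, 4, [2, 3, 5], [23, 139, 7673]),
   (281, 4, [2, 3, 5, 7], [13, 47, 3037]),
   (283, 3, [2, 3, 5], [47, 71, 8009]),
   (289, 4, [2, 3, 5], [29, 41761]),
   (293, 4, [2, 3, 5, 7], [17, 73, 101]),
   (307, 3, [2, 3, 5, 7], [11, 13, 17, 29]),
   (311, 3, [2, 3, 5, 13], [31, 137, 353]),
   (313, 4, [2, 3, 5, 13], [97, 101, 157]),
   (317, 4, [2, 3, 5, 13], [53, 79, 773])]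

lemma data_ok : data.all chk = true := by decide +kernel

def exc : List ℕ := [2, 4, 8, 16, 3, 9, 27, 5, 25, 7, 11, 13, 17, 19, 23, 29, 31, 37, 41, 43, 47, 83]

def ppf (q : ℕ) : Bool := [2, 3, 5, 7, 11, 13, 17].all fun a => !decide (a ∣ q) || decide (q ∣ a ^ 9)

lemma cov_ok : ((List.range 330).all fun q => decide (q < 2) || !ppf q || decide (q ∈ exc) ||
    decide (q ∈ data.map Prod.fst)) = true := by decide +kernel

lemma ppf_of {q : ℕ} (hq : IsPrimePow q) (h : q < 512) : ppf q = true := by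
  rw [ppf, List.all_eq_true]
  intro a ha
  have hap : a.Prime := by
    simp only [List.mem_cons, List.not_mem_nil, or_false] at ha
    rcases ha with rfl | rfl | rfl | rfl | rfl | rfl | rfl <;> norm_num
  rw [Bool.or_eq_true, decide_eq_true_eq, Bool.not_eq_true', decide_eq_false_iff_not]
  by_cases hd : a ∣ q
  · right
    rw [isPrimePow_nat_iff] at hq
    obtain ⟨p, k, hp, hk, rfl⟩ := hq
    have : a = p := (Nat.prime_dvd_prime_iff_eq hap hp).1 (hap.dvd_of_dvd_pow hd)
    subst this
    apply pow_dvd_pow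
    by_contra hk9
    have h1 : 2 ^ 9 ≤ a ^ k := (Nat.pow_le_pow_left hap.two_le 9).trans (Nat.pow_le_pow_right hap.pos (by omega))
    omega
  · exact Or.inl hd

lemma small_q {q : ℕ} (hq : IsPrimePow q) (h : q < 330) (hex : q ∉ exc) : memB 3 2 q 4 := by
  have h1 := List.all_eq_true.1 cov_ok q (List.mem_range.2 h)
  simp only [Bool.or_eq_true, decide_eq_true_eq, Bool.not_eq_true'] at h1
  rcases h1 with ((h1 | h1) | h1) | h1
  · have := hq.one_lt; omega
  · rw [ppf_of hq (by omega)] at h1; simp at h1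
  · exact absurd h1 hex
  · obtain ⟨x, hx, rfl⟩ := List.mem_map.1 h1
    exact chk_memB x (List.all_eq_true.1 data_ok x hx)

end PM
end Stp

open Polynomial
set_option linter.unusedSectionVars false
namespace Stp
section PN

lemma k_smallest (S : Finset ℕ) (k : ℕ) (hk : k ≤ S.card) :
    ∃ C ⊆ S, C.card = k ∧ ∀ a ∈ C, ∀ b ∈ S \ C, a < b := by
  induction k with
  | zero => exact ⟨∅, Finset.empty_subset _, rfl, by simp⟩
  | succ k ih =>
    obtain ⟨C, hCS, hc, h⟩ := ih (by omega)
    have hne : (S \ C).Nonempty := by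
      rw [← Finset.card_pos, Finset.card_sdiff_of_subset hCS]; omega
    set m := (S \ C).min' hne with hm
    have hmem : m ∈ S \ C := Finset.min'_mem _ _
    rw [Finset.mem_sdiff] at hmem
    refine ⟨insert m C, ?_, ?_, ?_⟩
    · intro x hx
      rcases Finset.mem_insert.1 hx with rfl | hx
      · exact hmem.1
      · exact hCS hx
    · rw [Finset.card_insert_of_notMem hmem.2, hc]
    · intro a ha b hb
      rw [Finset.mem_sdiff, Finset.mem_insert, not_or] at hb
      have hb' : b ∈ S \ C := Finset.mem_sdiff.2 ⟨hb.1, hb.2.2⟩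
      rcases Finset.mem_insert.1 ha with rfl | ha
      · exact lt_of_le_of_ne (Finset.min'_le _ _ hb') (fun h => hb.2.1 h.symm)
      · exact h a ha b hb'

lemma exch_prod (S U : Finset ℕ) (g : ℕ → ℝ) (hS : ∀ x ∈ S, 0 < g x) (hU : ∀ x ∈ U, 0 < g x)
    (h1 : ∀ x ∈ U, g x ≤ 1) (h2 : ∀ x ∈ S, x ∉ U → 1 ≤ g x) : ∏ x ∈ U, g x ≤ ∏ x ∈ S, g x := by
  rw [← Finset.prod_inter_mul_prod_sdiff U S, ← Finset.prod_inter_mul_prod_sdiff S U, Finset.inter_comm S U]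
  have a1 : 0 < ∏ x ∈ U ∩ S, g x := Finset.prod_pos fun x hx => hU x (Finset.mem_inter.1 hx).1
  have a2 : ∏ x ∈ U \ S, g x ≤ 1 := Finset.prod_le_one (fun x hx => (hU x (Finset.mem_sdiff.1 hx).1).le)
    (fun x hx => h1 x (Finset.mem_sdiff.1 hx).1)
  have a3 : 1 ≤ ∏ x ∈ S \ U, g x := by
    have : ∏ x ∈ S \ U, (1:ℝ) ≤ ∏ x ∈ S \ U, g x := Finset.prod_le_prod (fun _ _ => zero_le_one)
      (fun x hx => h2 x (Finset.mem_sdiff.1 hx).1 (Finset.mem_sdiff.1 hx).2)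
    simpa using this
  exact mul_le_mul_of_nonneg_left (a2.trans a3) a1.le

lemma exch_sum (S U : Finset ℕ) (g : ℕ → ℝ)
    (h1 : ∀ x ∈ U, 0 ≤ g x) (h2 : ∀ x ∈ S, x ∉ U → g x ≤ 0) : ∑ x ∈ S, g x ≤ ∑ x ∈ U, g x := by
  rw [← Finset.sum_inter_add_sum_sdiff U S, ← Finset.sum_inter_add_sum_sdiff S U, Finset.inter_comm S U]
  have a2 : 0 ≤ ∑ x ∈ U \ S, g x := Finset.sum_nonneg fun x hx => h1 x (Finset.mem_sdiff.1 hx).1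
  have a3 : ∑ x ∈ S \ U, g x ≤ 0 := Finset.sum_nonpos fun x hx => h2 x (Finset.mem_sdiff.1 hx).1 (Finset.mem_sdiff.1 hx).2
  linarith

lemma prim_bound (S U : Finset ℕ) (M : ℕ) (hM : 0 < M) (hS : ∀ p ∈ S, p.Prime) (hU : ∀ p ∈ U, 0 < p ∧ p ≤ M)
    (hSU : ∀ p, p.Prime → p ∉ U → M ≤ p) :
    (∏ p ∈ U, (p:ℝ)) * (M:ℝ) ^ S.card ≤ (∏ p ∈ S, (p:ℝ)) * (M:ℝ) ^ U.card := by
  have hM' : (0:ℝ) < M := by exact_mod_cast hM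
  have h := exch_prod S U (fun p => (p:ℝ) / M) (fun x hx => div_pos (by exact_mod_cast (hS x hx).pos) hM')
    (fun x hx => div_pos (by exact_mod_cast (hU x hx).1) hM')
    (fun x hx => (div_le_one hM').2 (by exact_mod_cast (hU x hx).2))
    (fun x hx hxU => (one_le_div hM').2 (by exact_mod_cast hSU x (hS x hx) hxU))
  rw [Finset.prod_div_distrib, Finset.prod_div_distrib, Finset.prod_const, Finset.prod_const,
    div_le_div_iff₀ (by positivity) (by positivity)] at h
  exact h

lemma theta_bound (C U : Finset ℕ) (M : ℕ) (hM : 1 < M) (hC : ∀ p ∈ C, p.Prime) (hU : ∀ p ∈ U, 1 < p ∧ p ≤ M)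
    (hSU : ∀ p, p.Prime → p ∉ U → M ≤ p) (hc : C.card ≤ U.card) : theta U ≤ theta C := by
  have hM' : (1:ℝ) < M := by exact_mod_cast hM
  set m : ℝ := 1 - 1 / M with hm
  have hm0 : 0 < m := by
    rw [hm, sub_pos, div_lt_one (by linarith)]; exact hM'
  have hm1 : m ≤ 1 := by
    have : 0 ≤ 1 / (M:ℝ) := by positivity
    linarith
  have pos : ∀ x : ℕ, 1 < x → 0 < 1 - 1 / (x:ℝ) := by
    intro x hx
    have : (1:ℝ) < x := by exact_mod_cast hx
    rw [sub_pos, div_lt_one (by linarith)]; exact this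
  have h := exch_prod C U (fun p => (1 - 1 / (p:ℝ)) / m) (fun x hx => div_pos (pos x (hC x hx).one_lt) hm0)
    (fun x hx => div_pos (pos x (hU x hx).1) hm0)
    (fun x hx => (div_le_one hm0).2 (by
      have h1 : (0:ℝ) < x := by exact_mod_cast (hU x hx).1.le
      have h2 : (x:ℝ) ≤ M := by exact_mod_cast (hU x hx).2
      have := one_div_le_one_div_of_le h1 h2
      rw [hm]; linarith))
    (fun x hx hxU => (one_le_div hm0).2 (by
      have h2 : (M:ℝ) ≤ x := by exact_mod_cast hSU x (hC x hx) hxU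
      have := one_div_le_one_div_of_le (by linarith) h2
      rw [hm]; linarith))
  rw [Finset.prod_div_distrib, Finset.prod_div_distrib, Finset.prod_const, Finset.prod_const,
    div_le_div_iff₀ (by positivity) (by positivity)] at h
  have h3 : m ^ U.card ≤ m ^ C.card := pow_le_pow_of_le_one hm0.le hm1 hc
  have hθC : 0 ≤ theta C := Finset.prod_nonneg fun x hx => (pos x (hC x hx).one_lt).le
  have h4 : theta U * m ^ C.card ≤ theta C * m ^ C.card :=
    h.trans (mul_le_mul_of_nonneg_left h3 hθC)
  exact le_of_mul_le_mul_right h4 (by positivity)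

lemma sum_bound (R T : Finset ℕ) (M : ℕ) (hM : 0 < M) (hT : ∀ p ∈ T, 0 < p ∧ p ≤ M)
    (hR : ∀ p ∈ R, p ∉ T → M ≤ p) (hc : R.card ≤ T.card) : ∑ p ∈ R, 1 / (p:ℝ) ≤ ∑ p ∈ T, 1 / (p:ℝ) := by
  have hM' : (0:ℝ) < M := by exact_mod_cast hM
  have h := exch_sum R T (fun p => 1 / (p:ℝ) - 1 / M)
    (fun x hx => by
      have h1 : (0:ℝ) < x := by exact_mod_cast (hT x hx).1
      have h2 : (x:ℝ) ≤ M := by exact_mod_cast (hT x hx).2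
      have := one_div_le_one_div_of_le h1 h2
      linarith)
    (fun x hx hxU => by
      have h2 : (M:ℝ) ≤ x := by exact_mod_cast hR x hx hxU
      have := one_div_le_one_div_of_le hM' h2
      linarith)
  rw [Finset.sum_sub_distrib, Finset.sum_sub_distrib, Finset.sum_const, Finset.sum_const, nsmul_eq_mul, nsmul_eq_mul] at h
  have h3 : (R.card:ℝ) * (1 / M) ≤ T.card * (1 / M) :=
    mul_le_mul_of_nonneg_right (by exact_mod_cast hc) (by positivity)
  linarith

def U4 : Finset ℕ := {2, 3, 5, 7}
def U5 : Finset ℕ := {2, 3, 5, 7, 11}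
def U12 : Finset ℕ := {2, 3, 5, 7, 11, 13, 17, 19, 23, 29, 31, 37}
def U19 : Finset ℕ := {2, 3, 5, 7, 11, 13, 17, 19, 23, 29, 31, 37, 41, 43, 47, 53, 59, 61, 67}
def T4 : Finset ℕ := {11, 13, 17, 19, 23, 29, 31}
def T5 : Finset ℕ := {13, 17, 19, 23, 29, 31, 37, 41, 43, 47, 53, 59, 61}

lemma mem_U19 {p : ℕ} (hp : p.Prime) (h : p ≤ 67) : p ∈ U19 := by
  interval_cases p <;> first | decide | (exfalso; revert hp; norm_num)

lemma mem_U12 {p : ℕ} (hp : p.Prime) (h : p ≤ 37) : p ∈ U12 := by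
  interval_cases p <;> first | decide | (exfalso; revert hp; norm_num)

lemma mem_U5 {p : ℕ} (hp : p.Prime) (h : p ≤ 11) : p ∈ U5 := by
  interval_cases p <;> first | decide | (exfalso; revert hp; norm_num)

lemma mem_U4 {p : ℕ} (hp : p.Prime) (h : p ≤ 7) : p ∈ U4 := by
  interval_cases p <;> first | decide | (exfalso; revert hp; norm_num)

lemma mem_T4 {p : ℕ} (hp : p.Prime) (h : p ≤ 31) (h8 : 8 ≤ p) : p ∈ T4 := by
  interval_cases p <;> first | decide | (exfalso; revert hp; norm_num)

lemma mem_T5 {p : ℕ} (hp : p.Prime) (h : p ≤ 61) (h8 : 12 ≤ p) : p ∈ T5 := by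
  interval_cases p <;> first | decide | (exfalso; revert hp; norm_num)

lemma large4 {C : Finset ℕ} (hC : ∀ p ∈ C, p.Prime) (hc : C.card = 4) {b : ℕ}
    (hb : ∀ a ∈ C, a < b) (hbp : b.Prime) : 8 ≤ b := by
  by_contra h
  have hb7 : b ∈ U4 := mem_U4 hbp (by omega)
  have : C ⊆ U4.erase b := by
    intro a ha
    rw [Finset.mem_erase]
    exact ⟨(hb a ha).ne, mem_U4 (hC a ha) (by have := hb a ha; omega)⟩
  have := Finset.card_le_card this
  rw [Finset.card_erase_of_mem hb7, hc] at this
  revert this; decide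

lemma large5 {C : Finset ℕ} (hC : ∀ p ∈ C, p.Prime) (hc : C.card = 5) {b : ℕ}
    (hb : ∀ a ∈ C, a < b) (hbp : b.Prime) : 12 ≤ b := by
  by_contra h
  have hb7 : b ∈ U5 := mem_U5 hbp (by omega)
  have : C ⊆ U5.erase b := by
    intro a ha
    rw [Finset.mem_erase]
    exact ⟨(hb a ha).ne, mem_U5 (hC a ha) (by have := hb a ha; omega)⟩
  have := Finset.card_le_card this
  rw [Finset.card_erase_of_mem hb7, hc] at this
  revert this; decide

lemma theta_U4 : theta U4 = 8 / 35 := by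
  unfold theta U4; simp; norm_num

lemma theta_U5 : theta U5 = 16 / 77 := by
  unfold theta U5; simp; norm_num

lemma sum_T4 : 1 - 2 * ∑ p ∈ T4, 1 / (p:ℝ) ≥ 0.22 := by
  unfold T4; simp; norm_num

lemma sum_T5 : 1 - 2 * ∑ p ∈ T5, 1 / (p:ℝ) ≥ 0.1 := by
  unfold T5; simp; norm_num

lemma prod_U12 : ∏ p ∈ U12, (p:ℝ) = 7420738134810 := by
  unfold U12; simp; norm_num

lemma prod_U19 : ∏ p ∈ U19, (p:ℝ) = 7858321551080267055879090 := by
  unfold U19; simp; norm_num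

lemma core (θ θ₀ δ δ₀ W r r₀ q : ℝ) (hθ : θ₀ ≤ θ) (h0 : 0 < θ₀) (hδ : δ₀ ≤ δ) (hq : 10 * W ^ 2 ≤ q ^ 2) (hr : r ≤ r₀)
    (hpos : 0 ≤ δ₀ * (q ^ 2 - 10 * W ^ 2) - 5 * W ^ 2 * (2 * r₀ - 1))
    (h : 4 * (q + W) < θ₀ * (δ₀ * (q ^ 2 - 10 * W ^ 2) - 5 * W ^ 2 * (2 * r₀ - 1))) :
    4 * (q + W) < θ * (δ * q ^ 2 - 5 * W ^ 2 * (2 * δ + 2 * r - 1)) := by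
  refine h.trans_le ?_
  have h1 : δ₀ * (q ^ 2 - 10 * W ^ 2) - 5 * W ^ 2 * (2 * r₀ - 1) ≤ δ * q ^ 2 - 5 * W ^ 2 * (2 * δ + 2 * r - 1) := by
    have a1 := mul_le_mul_of_nonneg_right hδ (sub_nonneg.2 hq)
    have a2 := mul_le_mul_of_nonneg_left hr (by positivity : 0 ≤ 10 * W ^ 2)
    nlinarith
  exact mul_le_mul hθ h1 hpos (h0.le.trans hθ)

lemma big_q {q : ℕ} (hq : 330 ≤ q) : Crit q 4 := by
  set S := (q ^ 4 - 1).primeFactors with hS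
  have hSp : ∀ p ∈ S, p.Prime := fun p hp => Nat.prime_of_mem_primeFactors hp
  have hq' : (330:ℝ) ≤ q := by exact_mod_cast hq
  have hprod : ∏ p ∈ S, (p:ℝ) ≤ (q:ℝ) ^ 4 := by
    have h4 : 330 ^ 4 ≤ q ^ 4 := Nat.pow_le_pow_left hq 4
    have := Nat.le_of_dvd (by omega) (Nat.prod_primeFactors_dvd (q ^ 4 - 1))
    have h2 : ∏ p ∈ S, p ≤ q ^ 4 := this.trans (Nat.sub_le _ _)
    have h3 : ((∏ p ∈ S, p : ℕ) : ℝ) ≤ ((q ^ 4 : ℕ) : ℝ) := Nat.cast_le.2 h2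
    rw [Nat.cast_prod, Nat.cast_pow] at h3
    exact h3
  rcases le_or_gt S.card 4 with h4 | h4
  · -- everything in the core
    refine ⟨S, ∅, by simp, by simp [hS], by simp, ?_⟩
    simp only [Finset.sum_empty, Finset.card_empty]
    have hθ := theta_bound S U4 7 (by norm_num) hSp (by decide) (fun p hp hn => by
      by_contra hh; exact hn (mem_U4 hp (by omega))) (h4.trans (by decide))
    rw [theta_U4] at hθ
    have hW : (2:ℝ) ^ S.card ≤ 16 := by
      calc (2:ℝ) ^ S.card ≤ 2 ^ 4 := pow_le_pow_right₀ (by norm_num) h4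
        _ = 16 := by norm_num
    have hW0 : (0:ℝ) < 2 ^ S.card := by positivity
    set W : ℝ := 2 ^ S.card
    have h1 : (q:ℝ) ^ 2 - 1280 ≤ (1 - 2 * 0) * q ^ 2 - 5 * W ^ 2 * (2 * (1 - 2 * 0) + 2 * ((0:ℕ):ℝ) - 1) := by
      push_cast; nlinarith
    have h2 : 0 ≤ (q:ℝ) ^ 2 - 1280 := by nlinarith
    have h3 := mul_le_mul hθ h1 h2 (le_trans (by norm_num) hθ)
    refine lt_of_lt_of_le ?_ h3
    push_cast
    nlinarith
  rcases le_or_gt S.card 11 with h11 | h11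
  · obtain ⟨C, hCS, hc, hlt⟩ := k_smallest S 4 (by omega)
    have hCp : ∀ p ∈ C, p.Prime := fun p hp => hSp p (hCS hp)
    have hRc : (S \ C).card ≤ 7 := by rw [Finset.card_sdiff_of_subset hCS]; omega
    have hsum := sum_bound (S \ C) T4 31 (by norm_num) (by decide) (fun p hp hn => by
      by_contra hh
      have hpS := hSp p (Finset.mem_sdiff.1 hp).1
      exact hn (mem_T4 hpS (by omega) (large4 hCp hc (fun a ha => hlt a ha p hp) hpS))) hRc
    have hδ := sum_T4
    have hθ := theta_bound C U4 7 (by norm_num) hCp (by decide) (fun p hp hn => by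
      by_contra hh; exact hn (mem_U4 hp (by omega))) (by rw [hc]; decide)
    rw [theta_U4] at hθ
    refine ⟨C, S \ C, Finset.disjoint_sdiff, Finset.union_sdiff_of_subset hCS, by linarith, ?_⟩
    rw [hc]
    have hr : ((S \ C).card : ℝ) ≤ 7 := by exact_mod_cast hRc
    push_cast
    refine core _ (8 / 35) _ 0.22 _ _ 7 _ hθ (by norm_num) (by linarith) (by nlinarith) hr (by nlinarith) (by nlinarith)
  have hq2 : 1650 ≤ (q:ℝ) := by
    have h := prim_bound S U12 37 (by norm_num) hSp (by decide) (fun p hp hn => by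
      by_contra hh; exact hn (mem_U12 hp (by omega)))
    rw [prod_U12] at h
    have h12 : U12.card = 12 := by decide
    rw [h12] at h
    have h37 : ((37:ℕ):ℝ) ^ 12 ≤ ((37:ℕ):ℝ) ^ S.card := pow_le_pow_right₀ (by norm_num) (by omega)
    have h5 : (7420738134810:ℝ) * ((37:ℕ):ℝ) ^ 12 ≤ (∏ p ∈ S, (p:ℝ)) * ((37:ℕ):ℝ) ^ 12 :=
      le_trans (mul_le_mul_of_nonneg_left h37 (by norm_num)) h
    have h6 := le_of_mul_le_mul_right h5 (by positivity)
    have h7 := h6.trans hprod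
    by_contra hh
    push Not at hh
    have : (q:ℝ) ^ 4 ≤ 1650 ^ 4 := pow_le_pow_left₀ (by positivity) hh.le 4
    norm_num at this
    linarith
  rcases le_or_gt S.card 18 with h18 | h18
  · obtain ⟨C, hCS, hc, hlt⟩ := k_smallest S 5 (by omega)
    have hCp : ∀ p ∈ C, p.Prime := fun p hp => hSp p (hCS hp)
    have hRc : (S \ C).card ≤ 13 := by rw [Finset.card_sdiff_of_subset hCS]; omega
    have hsum := sum_bound (S \ C) T5 61 (by norm_num) (by decide) (fun p hp hn => by
      by_contra hh
      have hpS := hSp p (Finset.mem_sdiff.1 hp).1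
      exact hn (mem_T5 hpS (by omega) (large5 hCp hc (fun a ha => hlt a ha p hp) hpS))) hRc
    have hδ := sum_T5
    have hθ := theta_bound C U5 11 (by norm_num) hCp (by decide) (fun p hp hn => by
      by_contra hh; exact hn (mem_U5 hp (by omega))) (by rw [hc]; decide)
    rw [theta_U5] at hθ
    refine ⟨C, S \ C, Finset.disjoint_sdiff, Finset.union_sdiff_of_subset hCS, by linarith, ?_⟩
    rw [hc]
    have hr : ((S \ C).card : ℝ) ≤ 13 := by exact_mod_cast hRc
    push_cast
    refine core _ (16 / 77) _ 0.1 _ _ 13 _ hθ (by norm_num) (by linarith) (by nlinarith) hr (by nlinarith) (by nlinarith)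
  · refine ⟨S, ∅, by simp, by simp [hS], by simp, ?_⟩
    simp only [Finset.sum_empty, Finset.card_empty]
    obtain ⟨n, hn⟩ : ∃ n, S.card = 19 + n := ⟨S.card - 19, by omega⟩
    have h := prim_bound S U19 67 (by norm_num) hSp (by decide) (fun p hp hn => by
      by_contra hh; exact hn (mem_U19 hp (by omega)))
    have h19 : U19.card = 19 := by decide
    rw [prod_U19, h19, hn, pow_add] at h
    have h5 : (7858321551080267055879090 * ((67:ℕ):ℝ) ^ n) * ((67:ℕ):ℝ) ^ 19 ≤ (∏ p ∈ S, (p:ℝ)) * ((67:ℕ):ℝ) ^ 19 := by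
      linarith
    have h6 := (le_of_mul_le_mul_right h5 (by positivity)).trans hprod
    have h67 : (16:ℝ) ^ n ≤ ((67:ℕ):ℝ) ^ n := pow_le_pow_left₀ (by norm_num) (by norm_num) n
    have h7 : (100:ℝ) * 16 ^ S.card ≤ q ^ 4 := by
      rw [hn, pow_add]
      have : (0:ℝ) < 16 ^ n := by positivity
      norm_num
      nlinarith
    set W : ℝ := 2 ^ S.card with hW
    have hW0 : 0 < W := by positivity
    have hW4 : (16:ℝ) ^ S.card = W ^ 4 := by
      rw [hW, ← pow_mul, mul_comm, pow_mul]; norm_num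
    rw [hW4] at h7
    have h8 : 10 * W ^ 2 ≤ (q:ℝ) ^ 2 := by
      have : (10 * W ^ 2) ^ 2 ≤ ((q:ℝ) ^ 2) ^ 2 := by linarith
      exact le_of_sq_le_sq this (by positivity)
    have h9 : 3 * W ≤ q := by
      have : (3 * W) ^ 2 ≤ (q:ℝ) ^ 2 := by nlinarith
      exact le_of_sq_le_sq this (by positivity)
    -- lower bound for theta
    have hθ : 1 / 2 * (2 / 3 : ℝ) ^ S.card ≤ theta S := by
      have e1 := exch_prod S {2} (fun p => (1 - 1 / (p:ℝ)) / (2 / 3)) (fun x hx => by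
          have : (2:ℝ) ≤ x := by exact_mod_cast (hSp x hx).two_le
          have : 1 / (x:ℝ) ≤ 1 / 2 := one_div_le_one_div_of_le (by norm_num) this
          apply div_pos _ (by norm_num)
          linarith) (by simp; norm_num) (by simp; norm_num) (fun x hx hn => by
          have h2 := (hSp x hx).two_le
          have h3 : 3 ≤ x := by
            rw [Finset.mem_singleton] at hn; omega
          have : (3:ℝ) ≤ x := by exact_mod_cast h3
          have : 1 / (x:ℝ) ≤ 1 / 3 := one_div_le_one_div_of_le (by norm_num) this
          rw [one_le_div (by norm_num)]
          linarith)
      rw [Finset.prod_singleton, Finset.prod_div_distrib, Finset.prod_const, le_div_iff₀ (by positivity)] at e1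
      refine le_trans ?_ e1
      have : (0:ℝ) < (2/3) ^ S.card := by positivity
      norm_num
    have h10 : (100:ℝ) ≤ (4 / 3 : ℝ) ^ S.card := by
      calc (100:ℝ) ≤ (4 / 3) ^ 19 := by norm_num
        _ ≤ _ := pow_le_pow_right₀ (by norm_num) (by omega)
    have h11 : (2 / 3 : ℝ) ^ S.card * W = (4 / 3) ^ S.card := by
      rw [hW, ← mul_pow]; norm_num
    have h12 : 300 ≤ (2 / 3 : ℝ) ^ S.card * q := by
      have : (0:ℝ) < (2/3) ^ S.card := by positivity
      nlinarith
    have hb : (q:ℝ) ^ 2 / 2 ≤ (1 - 2 * 0) * q ^ 2 - 5 * W ^ 2 * (2 * (1 - 2 * 0) + 2 * ((0:ℕ):ℝ) - 1) := by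
      push_cast; linarith
    have hfin := mul_le_mul hθ hb (by positivity) (le_trans (by positivity) hθ)
    refine lt_of_lt_of_le ?_ hfin
    push_cast
    have : 1 / 2 * (2 / 3 : ℝ) ^ S.card * ((q:ℝ) ^ 2 / 2) = ((2 / 3 : ℝ) ^ S.card * q) * q / 4 := by ring
    rw [this]
    nlinarith

end PN
end Stp


theorem stmt9 (q : ℕ) (hq : IsPrimePow q)
    (h : q ∉ ({2, 4, 8, 16, 3, 9, 27, 5, 25, 7, 11, 13, 17, 19, 23, 29, 31, 37, 41, 43,
      47, 83} : Finset ℕ)) :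
    memB 3 2 q 4 := by
  rcases lt_or_ge q 330 with h1 | h1
  · exact Stp.small_q hq h1 (by simpa [Stp.exc] using h)
  · exact Stp.memB_of_crit4 (Stp.big_q h1)
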